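/- Long-time behavior when the ergodic constant is positive: let m > 2, f ∈ C(Ω̄), u₀ ∈ C(Ω̄) and g ∈ C(∂Ω) with u₀ = g on ∂Ω, and let u be the unique continuous viscosity solution of E(Ω,f,g,u₀,0). Let c ∈ ℝ and u_∞ be an ergodic pair, i.e. u_∞ is a viscosity solution of Erg(Ω,f,c) which is Hölder continuous on Ω̄ with exponent (m−2)/(m−1) and locally Lipschitz in Ω. If c > 0, then: (a) the generalized Dirichlet problem S(Ω,f,g,0) has no bounded continuous viscosity solution; (b) the function (x,t) ↦ u(x,t) + ct is uniformly bounded on Ω̄ × [0,+∞); and (c) there exists a constant K₁ ∈ ℝ (depending on f, c, u₀ and g) such that u(·,t) + ct converges uniformly on Ω̄ to u_∞ + K₁ as t → +∞. -/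

import Mathlib

open Set Filter Topology Metric MeasureTheory

noncomputable section

/-- Euclidean space `ℝ^N`. -/
abbrev Euc (N : ℕ) : Type := EuclideanSpace ℝ (Fin N)

/-- The Laplacian of `φ` at `x`, computed as the trace of the second derivative
in the standard orthonormal basis of `ℝ^N`. -/
noncomputable def lapl {N : ℕ} (φ : Euc N → ℝ) (x : Euc N) : ℝ :=
  ∑ i : Fin N,
    iteratedFDeriv ℝ 2 φ x ![EuclideanSpace.single i 1, EuclideanSpace.single i 1]

/-- `Ω` is a domain with `C²` boundary: it is the sublevel set of a `C²`
defining function whose gradient does not vanish on the boundary. -/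
def HasC2Boundary {N : ℕ} (Ω : Set (Euc N)) : Prop :=
  ∃ ρ : Euc N → ℝ, ContDiff ℝ 2 ρ ∧ Ω = {x | ρ x < 0} ∧
    frontier Ω = {x | ρ x = 0} ∧ ∀ x ∈ frontier Ω, gradient ρ x ≠ 0

/-- The stationary operator `−Δφ(x) + |Dφ(x)|^m + λ r − h(x)` evaluated with the
value `r` of the (sub/super)solution at `x`. -/
noncomputable def statOp {N : ℕ} (h : Euc N → ℝ) (lam m : ℝ)
    (φ : Euc N → ℝ) (r : ℝ) (x : Euc N) : ℝ :=
  -lapl φ x + ‖gradient φ x‖ ^ m + lam * r - h x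

/-- Viscosity subsolution of the generalized Dirichlet problem
`S(Ω,h,k,λ)`: `−Δw + |Dw|^m + λ w = h` in `Ω`, `w = k` on `∂Ω`. -/
def IsStatSub {N : ℕ} (Ω : Set (Euc N)) (h k : Euc N → ℝ) (lam m : ℝ)
    (u : Euc N → ℝ) : Prop :=
  UpperSemicontinuousOn u (closure Ω) ∧
  ∀ φ : Euc N → ℝ, ContDiff ℝ 2 φ → ∀ x₀ ∈ closure Ω,
    IsLocalMaxOn (u - φ) (closure Ω) x₀ →
      (x₀ ∈ Ω → statOp h lam m φ (u x₀) x₀ ≤ 0) ∧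
      (x₀ ∈ frontier Ω → min (statOp h lam m φ (u x₀) x₀) (u x₀ - k x₀) ≤ 0)

/-- Viscosity supersolution of the generalized Dirichlet problem `S(Ω,h,k,λ)`. -/
def IsStatSuper {N : ℕ} (Ω : Set (Euc N)) (h k : Euc N → ℝ) (lam m : ℝ)
    (v : Euc N → ℝ) : Prop :=
  LowerSemicontinuousOn v (closure Ω) ∧
  ∀ φ : Euc N → ℝ, ContDiff ℝ 2 φ → ∀ x₀ ∈ closure Ω,
    IsLocalMinOn (v - φ) (closure Ω) x₀ →
      (x₀ ∈ Ω → 0 ≤ statOp h lam m φ (v x₀) x₀) ∧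
      (x₀ ∈ frontier Ω → 0 ≤ max (statOp h lam m φ (v x₀) x₀) (v x₀ - k x₀))

/-- The parabolic operator
`φ_t(x,t) − Δφ(·,t)(x) + |Dφ(·,t)(x)|^m + λ r − f(x)`. -/
noncomputable def parOp {N : ℕ} (f : Euc N → ℝ) (lam m : ℝ)
    (φ : Euc N × ℝ → ℝ) (r : ℝ) (x : Euc N) (t : ℝ) : ℝ :=
  deriv (fun s => φ (x, s)) t - lapl (fun y => φ (y, t)) x
    + ‖gradient (fun y => φ (y, t)) x‖ ^ m + lam * r - f x

/-- Viscosity subsolution of the generalized initial-boundary value problem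
`E(Ω,f,g,u₀,λ)` on the time interval `[0,T]`:
`u_t − Δu + |Du|^m + λ u = f` in `Ω × (0,T]`, `u = g` on `∂Ω × (0,T]`,
`u(·,0) = u₀` on `closure Ω`. -/
def IsParSub {N : ℕ} (Ω : Set (Euc N)) (f g u₀ : Euc N → ℝ) (lam m T : ℝ)
    (u : Euc N → ℝ → ℝ) : Prop :=
  UpperSemicontinuousOn (fun p : Euc N × ℝ => u p.1 p.2) (closure Ω ×ˢ Ico 0 T) ∧
  (∀ x ∈ closure Ω, u x 0 ≤ u₀ x) ∧
  ∀ φ : Euc N × ℝ → ℝ, ContDiff ℝ 2 φ → ∀ x₀ : Euc N, ∀ t₀ : ℝ,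
    (x₀, t₀) ∈ closure Ω ×ˢ Ioc 0 T →
    IsLocalMaxOn (fun p : Euc N × ℝ => u p.1 p.2 - φ p) (closure Ω ×ˢ Ioc 0 T) (x₀, t₀) →
      (x₀ ∈ Ω → parOp f lam m φ (u x₀ t₀) x₀ t₀ ≤ 0) ∧
      (x₀ ∈ frontier Ω →
        min (parOp f lam m φ (u x₀ t₀) x₀ t₀) (u x₀ t₀ - g x₀) ≤ 0)

/-- Viscosity supersolution of `E(Ω,f,g,u₀,λ)` on the time interval `[0,T]`. -/
def IsParSuper {N : ℕ} (Ω : Set (Euc N)) (f g u₀ : Euc N → ℝ) (lam m T : ℝ)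
    (v : Euc N → ℝ → ℝ) : Prop :=
  LowerSemicontinuousOn (fun p : Euc N × ℝ => v p.1 p.2) (closure Ω ×ˢ Icc 0 T) ∧
  (∀ x ∈ closure Ω, u₀ x ≤ v x 0) ∧
  ∀ φ : Euc N × ℝ → ℝ, ContDiff ℝ 2 φ → ∀ x₀ : Euc N, ∀ t₀ : ℝ,
    (x₀, t₀) ∈ closure Ω ×ˢ Ioc 0 T →
    IsLocalMinOn (fun p : Euc N × ℝ => v p.1 p.2 - φ p) (closure Ω ×ˢ Ioc 0 T) (x₀, t₀) →
      (x₀ ∈ Ω → 0 ≤ parOp f lam m φ (v x₀ t₀) x₀ t₀) ∧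
      (x₀ ∈ frontier Ω →
        0 ≤ max (parOp f lam m φ (v x₀ t₀) x₀ t₀) (v x₀ t₀ - g x₀))

/-- A continuous viscosity solution, global in time, of `E(Ω,f,g,u₀,λ)`. -/
def IsGlobalParSol {N : ℕ} (Ω : Set (Euc N)) (f g u₀ : Euc N → ℝ) (lam m : ℝ)
    (u : Euc N → ℝ → ℝ) : Prop :=
  ContinuousOn (fun p : Euc N × ℝ => u p.1 p.2) (closure Ω ×ˢ Ici 0) ∧
  ∀ T > (0 : ℝ), IsParSub Ω f g u₀ lam m T u ∧ IsParSuper Ω f g u₀ lam m T u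

open scoped Classical in
/-- Redefinition of a parabolic subsolution on the lateral boundary by its
`limsup` from inside `Ω × (0,T]`. -/
noncomputable def uscExtPar {N : ℕ} (Ω : Set (Euc N)) (T : ℝ)
    (u : Euc N → ℝ → ℝ) : Euc N → ℝ → ℝ :=
  fun z t => if z ∈ Ω then u z t
    else limsup (fun p : Euc N × ℝ => u p.1 p.2) (𝓝[Ω ×ˢ Ioc 0 T] (z, t))

open scoped Classical in
/-- Redefinition of a stationary subsolution on the boundary by its `limsup`
from inside `Ω`. -/
noncomputable def uscExtStat {N : ℕ} (Ω : Set (Euc N))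
    (u : Euc N → ℝ) : Euc N → ℝ :=
  fun z => if z ∈ Ω then u z else limsup u (𝓝[Ω] z)

/-- Continuous viscosity solution of the state constraint problem
`−Δw + |Dw|^m + λ w = h` in `Ω`, `−Δw + |Dw|^m + λ w ≥ h` on `∂Ω`. -/
def IsSCSolution {N : ℕ} (Ω : Set (Euc N)) (h : Euc N → ℝ) (lam m : ℝ)
    (w : Euc N → ℝ) : Prop :=
  ContinuousOn w (closure Ω) ∧
  (∀ φ : Euc N → ℝ, ContDiff ℝ 2 φ → ∀ x₀ ∈ Ω, IsLocalMaxOn (w - φ) Ω x₀ →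
      statOp h lam m φ (w x₀) x₀ ≤ 0) ∧
  (∀ φ : Euc N → ℝ, ContDiff ℝ 2 φ → ∀ x₀ ∈ closure Ω,
      IsLocalMinOn (w - φ) (closure Ω) x₀ → 0 ≤ statOp h lam m φ (w x₀) x₀)

/-- Continuous viscosity subsolution of `−Δu + |Du|^m ≤ h` in `Ω`
(no boundary condition). -/
def IsIntSub {N : ℕ} (Ω : Set (Euc N)) (h : Euc N → ℝ) (m : ℝ)
    (u : Euc N → ℝ) : Prop :=
  ∀ φ : Euc N → ℝ, ContDiff ℝ 2 φ → ∀ x₀ ∈ Ω, IsLocalMaxOn (u - φ) Ω x₀ →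
    statOp h 0 m φ (u x₀) x₀ ≤ 0

/-- Hölder continuity with exponent `α` on a set. -/
def HolderOnCl {N : ℕ} (α : ℝ) (s : Set (Euc N)) (w : Euc N → ℝ) : Prop :=
  ∃ C > (0 : ℝ), ∀ x ∈ s, ∀ y ∈ s, |w x - w y| ≤ C * ‖x - y‖ ^ α

/-- Local Lipschitz continuity inside `Ω`. -/
def LocLipIn {N : ℕ} (Ω : Set (Euc N)) (w : Euc N → ℝ) : Prop :=
  ∀ x ∈ Ω, ∃ ε > (0 : ℝ), ∃ K : ℝ, 0 ≤ K ∧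
    ∀ y ∈ ball x ε ∩ Ω, ∀ z ∈ ball x ε ∩ Ω, |w y - w z| ≤ K * ‖y - z‖

/-- A piecewise `C¹` path parametrized on `[0,1]`. -/
def IsPWC1Path {N : ℕ} (γ : ℝ → Euc N) : Prop :=
  ContinuousOn γ (Icc 0 1) ∧
  ∃ n : ℕ, ∃ τ : Fin (n + 1) → ℝ, StrictMono τ ∧ τ 0 = 0 ∧ τ (Fin.last n) = 1 ∧
    ∀ i : Fin n, ContDiffOn ℝ 1 γ (Icc (τ i.castSucc) (τ i.succ))

/-- The length of a path on `[0,1]`. -/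
noncomputable def pathLen {N : ℕ} (γ : ℝ → Euc N) : ℝ :=
  ∫ t in (0 : ℝ)..1, ‖derivWithin γ (Icc (0 : ℝ) 1) t‖

/-- The geodesic-type distance inside `closure S` via piecewise `C¹` paths. -/
noncomputable def dTilde {N : ℕ} (S : Set (Euc N)) (x y : Euc N) : ℝ :=
  sInf {L : ℝ | ∃ γ : ℝ → Euc N, IsPWC1Path γ ∧ γ 0 = x ∧ γ 1 = y ∧
    MapsTo γ (Icc 0 1) (closure S) ∧ L = pathLen γ}

/-- The inner parallel set `Ω_δ = {x ∈ Ω : dist(x,∂Ω) > δ}`. -/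
def innerSet {N : ℕ} (Ω : Set (Euc N)) (δ : ℝ) : Set (Euc N) :=
  {x ∈ Ω | δ < infDist x (frontier Ω)}

end


abbrev SpT (N : ℕ) : Type := Euc N × ℝ

noncomputable def eb {N : ℕ} (i : Fin N) : SpT N := (EuclideanSpace.single i 1, 0)

noncomputable def Dt {N : ℕ} (φ : SpT N → ℝ) (p : SpT N) : ℝ := fderiv ℝ φ p (0, 1)

noncomputable def Gd {N : ℕ} (φ : SpT N → ℝ) (p : SpT N) : Euc N →L[ℝ] ℝ :=
  (fderiv ℝ φ p).comp (ContinuousLinearMap.inl ℝ (Euc N) ℝ)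

noncomputable def Lpl {N : ℕ} (φ : SpT N → ℝ) (p : SpT N) : ℝ :=
  ∑ i : Fin N, fderiv ℝ (fderiv ℝ φ) p (eb i) (eb i)

noncomputable def pOp {N : ℕ} (m : ℝ) (φ : SpT N → ℝ) (p : SpT N) : ℝ :=
  Dt φ p - Lpl φ p + ‖Gd φ p‖ ^ m

lemma c2_diff {E F : Type*} [NormedAddCommGroup E] [NormedSpace ℝ E]
    [NormedAddCommGroup F] [NormedSpace ℝ F] {φ : E → F} (h : ContDiff ℝ 2 φ) :
    Differentiable ℝ φ := h.differentiable (by norm_num)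

lemma c2_diff2 {E F : Type*} [NormedAddCommGroup E] [NormedSpace ℝ E]
    [NormedAddCommGroup F] [NormedSpace ℝ F] {φ : E → F} (h : ContDiff ℝ 2 φ) :
    Differentiable ℝ (fderiv ℝ φ) :=
  (h.fderiv_right (m := 1) (by norm_num)).differentiable (by norm_num)

lemma c2_cont2 {E F : Type*} [NormedAddCommGroup E] [NormedSpace ℝ E]
    [NormedAddCommGroup F] [NormedSpace ℝ F] {φ : E → F} (h : ContDiff ℝ 2 φ) :
    Continuous (fderiv ℝ (fderiv ℝ φ)) :=
  ((h.fderiv_right (m := 1) (by norm_num)).fderiv_right (m := 0) (by norm_num)).continuous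

lemma sec_hasFDeriv {N : ℕ} {φ : SpT N → ℝ} (h : ContDiff ℝ 2 φ) (x : Euc N) (t : ℝ) :
    HasFDerivAt (fun y => φ (y, t)) (Gd φ (x, t)) x := by
  have h1 := (c2_diff h (x, t)).hasFDerivAt
  exact h1.comp x (hasFDerivAt_prodMk_left x t)

lemma lapl_eq_sum {N : ℕ} (φ : Euc N → ℝ) (x : Euc N) :
    lapl φ x = ∑ i : Fin N, fderiv ℝ (fderiv ℝ φ) x (EuclideanSpace.single i 1)
      (EuclideanSpace.single i 1) := by
  unfold lapl
  simp [iteratedFDeriv_two_apply]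

lemma lapl_sec {N : ℕ} {φ : SpT N → ℝ} (h : ContDiff ℝ 2 φ) (x : Euc N) (t : ℝ) :
    lapl (fun y => φ (y, t)) x = Lpl φ (x, t) := by
  rw [lapl_eq_sum, Lpl]
  have e : fderiv ℝ (fun y => φ (y, t)) = fun y => Gd φ (y, t) := by
    ext1 y; exact (sec_hasFDeriv h y t).fderiv
  rw [e]
  refine Finset.sum_congr rfl fun i _ => ?_
  have h2 := (c2_diff2 h (x, t)).hasFDerivAt
  have h3 := HasFDerivAt.comp (g := fderiv ℝ φ) (f := fun e : Euc N => (e, t)) x h2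
    (hasFDerivAt_prodMk_left (𝕜 := ℝ) x t)
  have h4 : HasFDerivAt (fun y => Gd φ (y, t))
    (((ContinuousLinearMap.compL ℝ (Euc N) (SpT N) ℝ).flip
      (ContinuousLinearMap.inl ℝ (Euc N) ℝ)).comp
      ((fderiv ℝ (fderiv ℝ φ) (x, t)).comp (ContinuousLinearMap.inl ℝ (Euc N) ℝ))) x := by
    exact (((ContinuousLinearMap.compL ℝ (Euc N) (SpT N) ℝ).flip
      (ContinuousLinearMap.inl ℝ (Euc N) ℝ)).hasFDerivAt).comp x h3
  rw [h4.fderiv]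
  simp [eb]

lemma norm_grad {N : ℕ} (φ : Euc N → ℝ) (x : Euc N) : ‖gradient φ x‖ = ‖fderiv ℝ φ x‖ := by
  simp [gradient]

lemma norm_grad_sec {N : ℕ} {φ : SpT N → ℝ} (h : ContDiff ℝ 2 φ) (x : Euc N) (t : ℝ) :
    ‖gradient (fun y => φ (y, t)) x‖ = ‖Gd φ (x, t)‖ := by
  rw [norm_grad, (sec_hasFDeriv h x t).fderiv]

lemma sec_hasDeriv {N : ℕ} {φ : SpT N → ℝ} (h : ContDiff ℝ 2 φ) (x : Euc N) (t : ℝ) :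
    HasDerivAt (fun s => φ (x, s)) (Dt φ (x, t)) t := by
  have h1 := (c2_diff h (x, t)).hasFDerivAt
  have h2 := h1.comp t (hasFDerivAt_prodMk_right x t)
  have := h2.hasDerivAt
  simpa [Dt, Function.comp_def] using this

lemma pOp_sec {N : ℕ} {φ : SpT N → ℝ} (h : ContDiff ℝ 2 φ) (m : ℝ) (x : Euc N) (t : ℝ) :
    pOp m φ (x, t) = deriv (fun s => φ (x, s)) t - lapl (fun y => φ (y, t)) x
      + ‖gradient (fun y => φ (y, t)) x‖ ^ m := by
  rw [(sec_hasDeriv h x t).deriv, lapl_sec h, norm_grad_sec h, pOp]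

lemma parOp_eq {N : ℕ} {φ : SpT N → ℝ} (h : ContDiff ℝ 2 φ) (f : Euc N → ℝ) (m r : ℝ)
    (x : Euc N) (t : ℝ) : parOp f 0 m φ r x t = pOp m φ (x, t) - f x := by
  rw [pOp_sec h, parOp]; ring

lemma statOp_sec {N : ℕ} {φ : SpT N → ℝ} (h : ContDiff ℝ 2 φ) (f : Euc N → ℝ) (m r : ℝ)
    (x : Euc N) (t : ℝ) : statOp f 0 m (fun y => φ (y, t)) r x
      = pOp m φ (x, t) - Dt φ (x, t) - f x := by
  rw [statOp, lapl_sec h, norm_grad_sec h, pOp]; ring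

/-! linear combinations -/

lemma fderiv_lc {N : ℕ} {φ ψ : SpT N → ℝ} (h : ContDiff ℝ 2 φ) (h' : ContDiff ℝ 2 ψ) (a b : ℝ)
    (p : SpT N) : fderiv ℝ (fun q => a * φ q + b * ψ q) p = a • fderiv ℝ φ p + b • fderiv ℝ ψ p :=
  (((c2_diff h p).hasFDerivAt.const_mul a).add ((c2_diff h' p).hasFDerivAt.const_mul b)).fderiv

lemma fderiv2_lc {N : ℕ} {φ ψ : SpT N → ℝ} (h : ContDiff ℝ 2 φ) (h' : ContDiff ℝ 2 ψ) (a b : ℝ)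
    (p : SpT N) : fderiv ℝ (fderiv ℝ (fun q => a * φ q + b * ψ q)) p =
      a • fderiv ℝ (fderiv ℝ φ) p + b • fderiv ℝ (fderiv ℝ ψ) p := by
  have : fderiv ℝ (fun q => a * φ q + b * ψ q) = fun p => a • fderiv ℝ φ p + b • fderiv ℝ ψ p := by
    ext1 q; exact fderiv_lc h h' a b q
  rw [this]
  exact (((c2_diff2 h p).hasFDerivAt.const_smul a).add
    ((c2_diff2 h' p).hasFDerivAt.const_smul b)).fderiv

lemma lc_c2 {N : ℕ} {φ ψ : SpT N → ℝ} (h : ContDiff ℝ 2 φ) (h' : ContDiff ℝ 2 ψ) (a b : ℝ) :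
    ContDiff ℝ 2 (fun q => a * φ q + b * ψ q) :=
  (contDiff_const.mul h).add (contDiff_const.mul h')

lemma Dt_lc {N : ℕ} {φ ψ : SpT N → ℝ} (h : ContDiff ℝ 2 φ) (h' : ContDiff ℝ 2 ψ) (a b : ℝ)
    (p : SpT N) : Dt (fun q => a * φ q + b * ψ q) p = a * Dt φ p + b * Dt ψ p := by
  simp [Dt, fderiv_lc h h']

lemma Gd_lc {N : ℕ} {φ ψ : SpT N → ℝ} (h : ContDiff ℝ 2 φ) (h' : ContDiff ℝ 2 ψ) (a b : ℝ)
    (p : SpT N) : Gd (fun q => a * φ q + b * ψ q) p = a • Gd φ p + b • Gd ψ p := by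
  simp [Gd, fderiv_lc h h', ContinuousLinearMap.add_comp, ContinuousLinearMap.smul_comp]

lemma Lpl_lc {N : ℕ} {φ ψ : SpT N → ℝ} (h : ContDiff ℝ 2 φ) (h' : ContDiff ℝ 2 ψ) (a b : ℝ)
    (p : SpT N) : Lpl (fun q => a * φ q + b * ψ q) p = a * Lpl φ p + b * Lpl ψ p := by
  simp [Lpl, fderiv2_lc h h', Finset.sum_add_distrib, Finset.mul_sum]

lemma Dt_cont {N : ℕ} {φ : SpT N → ℝ} (h : ContDiff ℝ 2 φ) : Continuous (Dt φ) := by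
  have := (h.fderiv_right (m := 1) (by norm_num)).continuous
  unfold Dt; fun_prop

lemma Gd_cont {N : ℕ} {φ : SpT N → ℝ} (h : ContDiff ℝ 2 φ) : Continuous (Gd φ) := by
  have := (h.fderiv_right (m := 1) (by norm_num)).continuous
  unfold Gd; fun_prop

lemma Lpl_cont {N : ℕ} {φ : SpT N → ℝ} (h : ContDiff ℝ 2 φ) : Continuous (Lpl φ) := by
  have := c2_cont2 h
  unfold Lpl; fun_prop

lemma pOp_cont {N : ℕ} {φ : SpT N → ℝ} (h : ContDiff ℝ 2 φ) {m : ℝ} (hm : 0 ≤ m) :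
    Continuous (pOp m φ) := by
  unfold pOp
  exact ((Dt_cont h).sub (Lpl_cont h)).add ((Gd_cont h).norm.rpow_const (fun _ => Or.inr hm))

/-! affine change of variables -/

lemma fderiv_aff {N : ℕ} {φ : SpT N → ℝ} (h : ContDiff ℝ 2 φ) (A : SpT N →L[ℝ] SpT N) (p z : SpT N) :
    fderiv ℝ (fun z => φ (p + A z)) z = (fderiv ℝ φ (p + A z)).comp A :=
  ((c2_diff h (p + A z)).hasFDerivAt.comp z (A.hasFDerivAt.const_add p)).fderiv

lemma fderiv2_aff {N : ℕ} {φ : SpT N → ℝ} (h : ContDiff ℝ 2 φ) (A : SpT N →L[ℝ] SpT N) (p z a b : SpT N) :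
    fderiv ℝ (fderiv ℝ (fun z => φ (p + A z))) z a b
      = fderiv ℝ (fderiv ℝ φ) (p + A z) (A a) (A b) := by
  have e : fderiv ℝ (fun z => φ (p + A z)) = fun z => (fderiv ℝ φ (p + A z)).comp A := by
    ext1 q; exact fderiv_aff h A p q
  rw [e]
  have h3 := (c2_diff2 h (p + A z)).hasFDerivAt.comp z (A.hasFDerivAt.const_add p)
  have h4 := (((ContinuousLinearMap.compL ℝ (SpT N) (SpT N) ℝ).flip A).hasFDerivAt).comp z h3
  have h5 : HasFDerivAt (fun z => (fderiv ℝ φ (p + A z)).comp A)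
    (((ContinuousLinearMap.compL ℝ (SpT N) (SpT N) ℝ).flip A).comp
      ((fderiv ℝ (fderiv ℝ φ) (p + A z)).comp A)) z := h4
  rw [h5.fderiv]; simp

/-! second derivative test -/

lemma second_deriv_nonpos {g : ℝ → ℝ} (hg : ContDiff ℝ 2 g) {a : ℝ} (h : IsLocalMax g a) :
    deriv (deriv g) a ≤ 0 := by
  by_contra hc
  push Not at hc
  have h0 : deriv g a = 0 := h.deriv_eq_zero
  have hmin : IsLocalMin g a := isLocalMin_of_deriv_deriv_pos hc h0 hg.continuous.continuousAt
  have hconst : g =ᶠ[𝓝 a] fun _ => g a := by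
    filter_upwards [h, hmin] with x h1 h2 using le_antisymm h1 h2
  have h1 : deriv g =ᶠ[𝓝 a] deriv (fun _ => g a) := hconst.deriv
  have h2 := h1.deriv_eq
  simp at h2
  linarith

lemma line_second {N : ℕ} {θ : SpT N → ℝ} (h : ContDiff ℝ 2 θ) (p v : SpT N) :
    deriv (deriv (fun s : ℝ => θ (p + s • v))) 0 = fderiv ℝ (fderiv ℝ θ) p v v := by
  have hl : ∀ s : ℝ, HasDerivAt (fun s : ℝ => p + s • v) v s := fun s => by
    simpa using ((hasDerivAt_id s).smul_const v).const_add p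
  have e : deriv (fun s : ℝ => θ (p + s • v)) = fun s => fderiv ℝ θ (p + s • v) v := by
    ext1 s
    exact ((c2_diff h _).hasFDerivAt.comp_hasDerivAt s (hl s)).deriv
  rw [e]
  have h1 := (c2_diff2 h (p + (0:ℝ) • v)).hasFDerivAt.comp_hasDerivAt (0:ℝ) (hl 0)
  have h2 := h1.clm_apply (hasDerivAt_const (0:ℝ) v)
  simpa using h2.deriv

lemma localMax_conds {N : ℕ} {θ : SpT N → ℝ} (h : ContDiff ℝ 2 θ) {p : SpT N} (hp : IsLocalMax θ p) :
    fderiv ℝ θ p = 0 ∧ Lpl θ p ≤ 0 := by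
  refine ⟨hp.fderiv_eq_zero, Finset.sum_nonpos fun i _ => ?_⟩
  rw [← line_second h]
  refine second_deriv_nonpos (h.comp (by fun_prop)) ?_
  have hc : ContinuousAt (fun s : ℝ => p + s • (eb i : SpT N)) 0 := by fun_prop
  have : Tendsto (fun s : ℝ => p + s • (eb i : SpT N)) (𝓝 0) (𝓝 p) := by
    simpa [ContinuousAt] using hc
  simpa [IsLocalMax, IsMaxFilter] using this.eventually hp


/-- viscosity subsolution at a point of the linear operator `∂_t - Δ + b·D ≤ M` -/
def LinSub {N : ℕ} (b : Euc N) (M : ℝ) (U : SpT N → ℝ) (p : SpT N) : Prop :=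
  ∀ φ : SpT N → ℝ, ContDiff ℝ 2 φ → IsLocalMax (fun q => U q - φ q) p →
    Dt φ p - Lpl φ p + Gd φ p b ≤ M

lemma timefun_c2 {N : ℕ} {τ : ℝ → ℝ} (h : ContDiff ℝ 2 τ) :
    ContDiff ℝ 2 (fun q : SpT N => τ q.2) := h.comp contDiff_snd

lemma timefun_Dt {N : ℕ} {τ : ℝ → ℝ} (h : ContDiff ℝ 2 τ) (p : SpT N) :
    Dt (fun q : SpT N => τ q.2) p = deriv τ p.2 := by
  have := sec_hasDeriv (timefun_c2 (N := N) h) p.1 p.2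
  exact this.deriv.symm

lemma timefun_Gd {N : ℕ} {τ : ℝ → ℝ} (h : ContDiff ℝ 2 τ) (p : SpT N) :
    Gd (fun q : SpT N => τ q.2) p = 0 := by
  have := sec_hasFDeriv (timefun_c2 (N := N) h) p.1 p.2
  have h2 := this.fderiv
  simp at h2
  exact h2.symm

lemma timefun_Lpl {N : ℕ} {τ : ℝ → ℝ} (h : ContDiff ℝ 2 τ) (p : SpT N) :
    Lpl (fun q : SpT N => τ q.2) p = 0 := by
  have := lapl_sec (timefun_c2 (N := N) h) p.1 p.2
  rw [← Prod.mk.eta (p := p), ← this, lapl_eq_sum]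
  simp

/-- classical subsolutions are viscosity subsolutions -/
lemma linSub_of_classical {N : ℕ} {b : Euc N} {M : ℝ} {U : SpT N → ℝ} (hU : ContDiff ℝ 2 U)
    {p : SpT N} (h : Dt U p - Lpl U p + Gd U p b ≤ M) : LinSub b M U p := by
  intro φ hφ hmax
  have hc := lc_c2 hU hφ 1 (-1)
  have hm : IsLocalMax (fun q => 1 * U q + (-1) * φ q) p := by
    have : (fun q => 1 * U q + (-1) * φ q) = fun q => U q - φ q := by ext q; ring
    rw [this]; exact hmax
  obtain ⟨h1, h2⟩ := localMax_conds hc hm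
  have e1 : Dt (fun q => 1 * U q + (-1) * φ q) p = 0 := by rw [Dt, h1]; simp
  have e2 : Gd (fun q => 1 * U q + (-1) * φ q) p = 0 := by rw [Gd, h1]; simp
  rw [Dt_lc hU hφ] at e1
  rw [Gd_lc hU hφ] at e2
  rw [Lpl_lc hU hφ] at h2
  have e3 : Gd U p b - Gd φ p b = 0 := by
    have := congrArg (fun L => L b) e2
    simpa [sub_eq_add_neg] using this
  linarith

def Dbar (N : ℕ) : Set (SpT N) := {z | ‖z.1‖ ^ 2 ≤ 1 + z.2 ∧ z.2 ≤ 1}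
def Dint (N : ℕ) : Set (SpT N) := {z | ‖z.1‖ ^ 2 < 1 + z.2 ∧ z.2 < 1}
def Kp (N : ℕ) : Set (SpT N) := {z | ‖z.1‖ ^ 2 = 1 + z.2 ∧ z.2 ≤ 1}

lemma Dbar_compact (N : ℕ) : IsCompact (Dbar N) := by
  refine Metric.isCompact_of_isClosed_isBounded ?_ ?_
  · exact ((show IsClosed {z : SpT N | ‖z.1‖ ^ 2 ≤ 1 + z.2} from isClosed_le (by fun_prop) (by fun_prop)).inter
    (show IsClosed {z : SpT N | z.2 ≤ 1} from isClosed_le (by fun_prop) (by fun_prop)))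
  · refine (Metric.isBounded_closedBall (x := (0 : SpT N)) (r := 2)).subset ?_
    rintro ⟨x, t⟩ ⟨h1, h2⟩
    simp only at h1 h2
    have h3 := sq_nonneg ‖x‖
    simp only [mem_closedBall, dist_zero_right, Prod.norm_mk, max_le_iff]
    refine ⟨by nlinarith [norm_nonneg x], ?_⟩
    rw [Real.norm_eq_abs, abs_le]; constructor <;> linarith

lemma Kp_sub (N : ℕ) : Kp N ⊆ Dbar N := fun _ hz => ⟨hz.1.le, hz.2⟩

lemma Kp_compact (N : ℕ) : IsCompact (Kp N) := by
  refine (Dbar_compact N).of_isClosed_subset ?_ (Kp_sub N)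
  exact ((show IsClosed {z : SpT N | ‖z.1‖ ^ 2 = 1 + z.2} from isClosed_eq (by fun_prop) (by fun_prop)).inter
    (show IsClosed {z : SpT N | z.2 ≤ 1} from isClosed_le (by fun_prop) (by fun_prop)))

lemma Dint_open (N : ℕ) : IsOpen (Dint N) :=
  ((show IsOpen {z : SpT N | ‖z.1‖ ^ 2 < 1 + z.2} from isOpen_lt (by fun_prop) (by fun_prop)).inter
    (show IsOpen {z : SpT N | z.2 < 1} from isOpen_lt (by fun_prop) (by fun_prop)))

lemma Dint_sub (N : ℕ) : Dint N ⊆ Dbar N := fun _ hz => ⟨hz.1.le, hz.2.le⟩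

lemma maxPrinc {N : ℕ} {U h : SpT N → ℝ} {M : ℝ} (hU : Continuous U)
    (hsub : ∀ p ∈ Dint N, LinSub 0 M U p) (hh : ContDiff ℝ 2 h)
    (hs : ∀ p ∈ Dint N, M < Dt h p - Lpl h p) (hK : ∀ z ∈ Kp N, U z ≤ h z) :
    ∀ z ∈ Dbar N, z.2 ≤ 0 → U z ≤ h z := by
  intro z hz hz0
  by_contra hc
  push Not at hc
  set γ := (U z - h z) / 2 with hγ
  have hγ0 : 0 < γ := by rw [hγ]; linarith
  obtain ⟨B, hB⟩ := ((Dbar_compact N).image_of_continuousOn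
    (hU.sub hh.continuous).continuousOn).isBounded.bddAbove
  have hB' : ∀ p ∈ Dbar N, U p - h p ≤ B := fun p hp => hB ⟨p, hp, rfl⟩
  obtain ⟨k, hk⟩ : ∃ k : ℝ, 0 ≤ k ∧ B < γ * Real.exp k := by
    refine ⟨max 0 (B / γ), le_max_left _ _, ?_⟩
    have h1 := Real.add_one_le_exp (max 0 (B / γ))
    have h2 := le_max_right 0 (B / γ)
    have : B / γ < Real.exp (max 0 (B / γ)) := by linarith
    rw [div_lt_iff₀ hγ0] at this
    linarith
  have hτ : ContDiff ℝ 2 (fun t : ℝ => Real.exp (k * t)) := by fun_prop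
  have hφ := lc_c2 hh (timefun_c2 (N := N) hτ) 1 γ
  obtain ⟨p, hp, hpmax⟩ := (Dbar_compact N).exists_isMaxOn ⟨z, hz⟩
    (f := fun q => U q - (1 * h q + γ * Real.exp (k * q.2))) (hU.sub hφ.continuous).continuousOn
  have hpz : γ ≤ U p - (1 * h p + γ * Real.exp (k * p.2)) := by
    have h1 := hpmax hz
    have h2 : Real.exp (k * z.2) ≤ 1 := by
      rw [Real.exp_le_one_iff]; exact mul_nonpos_of_nonneg_of_nonpos hk.1 hz0
    simp only [mem_ofPred_eq] at h1
    refine le_trans ?_ h1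
    nlinarith
  have hexp := mul_pos hγ0 (Real.exp_pos (k * p.2))
  have hpi : p ∈ Dint N := by
    refine ⟨lt_of_le_of_ne hp.1 fun he => ?_, lt_of_le_of_ne hp.2 fun he => ?_⟩
    · have := hK p ⟨he, hp.2⟩
      linarith
    · have := hB' p hp
      rw [he, mul_one] at hpz
      linarith
  have hloc : IsLocalMax (fun q => U q - (1 * h q + γ * Real.exp (k * q.2))) p := by
    refine (hpmax.isLocalMax ?_)
    exact mem_of_superset ((Dint_open N).mem_nhds hpi) (Dint_sub N)
  have h1 := hsub p hpi _ hφ hloc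
  rw [Dt_lc hh (timefun_c2 hτ), Lpl_lc hh (timefun_c2 hτ), timefun_Dt hτ, timefun_Lpl hτ] at h1
  have hd : deriv (fun t : ℝ => Real.exp (k * t)) p.2 = Real.exp (k * p.2) * k := by
    have := ((hasDerivAt_id p.2).const_mul k).exp
    simpa using this.deriv
  rw [hd] at h1
  simp only [map_zero] at h1
  have := hs p hpi
  have h3 : 0 ≤ γ * (Real.exp (k * p.2) * k) := by
    have := Real.exp_pos (k * p.2); have := hk.1; positivity
  linarith

/-! polynomials -/
def ev {N : ℕ} (z : SpT N) : Option (Fin N) → ℝ := fun o => o.elim z.2 (fun i => z.1 i)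

noncomputable def pe {N : ℕ} (P : MvPolynomial (Option (Fin N)) ℝ) (z : SpT N) : ℝ :=
  MvPolynomial.eval (ev z) P

noncomputable def cc {N : ℕ} (o : Option (Fin N)) : SpT N →L[ℝ] ℝ :=
  o.elim (ContinuousLinearMap.snd ℝ (Euc N) ℝ)
    (fun i => (EuclideanSpace.proj i : Euc N →L[ℝ] ℝ).comp (ContinuousLinearMap.fst ℝ (Euc N) ℝ))

lemma cc_apply {N : ℕ} (o : Option (Fin N)) (z : SpT N) : cc o z = ev z o := by
  cases o <;> simp [cc, ev]

lemma pe_c {N : ℕ} (P : MvPolynomial (Option (Fin N)) ℝ) {n : WithTop ℕ∞} : ContDiff ℝ n (pe P) := by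
  induction P using MvPolynomial.induction_on with
  | C a =>
    have : pe (MvPolynomial.C a : MvPolynomial (Option (Fin N)) ℝ) = fun _ => a := by
      ext z; simp [pe]
    rw [this]; exact contDiff_const
  | add p q hp hq => 
    have : pe (p + q) = fun z => pe p z + pe q z := by ext z; simp [pe]
    rw [this]; exact hp.add hq
  | mul_X p o hp => 
    have : pe (p * MvPolynomial.X o) = fun z => pe p z * cc o z := by
      ext z; simp [pe, cc_apply]
    rw [this]; exact hp.mul (cc o).contDiff

lemma pe_fderiv {N : ℕ} (P : MvPolynomial (Option (Fin N)) ℝ) (z : SpT N) :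
    HasFDerivAt (pe P) (∑ o, pe (MvPolynomial.pderiv o P) z • cc o) z := by
  induction P using MvPolynomial.induction_on with
  | C a => 
    have : pe (MvPolynomial.C a : MvPolynomial (Option (Fin N)) ℝ) = fun _ => a := by
      ext z; simp [pe]
    rw [this]
    simpa [pe] using hasFDerivAt_const a z
  | add p q hp hq => 
    have : pe (p + q) = fun z => pe p z + pe q z := by ext z; simp [pe]
    rw [this]
    refine (hp.add hq).congr_fderiv ?_
    rw [← Finset.sum_add_distrib]
    refine Finset.sum_congr rfl fun o _ => ?_
    simp [pe, add_smul]
  | mul_X p o hp => 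
    have : pe (p * MvPolynomial.X o) = fun z => pe p z * cc o z := by
      ext z; simp [pe, cc_apply]
    rw [this]
    refine (hp.mul (cc o).hasFDerivAt).congr_fderiv ?_
    have e : ∀ o', pe (MvPolynomial.pderiv o' (p * MvPolynomial.X o)) z • (cc o' : SpT N →L[ℝ] ℝ)
        = (if o' = o then pe p z • cc o' else 0) + cc o z • pe (MvPolynomial.pderiv o' p) z • cc o' := by
      intro o'
      by_cases h : o' = o
      · subst h
        simp [pe, cc_apply, add_smul, smul_smul, mul_comm]
        try abel
      · simp [pe, h, cc_apply, smul_smul, mul_comm, MvPolynomial.pderiv_X, Pi.single_apply,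
          show ¬ (o = o') from fun hh => h hh.symm]
    simp_rw [e, Finset.sum_add_distrib, ← Finset.smul_sum]
    simp

lemma cc_none {N : ℕ} (x : Euc N) (t : ℝ) : cc none (x, t) = t := by simp [cc]
lemma cc_some {N : ℕ} (x : Euc N) (t : ℝ) (i : Fin N) : cc (some i) (x, t) = x i := by simp [cc]

lemma pe_Dt {N : ℕ} (P : MvPolynomial (Option (Fin N)) ℝ) (z : SpT N) :
    Dt (pe P) z = pe (MvPolynomial.pderiv none P) z := by
  simp [Dt, (pe_fderiv P z).fderiv, Fintype.sum_option, cc_none, cc_some]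

lemma pe_Di {N : ℕ} (P : MvPolynomial (Option (Fin N)) ℝ) (z : SpT N) (i : Fin N) :
    fderiv ℝ (pe P) z (eb i) = pe (MvPolynomial.pderiv (some i) P) z := by
  simp [eb, (pe_fderiv P z).fderiv, Fintype.sum_option, cc_none, cc_some]

lemma pe_Lpl {N : ℕ} (P : MvPolynomial (Option (Fin N)) ℝ) (z : SpT N) :
    Lpl (pe P) z = ∑ i, pe (MvPolynomial.pderiv (some i) (MvPolynomial.pderiv (some i) P)) z := by
  unfold Lpl
  refine Finset.sum_congr rfl fun i _ => ?_
  rw [← pe_Di]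
  have : pe (MvPolynomial.pderiv (some i) P) = fun z => fderiv ℝ (pe P) z (eb i) := by
    ext z; exact (pe_Di P z i).symm
  rw [this]
  have h := (c2_diff2 (pe_c P (n := 2)) z).hasFDerivAt.clm_apply (hasFDerivAt_const (eb i) z)
  rw [h.fderiv]; simp


abbrev Pol (N : ℕ) := MvPolynomial (Option (Fin N)) ℝ

def wgt (N : ℕ) : Option (Fin N) → ℕ := fun o => o.elim 2 (fun _ => 1)

noncomputable def Wd (N d : ℕ) : Submodule ℝ (Pol N) :=
  Submodule.span ℝ ((fun s => MvPolynomial.monomial s (1:ℝ)) '' {s | Finsupp.weight (wgt N) s ≤ d})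

lemma Wd_monomial {N d : ℕ} {s : Option (Fin N) →₀ ℕ} (h : Finsupp.weight (wgt N) s ≤ d) (a : ℝ) :
    MvPolynomial.monomial s a ∈ Wd N d := by
  have : MvPolynomial.monomial s a = a • MvPolynomial.monomial s (1:ℝ) := by
    rw [MvPolynomial.smul_monomial]; simp
  rw [this]
  exact Submodule.smul_mem _ _ (Submodule.subset_span ⟨s, h, rfl⟩)

lemma Wd_mono {N d d' : ℕ} (h : d ≤ d') : Wd N d ≤ Wd N d' :=
  Submodule.span_mono (image_mono fun _ hs => le_trans hs h)

lemma Wd_map {N d d' : ℕ} (T : Pol N →ₗ[ℝ] Pol N)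
    (h : ∀ s, Finsupp.weight (wgt N) s ≤ d → T (MvPolynomial.monomial s 1) ∈ Wd N d') :
    ∀ P ∈ Wd N d, T P ∈ Wd N d' := by
  intro P hP
  have : Wd N d ≤ (Wd N d').comap T := by
    refine Submodule.span_le.2 ?_
    rintro _ ⟨s, hs, rfl⟩
    exact h s hs
  exact this hP

lemma Wd_X {N d : ℕ} (o : Option (Fin N)) (P : Pol N) (hP : P ∈ Wd N d) :
    MvPolynomial.X o * P ∈ Wd N (d + wgt N o) := by
  refine Wd_map (LinearMap.mulLeft ℝ (MvPolynomial.X o)) ?_ P hP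
  intro s hs
  simp only [LinearMap.mulLeft_apply, MvPolynomial.X, MvPolynomial.monomial_mul]
  refine Wd_monomial ?_ _
  rw [map_add, Finsupp.weight_single]
  simp only [one_smul]; omega

lemma Wd_pderiv {N d : ℕ} (o : Option (Fin N)) (P : Pol N) (hP : P ∈ Wd N (d + wgt N o)) :
    MvPolynomial.pderiv o P ∈ Wd N d := by
  refine Wd_map (MvPolynomial.pderiv o).toLinearMap ?_ P hP
  intro s hs
  change MvPolynomial.pderiv o (MvPolynomial.monomial s 1) ∈ _
  rw [MvPolynomial.pderiv_monomial]
  by_cases h0 : s o = 0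
  · simp [h0]
  refine Wd_monomial ?_ _
  have h1 : (s - Finsupp.single o 1) + Finsupp.single o 1 = s :=
    tsub_add_cancel_of_le (by simpa using Nat.one_le_iff_ne_zero.2 h0)
  have h2 := congrArg (Finsupp.weight (wgt N)) h1
  rw [map_add, Finsupp.weight_single] at h2
  simp only [one_smul] at h2
  omega

lemma Wd_exists {N : ℕ} (P : Pol N) : ∃ d, P ∈ Wd N d := by
  induction P using MvPolynomial.induction_on' with
  | monomial s a => exact ⟨_, Wd_monomial le_rfl a⟩
  | add p q hp hq =>
    obtain ⟨d, hd⟩ := hp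
    obtain ⟨d', hd'⟩ := hq
    exact ⟨max d d', Submodule.add_mem _ (Wd_mono (le_max_left _ _) hd)
      (Wd_mono (le_max_right _ _) hd')⟩

lemma wgt_finite (N d : ℕ) : {s : Option (Fin N) →₀ ℕ | Finsupp.weight (wgt N) s ≤ d}.Finite := by
  apply Finsupp.finite_of_nat_weight_le
  intro o; cases o <;> simp [wgt]

instance Wd_fin (N d : ℕ) : FiniteDimensional ℝ (Wd N d) :=
  FiniteDimensional.span_of_finite ℝ ((wgt_finite N d).image _)

noncomputable def heatP (N : ℕ) : Pol N →ₗ[ℝ] Pol N :=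
  (MvPolynomial.pderiv none).toLinearMap -
    ∑ i : Fin N, (MvPolynomial.pderiv (some i)).toLinearMap ∘ₗ (MvPolynomial.pderiv (some i)).toLinearMap

lemma heatP_eval {N : ℕ} (P : Pol N) (z : SpT N) :
    pe (heatP N P) z = Dt (pe P) z - Lpl (pe P) z := by
  rw [pe_Dt, pe_Lpl]
  simp [heatP, pe, LinearMap.sum_apply]

noncomputable def qP (N : ℕ) : Pol N :=
  ∑ i : Fin N, MvPolynomial.X (some i) * MvPolynomial.X (some i) - 1 - MvPolynomial.X none

lemma qP_eval {N : ℕ} (z : SpT N) : pe (qP N) z = ‖z.1‖ ^ 2 - 1 - z.2 := by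
  rw [EuclideanSpace.norm_sq_eq]
  have : ∀ i : Fin N, ‖z.1 i‖ ^ 2 = z.1 i * z.1 i := fun i => by
    rw [Real.norm_eq_abs, sq_abs, pow_two]
  simp only [this]
  simp [qP, pe, ev]

lemma pe_mul {N : ℕ} (P Q : Pol N) (z : SpT N) : pe (P * Q) z = pe P z * pe Q z := by simp [pe]

lemma Wd_q {N d : ℕ} (P : Pol N) (hP : P ∈ Wd N d) : qP N * P ∈ Wd N (d + 2) := by
  rw [qP, sub_mul, sub_mul, Finset.sum_mul, one_mul]
  refine Submodule.sub_mem _ (Submodule.sub_mem _ (Submodule.sum_mem _ fun i _ => ?_) ?_) ?_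
  · rw [mul_assoc]
    exact Wd_X (some i) _ (Wd_X (some i) P hP)
  · exact Wd_mono (by omega) hP
  · exact Wd_X none P hP

lemma Wd_heat {N d : ℕ} (P : Pol N) (hP : P ∈ Wd N (d + 2)) : heatP N P ∈ Wd N d := by
  simp only [heatP, LinearMap.sub_apply, LinearMap.sum_apply, LinearMap.comp_apply]
  refine Submodule.sub_mem _ (Wd_pderiv none P hP) (Submodule.sum_mem _ fun i _ => ?_)
  exact Wd_pderiv (some i) _ (Wd_pderiv (some i) P hP)

lemma pe_eq_zero {N : ℕ} (P : Pol N) (h : ∀ z ∈ Dbar N, z.2 ≤ 0 → pe P z = 0) : P = 0 := by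
  set δ : ℝ := 1 / (4 * (N + 1)) with hδ
  have hN : (0:ℝ) < N + 1 := by positivity
  have hδ0 : 0 < δ := by positivity
  have hδN : N * δ ≤ 1 / 4 := by
    rw [hδ, mul_one_div, div_le_div_iff₀ (by positivity) (by norm_num)]; linarith
  have hδ1 : δ ≤ 1 / 4 := by
    rw [hδ, div_le_div_iff₀ (by positivity) (by norm_num)]
    have : (0:ℝ) ≤ N := by positivity
    linarith
  refine MvPolynomial.funext_set (fun _ => Ioo (-δ) 0) (fun _ => Ioo_infinite (by linarith)) ?_
  intro v hv
  have hv' : ∀ o, -δ < v o ∧ v o < 0 := fun o => hv o (mem_univ _)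
  have := h (WithLp.toLp 2 (fun i => v (some i)), v none) ?_ (hv' none).2.le
  · have e : ev ((WithLp.toLp 2 (fun i => v (some i)), v none) : SpT N) = v := by
      ext o; cases o <;> simp [ev]
    rw [pe, e] at this
    simpa using this
  · have hn := hv' none
    refine ⟨?_, by simp only; linarith⟩
    simp only [EuclideanSpace.norm_sq_eq]
    calc ∑ i : Fin N, ‖v (some i)‖ ^ 2 ≤ ∑ i : Fin N, δ := by
          refine Finset.sum_le_sum fun i _ => ?_
          have := hv' (some i)
          rw [Real.norm_eq_abs, sq_abs]; nlinarith
      _ = N * δ := by simp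
      _ ≤ 1 + v none := by linarith

/-- the torsion-like polynomial: `heat = 1`, vanishing on `Kp` -/
noncomputable def torP (N : ℕ) : Pol N := MvPolynomial.C (-(1 / (2 * N + 1) : ℝ)) * qP N

lemma torP_eval {N : ℕ} (z : SpT N) : pe (torP N) z = (1 / (2 * N + 1)) * (1 + z.2 - ‖z.1‖ ^ 2) := by
  rw [torP, pe_mul, qP_eval]; simp [pe]; ring

lemma heat_qP (N : ℕ) : heatP N (qP N) = MvPolynomial.C (-(2 * N + 1 : ℝ)) := by
  have h1 : MvPolynomial.pderiv none (qP N) = -1 := by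
    simp [qP, MvPolynomial.pderiv_X, Pi.single_apply]
  have h2 : ∀ i : Fin N, MvPolynomial.pderiv (some i) (qP N) = 2 * MvPolynomial.X (some i) := by
    intro i
    simp [qP, MvPolynomial.pderiv_X, Pi.single_apply, two_mul, Finset.sum_add_distrib]
  have h3 : ∀ i : Fin N, MvPolynomial.pderiv (some i) (2 * MvPolynomial.X (some i) : Pol N) = 2 := by
    intro i
    rw [two_mul, map_add, MvPolynomial.pderiv_X_self]; norm_num
  have h4 : heatP N (qP N) = MvPolynomial.pderiv none (qP N) -
      ∑ i : Fin N, MvPolynomial.pderiv (some i) (MvPolynomial.pderiv (some i) (qP N)) := by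
    simp only [heatP, LinearMap.sub_apply, LinearMap.sum_apply, LinearMap.comp_apply]; rfl
  rw [h4]
  simp only [h1, h2, h3, Finset.sum_const, Finset.card_univ, Fintype.card_fin]
  simp only [nsmul_eq_mul, map_neg, map_add, map_mul, map_one, map_natCast, map_ofNat]
  ring

lemma heat_torP {N : ℕ} (z : SpT N) : Dt (pe (torP N)) z - Lpl (pe (torP N)) z = 1 := by
  have hN : (2 * N + 1 : ℝ) ≠ 0 := by positivity
  rw [← heatP_eval, torP, ← MvPolynomial.smul_eq_C_mul, map_smul, heat_qP]
  simp [pe, MvPolynomial.smul_eval]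
  field_simp
  ring

/-- non-strict version of the maximum principle against polynomials -/
lemma maxPrincP {N : ℕ} {U : SpT N → ℝ} {M : ℝ} (hU : Continuous U)
    (hsub : ∀ p ∈ Dint N, LinSub 0 M U p) (P : Pol N) (hP : heatP N P = 0)
    (hK : ∀ z ∈ Kp N, U z ≤ pe P z) :
    ∀ z ∈ Dbar N, z.2 ≤ 0 → U z ≤ pe P z + M * pe (torP N) z := by
  intro z hz hz0
  refine le_of_forall_pos_le_add fun ε hε => ?_
  have hbd : 0 ≤ pe (torP N) z ∧ pe (torP N) z ≤ 2 := by
    rw [torP_eval]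
    have h0 : (0:ℝ) ≤ N := by positivity
    have h1 : (1 / (2 * N + 1) : ℝ) ≤ 1 := by rw [div_le_one (by positivity)]; linarith
    have h2 : (0:ℝ) ≤ 1 / (2 * N + 1) := by positivity
    have h3 : 0 ≤ 1 + z.2 - ‖z.1‖ ^ 2 := by have := hz.1; linarith
    have h4 : 1 + z.2 - ‖z.1‖ ^ 2 ≤ 1 := by have := sq_nonneg ‖z.1‖; linarith
    constructor
    · positivity
    · nlinarith
  have h := maxPrinc (h := fun q => 1 * pe P q + (M + ε / 2) * pe (torP N) q) hU hsub
    (lc_c2 (pe_c P) (pe_c _) _ _) ?_ ?_ z hz hz0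
  · nlinarith
  · intro p hp
    rw [Dt_lc (pe_c P) (pe_c _), Lpl_lc (pe_c P) (pe_c _)]
    have h1 := heatP_eval P p
    rw [hP] at h1
    have h2 := heat_torP p
    have h3 : pe (0 : Pol N) p = 0 := by simp [pe]
    have : M + ε / 2 = (M + ε / 2) * (Dt (pe (torP N)) p - Lpl (pe (torP N)) p) := by rw [h2]; ring
    linarith
  · intro p hp
    have : pe (torP N) p = 0 := by rw [torP_eval, hp.1]; ring
    rw [this]; have := hK p hp; linarith

lemma linSub_caloric {N : ℕ} (P : Pol N) (hP : heatP N P = 0) (p : SpT N) :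
    LinSub 0 0 (pe P) p := by
  refine linSub_of_classical (pe_c P) ?_
  rw [← heatP_eval, hP]; simp [pe]

lemma caloric_le {N : ℕ} (P : Pol N) (hP : heatP N P = 0) (C : ℝ) (hK : ∀ z ∈ Kp N, pe P z ≤ C) :
    ∀ z ∈ Dbar N, z.2 ≤ 0 → pe P z ≤ C := by
  intro z hz hz0
  have := maxPrincP (pe_c P (n := 0)).continuous (fun p _ => linSub_caloric P hP p)
    (MvPolynomial.C C) (by simp [heatP]) (by simpa [pe] using hK) z hz hz0
  simpa [pe] using this

lemma caloric_abs {N : ℕ} (P : Pol N) (hP : heatP N P = 0) (C : ℝ) (hK : ∀ z ∈ Kp N, |pe P z| ≤ C) :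
    ∀ z ∈ Dbar N, z.2 ≤ 0 → |pe P z| ≤ C := by
  intro z hz hz0
  have h1 := caloric_le P hP C (fun z hz => (abs_le.1 (hK z hz)).2) z hz hz0
  have h2 := caloric_le (-P) (by rw [map_neg, hP, neg_zero]) C
    (fun z hz => by have := (abs_le.1 (hK z hz)).1; simp [pe] at this ⊢; linarith) z hz hz0
  rw [abs_le]; refine ⟨?_, h1⟩
  simp [pe] at h2 ⊢; linarith

lemma caloric_inj {N : ℕ} (P : Pol N) (hP : heatP N P = 0) (hK : ∀ z ∈ Kp N, pe P z = 0) : P = 0 :=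
  pe_eq_zero P fun z hz hz0 => by
    have := caloric_abs P hP 0 (fun z hz => by simp [hK z hz]) z hz hz0
    simpa using this

lemma fischer {N : ℕ} (P : Pol N) : ∃ Q : Pol N, heatP N (P - qP N * Q) = 0 := by
  obtain ⟨d, hd⟩ := Wd_exists (heatP N P)
  let T : Wd N d →ₗ[ℝ] Wd N d :=
    (heatP N ∘ₗ LinearMap.mulLeft ℝ (qP N)).restrict (p := Wd N d) (q := Wd N d)
      (fun Q hQ => Wd_heat _ (Wd_q Q hQ))
  have hinj : Function.Injective T := by
    rw [← LinearMap.ker_eq_bot, LinearMap.ker_eq_bot']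
    intro Q hQ
    have h1 : heatP N (qP N * (Q : Pol N)) = 0 := by
      have := congrArg Subtype.val hQ
      simpa [T] using this
    have h2 : qP N * (Q : Pol N) = 0 := caloric_inj _ h1 fun z hz => by
      rw [pe_mul, qP_eval, hz.1]; ring
    have h3 : qP N ≠ 0 := by
      intro h0
      have := qP_eval (0 : SpT N)
      rw [h0] at this; simp [pe] at this
    ext1
    exact (mul_eq_zero.1 h2).resolve_left h3
  obtain ⟨Q, hQ⟩ := (LinearMap.injective_iff_surjective.1 hinj) ⟨heatP N P, hd⟩
  refine ⟨Q, ?_⟩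
  have := congrArg Subtype.val hQ
  simp only [T] at this
  rw [map_sub, sub_eq_zero]
  exact this.symm


instance Kp_cs (N : ℕ) : CompactSpace (Kp N) := isCompact_iff_compactSpace.1 (Kp_compact N)

noncomputable def resK {N : ℕ} (U : SpT N → ℝ) (hU : Continuous U) : C(Kp N, ℝ) :=
  ⟨fun z => U z, hU.comp continuous_subtype_val⟩

lemma pe_cont {N : ℕ} (P : Pol N) : Continuous (pe P) := (pe_c P (n := 0)).continuous

noncomputable def resP (N : ℕ) : Pol N →ₐ[ℝ] C(Kp N, ℝ) where
  toFun P := resK (pe P) (pe_cont P)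
  map_one' := by ext z; simp [resK, pe]
  map_mul' P Q := by ext z; simp [resK, pe]
  map_zero' := by ext z; simp [resK, pe]
  map_add' P Q := by ext z; simp [resK, pe]
  commutes' r := by ext z; simp [resK, pe]

lemma resP_apply {N : ℕ} (P : Pol N) (z : Kp N) : resP N P z = pe P z := rfl

lemma caloric_abs0 {N : ℕ} (P : Pol N) (hP : heatP N P = 0) : |pe P 0| ≤ ‖resP N P‖ := by
  refine caloric_abs P hP _ (fun z hz => ?_) 0 (by simp [Dbar]) (by simp)
  exact (resP N P).norm_coe_le_norm ⟨z, hz⟩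

lemma exists_ell (N : ℕ) : ∃ l : C(Kp N, ℝ) →L[ℝ] ℝ, ‖l‖ ≤ 1 ∧
    ∀ P : Pol N, heatP N P = 0 → l (resP N P) = pe P 0 := by
  let R : LinearMap.ker (heatP N) →ₗ[ℝ] C(Kp N, ℝ) := (resP N).toLinearMap ∘ₗ (LinearMap.ker (heatP N)).subtype
  have hR : Function.Injective R := by
    rw [← LinearMap.ker_eq_bot, LinearMap.ker_eq_bot']
    intro P hP
    ext1
    refine caloric_inj _ P.2 fun z hz => ?_
    have := congrArg (fun g : C(Kp N, ℝ) => g ⟨z, hz⟩) hP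
    exact this
  let e := LinearEquiv.ofInjective R hR
  let ev0 : Pol N →ₗ[ℝ] ℝ := 
    { toFun := fun P => pe P 0
      map_add' := fun P Q => by simp [pe]
      map_smul' := fun r P => by simp [pe, MvPolynomial.smul_eval] }
  let L : LinearMap.range R →ₗ[ℝ] ℝ := ev0 ∘ₗ (LinearMap.ker (heatP N)).subtype ∘ₗ e.symm.toLinearMap
  have hL : ∀ y, ‖L y‖ ≤ 1 * ‖y‖ := by
    intro y
    have h1 := caloric_abs0 (e.symm y : Pol N) (e.symm y).2
    have h2 : resP N (e.symm y : Pol N) = (y : C(Kp N, ℝ)) := by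
      have := congrArg Subtype.val (e.apply_symm_apply y)
      exact this
    rw [h2] at h1
    rw [one_mul]; exact h1
  obtain ⟨l, hl, hl2⟩ := exists_extension_norm_eq (LinearMap.range R) (L.mkContinuous 1 hL)
  refine ⟨l, hl2.le.trans (LinearMap.mkContinuous_norm_le _ zero_le_one _), ?_⟩
  intro P hP
  have h := hl ⟨R ⟨P, hP⟩, ⟨P, hP⟩, rfl⟩
  have h3 : e.symm ⟨R ⟨P, hP⟩, ⟨P, hP⟩, rfl⟩ = ⟨P, hP⟩ := by
    rw [LinearEquiv.symm_apply_eq]; rfl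
  change l (resP N P) = _ at h
  rw [h]
  change pe ((e.symm ⟨R ⟨P, hP⟩, ⟨P, hP⟩, rfl⟩ : LinearMap.ker (heatP N)) : Pol N) 0 = _
  rw [h3]

lemma resP_dense {N : ℕ} (U : SpT N → ℝ) (hU : Continuous U) (ε : ℝ) (hε : 0 < ε) :
    ∃ P : Pol N, ∀ z ∈ Kp N, |pe P z - U z| < ε := by
  have hsep : (resP N).range.SeparatesPoints := by
    intro x y hxy
    have : ∃ o, ev x.1 o ≠ ev y.1 o := by
      by_contra hc
      push Not at hc
      apply hxy
      ext1
      refine Prod.ext ?_ ?_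
      · ext i; exact hc (some i)
      · exact hc none
    obtain ⟨o, ho⟩ := this
    refine ⟨_, ⟨resP N (MvPolynomial.X o), ⟨_, rfl⟩, rfl⟩, ?_⟩
    change pe _ _ ≠ pe _ _
    simpa [pe] using ho
  obtain ⟨⟨g, P, hP⟩, hg⟩ := ContinuousMap.exists_mem_subalgebra_near_continuous_of_separatesPoints
    (resP N).range hsep (fun z : Kp N => U z) (hU.comp continuous_subtype_val) ε hε
  refine ⟨P, fun z hz => ?_⟩
  have := hg ⟨z, hz⟩
  rw [← Real.norm_eq_abs]
  convert this using 2
  simp only [← hP]; rfl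

noncomputable def ell (N : ℕ) : C(Kp N, ℝ) →L[ℝ] ℝ := Classical.choose (exists_ell N)

lemma key1 {N : ℕ} {M : ℝ} {U : SpT N → ℝ} (hU : Continuous U)
    (hsub : ∀ p ∈ Dint N, LinSub 0 M U p) :
    U 0 ≤ ell N (resK U hU) + (1 / (2 * N + 1)) * M := by
  obtain ⟨h1, h2⟩ := Classical.choose_spec (exists_ell N)
  refine le_of_forall_pos_le_add fun ε hε => ?_
  obtain ⟨P, hP⟩ := resP_dense (fun z => U z + ε / 2) (by fun_prop) (ε / 2) (by positivity)
  obtain ⟨Q, hQ⟩ := fischer P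
  set h := P - qP N * Q with hh
  have hPh : ∀ z ∈ Kp N, pe h z = pe P z := by
    intro z hz
    have : pe (qP N * Q) z = 0 := by rw [pe_mul, qP_eval, hz.1]; ring
    have e : pe h z = pe P z - pe (qP N * Q) z := by simp [hh, pe]
    rw [e, this, sub_zero]
  have hb : ∀ z ∈ Kp N, U z ≤ pe h z ∧ pe h z ≤ U z + ε := by
    intro z hz
    have := abs_lt.1 (hP z hz)
    rw [hPh z hz]
    constructor <;> linarith
  have h3 := maxPrincP hU hsub h hQ (fun z hz => (hb z hz).1) 0 (by simp [Dbar]) (by simp)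
  rw [torP_eval] at h3
  have h4 : ell N (resP N h) = pe h 0 := h2 h hQ
  have h5 : ell N (resP N h) - ell N (resK U hU) ≤ ε := by
    rw [← map_sub]
    refine (le_abs_self _).trans ?_
    refine ((ell N).le_opNorm _).trans ?_
    have : ‖resP N h - resK U hU‖ ≤ ε := by
      rw [ContinuousMap.norm_le _ hε.le]
      intro z
      have := hb z z.2
      change ‖pe h z - U z‖ ≤ ε
      rw [Real.norm_eq_abs, abs_le]; constructor <;> linarith
    have h6 : ‖ell N‖ ≤ 1 := h1
    nlinarith [norm_nonneg (ell N), norm_nonneg (resP N h - resK U hU)]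
  simp at h3
  simp
  linarith


noncomputable def Smap {N : ℕ} (r : ℝ) (b : Euc N) : SpT N →L[ℝ] SpT N :=
  (r • ContinuousLinearMap.fst ℝ (Euc N) ℝ + (r ^ 2) • (ContinuousLinearMap.snd ℝ (Euc N) ℝ).smulRight b).prod
    (r ^ 2 • ContinuousLinearMap.snd ℝ (Euc N) ℝ)

lemma Smap_apply {N : ℕ} (r : ℝ) (b : Euc N) (z : SpT N) :
    Smap r b z = (r • z.1 + r ^ 2 • z.2 • b, r ^ 2 * z.2) := by simp [Smap]

lemma heat_aff {N : ℕ} {φ : SpT N → ℝ} (h : ContDiff ℝ 2 φ) (r : ℝ) (b : Euc N) (p z : SpT N) :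
    Dt (fun z => φ (p + Smap r b z)) z - Lpl (fun z => φ (p + Smap r b z)) z
      = r ^ 2 * (Dt φ (p + Smap r b z) - Lpl φ (p + Smap r b z) + Gd φ (p + Smap r b z) b) := by
  have h1 : Dt (fun z => φ (p + Smap r b z)) z
      = r ^ 2 * (Dt φ (p + Smap r b z) + Gd φ (p + Smap r b z) b) := by
    have e : Smap r b (0, 1) = r ^ 2 • ((0, 1) + (b, 0) : SpT N) := by
      rw [Smap_apply]; simp
    rw [Dt, fderiv_aff h, ContinuousLinearMap.comp_apply, e, map_smul, map_add]
    simp [Dt, Gd]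
  have h2 : Lpl (fun z => φ (p + Smap r b z)) z = r ^ 2 * Lpl φ (p + Smap r b z) := by
    rw [Lpl, Lpl, Finset.mul_sum]
    refine Finset.sum_congr rfl fun i _ => ?_
    have e : Smap r b (eb i) = r • (eb i : SpT N) := by
      rw [Smap_apply]; simp [eb]
    rw [fderiv2_aff h, e]
    simp; ring
  rw [h1, h2]; ring

lemma linSub_aff {N : ℕ} {U : SpT N → ℝ} {r : ℝ} (hr : 0 < r) {b : Euc N} {M : ℝ} {p z : SpT N}
    (h : LinSub b M U (p + Smap r b z)) : LinSub 0 (r ^ 2 * M) (fun z => U (p + Smap r b z)) z := by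
  intro φ hφ hmax
  let A : SpT N → SpT N := fun w => (r⁻¹ • ((w - p).1 - (w - p).2 • b), (r ^ 2)⁻¹ * (w - p).2)
  have hA : ContDiff ℝ 2 A := by
    refine ContDiff.prodMk ?_ ?_ <;> simp only [Prod.fst_sub, Prod.snd_sub] <;> fun_prop
  have hAS : ∀ w, A (p + Smap r b w) = w := by
    intro w
    refine Prod.ext ?_ ?_
    · simp [A, Smap_apply, smul_smul, hr.ne']
    · simp [A, Smap_apply, hr.ne']
  have hSA : ∀ w, p + Smap r b (A w) = w := by
    intro w
    refine Prod.ext ?_ ?_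
    · simp [A, Smap_apply, smul_smul, hr.ne']
    · simp [A, Smap_apply, hr.ne']
  set φ' : SpT N → ℝ := fun w => φ (A w) with hφ'
  have hφ'c : ContDiff ℝ 2 φ' := hφ.comp hA
  have e : (fun z => φ' (p + Smap r b z)) = φ := by ext w; simp [hφ', hAS]
  have h1 := h φ' hφ'c ?_
  · have h2 := heat_aff hφ'c r b p z
    rw [e] at h2
    rw [map_zero, add_zero, h2]
    exact mul_le_mul_of_nonneg_left h1 (by positivity)
  · have hc : Tendsto A (𝓝 (p + Smap r b z)) (𝓝 z) := by
      have := hA.continuous.tendsto (p + Smap r b z)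
      rwa [hAS] at this
    have := hc.eventually hmax
    filter_upwards [this] with w hw
    simp only [hSA] at hw
    simp only [hφ', hAS]
    exact hw

instance volHaar (N : ℕ) : Measure.IsAddHaarMeasure (volume : Measure (SpT N)) :=
  inferInstanceAs (Measure.IsAddHaarMeasure ((volume : Measure (Euc N)).prod (volume : Measure ℝ)))

/-- mollification -/
noncomputable def moll {N : ℕ} (η : ContDiffBump (0 : SpT N)) (U : SpT N → ℝ) (q : SpT N) : ℝ :=
  ∫ z, η.normed volume z • U (q - z)

lemma moll_conv {N : ℕ} (η : ContDiffBump (0 : SpT N)) (U : SpT N → ℝ) :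
    moll η U = MeasureTheory.convolution (η.normed volume) U (ContinuousLinearMap.lsmul ℝ ℝ) volume := by
  ext q; rfl

lemma moll_c2 {N : ℕ} (η : ContDiffBump (0 : SpT N)) {U : SpT N → ℝ} (hU : Continuous U) :
    ContDiff ℝ 2 (moll η U) := by
  rw [moll_conv]
  exact η.hasCompactSupport_normed.contDiff_convolution_left _ η.contDiff_normed
    hU.locallyIntegrable

lemma Smap_small {N : ℕ} (b : Euc N) {δ : ℝ} (hδ : 0 < δ) :
    ∃ r : ℝ, 0 < r ∧ ∀ z ∈ Dbar N, ‖Smap r b z‖ < δ := by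
  obtain ⟨B, hB⟩ := (Dbar_compact N).isBounded.exists_norm_le
  set C : ℝ := |B| + |B| * ‖b‖ + |B| + 1 with hC
  have hC0 : 0 < C := by positivity
  have hr : 0 < min 1 (δ / (2 * C)) := by positivity
  refine ⟨min 1 (δ / (2 * C)), hr, fun z hz => ?_⟩
  set r := min 1 (δ / (2 * C)) with hr'
  have h1 : r ≤ 1 := min_le_left _ _
  have h2 : r * C ≤ δ / 2 := by
    have : r ≤ δ / (2 * C) := min_le_right _ _
    calc r * C ≤ δ / (2 * C) * C := by gcongr
      _ = δ / 2 := by field_simp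
  have hz1 : ‖z‖ ≤ |B| := (hB z hz).trans (le_abs_self _)
  have hz2 : ‖z.1‖ ≤ |B| := (norm_fst_le z).trans hz1
  have hz3 : ‖z.2‖ ≤ |B| := (norm_snd_le z).trans hz1
  have hr2 : r ^ 2 ≤ r := by nlinarith
  rw [Smap_apply, Prod.norm_mk]
  have e1 : ‖r • z.1 + r ^ 2 • z.2 • b‖ ≤ r * C := by
    refine (norm_add_le _ _).trans ?_
    rw [norm_smul, norm_smul, norm_smul, Real.norm_of_nonneg hr.le, Real.norm_of_nonneg (by positivity)]
    have : r ^ 2 * (‖z.2‖ * ‖b‖) ≤ r * (|B| * ‖b‖) := by gcongr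
    have : r * ‖z.1‖ ≤ r * |B| := by gcongr
    have := abs_nonneg B
    rw [hC]; nlinarith
  have e2 : ‖r ^ 2 * z.2‖ ≤ r * C := by
    rw [norm_mul, Real.norm_of_nonneg (by positivity)]
    have : r ^ 2 * ‖z.2‖ ≤ r * |B| := by gcongr
    have h5 : 0 ≤ |B| * ‖b‖ := by positivity
    have := abs_nonneg B
    rw [hC]; nlinarith
  exact max_lt (by linarith) (by linarith)

lemma Smap_mono {N : ℕ} (b : Euc N) {O : Set (SpT N)} (hO : IsOpen O) {Kc : Set (SpT N)} (hK : IsCompact Kc)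
    (hKO : Kc ⊆ O) : ∃ δ > 0, ∀ p ∈ Kc, ∀ w, ‖w‖ < δ → p + w ∈ O := by
  obtain ⟨δ, hδ, h⟩ := hK.exists_thickening_subset_open hO hKO
  refine ⟨δ, hδ, fun p hp w hw => h ?_⟩
  rw [mem_thickening_iff]
  exact ⟨p, hp, by simpa [dist_eq_norm] using hw⟩

lemma linMoll {N : ℕ} (η : ContDiffBump (0 : SpT N)) {U : SpT N → ℝ} (hU : Continuous U)
    {O : Set (SpT N)} (hO : IsOpen O) {b : Euc N} {M : ℝ} (hsub : ∀ p ∈ O, LinSub b M U p)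
    {q : SpT N} (hq : closedBall q η.rOut ⊆ O) :
    Dt (moll η U) q - Lpl (moll η U) q + Gd (moll η U) q b ≤ M := by
  by_contra hc
  push Not at hc
  obtain ⟨M', hM, hM'⟩ := exists_between hc
  have hV := moll_c2 η hU
  set V := moll η U with hVdef
  have hLc : Continuous (fun q => Dt V q - Lpl V q + Gd V q b) := by
    have := Dt_cont hV; have := Lpl_cont hV; have := Gd_cont hV
    fun_prop
  have hO2 : IsOpen {q | M' < Dt V q - Lpl V q + Gd V q b} := isOpen_lt continuous_const hLc
  obtain ⟨δ1, hδ1, h1⟩ := Smap_mono b hO (isCompact_closedBall q η.rOut) hq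
  obtain ⟨δ2, hδ2, h2⟩ := Smap_mono b hO2 (isCompact_singleton (x := q)) (by simpa using hM')
  obtain ⟨r, hr, hrS⟩ := Smap_small (N := N) b (lt_min hδ1 hδ2)
  set c0 : ℝ := 1 / (2 * N + 1) with hc0
  have hc0p : 0 < c0 := by positivity
  -- upper inequality
  let G : C(SpT N × Kp N, ℝ) := ⟨fun w => U (q - w.1 + Smap r b w.2), by fun_prop⟩
  let F : C(SpT N, C(Kp N, ℝ)) := G.curry
  have hFc : Continuous F := F.continuous
  set ηn := η.normed (volume : Measure (SpT N)) with hηn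
  have hηc : Continuous ηn := η.continuous_normed
  have hηs : HasCompactSupport ηn := η.hasCompactSupport_normed
  have hFi : Integrable (fun z => ηn z • F z) :=
    (hηc.smul hFc).integrable_of_hasCompactSupport hηs.smul_right
  have hup : ∀ z, ηn z • U (q - z) ≤ ηn z • (ell N (F z) + c0 * (r ^ 2 * M)) := by
    intro z
    by_cases hz : ηn z = 0
    · simp [hz]
    have hz' : z ∈ ball (0 : SpT N) η.rOut := by
      rw [← η.support_normed_eq (μ := volume)]; exact hz
    refine smul_le_smul_of_nonneg_left ?_ (η.nonneg_normed z)
    have hcont : Continuous (fun y => U (q - z + Smap r b y)) := by fun_prop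
    have := key1 hcont (M := r ^ 2 * M) (fun y hy => linSub_aff hr (hsub _ (h1 _ ?_ _ ?_)))
    · simp only [map_zero, add_zero] at this
      exact this
    · simpa [dist_eq_norm] using (mem_ball_zero_iff.1 hz').le
    · exact (hrS y (Dint_sub N hy)).trans_le (min_le_left _ _)
  have hI1 : Integrable (fun z => ηn z • U (q - z)) :=
    (hηc.smul (by fun_prop)).integrable_of_hasCompactSupport hηs.smul_right
  have hI2 : Integrable (fun z => ηn z • (ell N (F z) + c0 * (r ^ 2 * M))) :=
    (hηc.smul (by fun_prop)).integrable_of_hasCompactSupport hηs.smul_right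
  have hup2 : V q ≤ ∫ z, ηn z • (ell N (F z) + c0 * (r ^ 2 * M)) := integral_mono hI1 hI2 hup
  have hVr : Continuous (fun y => V (q + Smap r b y)) := by
    have := hV.continuous; fun_prop
  have hres : resK (fun y => V (q + Smap r b y)) hVr = ∫ z, ηn z • F z := by
    ext y
    rw [ContinuousMap.integral_apply hFi]
    change V (q + Smap r b y) = _
    simp only [hVdef, moll]
    refine integral_congr_ae (Eventually.of_forall fun z => ?_)
    change _ = ηn z • U (q - z + Smap r b y)
    simp only
    rw [show q + Smap r b y - z = q - z + Smap r b y by abel]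
  have hell : ell N (resK (fun y => V (q + Smap r b y)) hVr) = ∫ z, ηn z • ell N (F z) := by
    rw [hres, ← ContinuousLinearMap.integral_comp_comm _ hFi]
    simp
  have hsplit : ∫ z, ηn z • (ell N (F z) + c0 * (r ^ 2 * M)) = (∫ z, ηn z • ell N (F z)) + c0 * (r ^ 2 * M) := by
    simp only [smul_add]
    rw [integral_add, integral_smul_const, η.integral_normed, one_smul]
    · exact (hηc.smul (by fun_prop)).integrable_of_hasCompactSupport hηs.smul_right
    · exact (hηc.smul (by fun_prop)).integrable_of_hasCompactSupport hηs.smul_right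
  -- lower inequality
  have hlow := key1 (U := fun y => -V (q + Smap r b y)) hVr.neg (M := -(r ^ 2 * M')) ?_
  · have hneg : resK (fun y => -V (q + Smap r b y)) hVr.neg = - resK (fun y => V (q + Smap r b y)) hVr := by
      ext y; rfl
    rw [hneg, map_neg] at hlow
    simp only [map_zero, add_zero] at hlow
    rw [hsplit, ← hell] at hup2
    have : c0 * (r ^ 2 * M) < c0 * (r ^ 2 * M') := by
      have : 0 < r ^ 2 := by positivity
      gcongr
    linarith
  · intro y hy
    have hneg : (fun y => -V (q + Smap r b y)) = fun y => (fun w => (-1) * V w + 0 * V w) (q + Smap r b y) := by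
      ext y; simp
    have hVn := lc_c2 hV hV (-1) 0
    refine linSub_of_classical ?_ ?_
    · have := hV; fun_prop
    · rw [hneg, map_zero, add_zero, heat_aff hVn, Dt_lc hV hV, Lpl_lc hV hV, Gd_lc hV hV]
      have h3 := h2 q rfl (Smap r b y) ((hrS y (Dint_sub N hy)).trans_le (min_le_right _ _))
      simp only [mem_ofPred_eq] at h3
      have hr2 : 0 < r ^ 2 := by positivity
      simp only [ContinuousLinearMap.add_apply, ContinuousLinearMap.smul_apply, smul_eq_mul]
      nlinarith


def VSubAt {N : ℕ} (m F : ℝ) (U : SpT N → ℝ) (p : SpT N) : Prop :=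
  ∀ φ : SpT N → ℝ, ContDiff ℝ 2 φ → IsLocalMax (fun q => U q - φ q) p → pOp m φ p ≤ F

lemma tangent1 {m r s : ℝ} (hm : 1 < m) (hr : 0 < r) (hs : 0 ≤ s) :
    r ^ m + m * r ^ (m - 1) * (s - r) ≤ s ^ m := by
  have h := one_add_mul_self_le_rpow_one_add (s := (s - r) / r) (by rw [le_div_iff₀ hr]; linarith) hm.le
  have e : 1 + (s - r) / r = s / r := by field_simp; ring
  rw [e, Real.div_rpow hs hr.le, le_div_iff₀ (by positivity)] at h
  have e2 : r ^ m = r ^ (m - 1) * r := by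
    rw [← Real.rpow_add_one hr.ne']; ring_nf
  calc r ^ m + m * r ^ (m - 1) * (s - r) = (1 + m * ((s - r) / r)) * r ^ m := by
        rw [e2]; field_simp
    _ ≤ s ^ m := h

lemma tangent {N : ℕ} {m : ℝ} (hm : 1 < m) (P : Euc N →L[ℝ] ℝ) : ∃ b : Euc N,
    ∀ p : Euc N →L[ℝ] ℝ, ‖P‖ ^ m + (p b - P b) ≤ ‖p‖ ^ m := by
  by_cases hP : P = 0
  · refine ⟨0, fun p => ?_⟩
    subst hP
    simp [Real.zero_rpow (by linarith : m ≠ 0)]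
    positivity
  set e := (InnerProductSpace.toDual ℝ (Euc N)).symm P with he
  have hr : 0 < ‖P‖ := norm_pos_iff.2 hP
  have h1 : ‖e‖ = ‖P‖ := by simp [he]
  have h2 : P e = ‖P‖ ^ 2 := by
    have : P e = inner ℝ e e := by rw [he, InnerProductSpace.toDual_symm_apply]
    rw [this, real_inner_self_eq_norm_sq, h1]
  refine ⟨(m * ‖P‖ ^ (m - 2)) • e, fun p => ?_⟩
  have h3 := tangent1 hm hr (norm_nonneg p)
  have e2 : ‖P‖ ^ (m - 1) = ‖P‖ ^ (m - 2) * ‖P‖ := by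
    rw [← Real.rpow_add_one hr.ne']; ring_nf
  have h4 : p e ≤ ‖p‖ * ‖P‖ := by
    rw [← h1]; exact (le_abs_self _).trans (p.le_opNorm e)
  have h5 : 0 ≤ m * ‖P‖ ^ (m - 2) := by positivity
  simp only [map_smul, smul_eq_mul, h2]
  have h6 : m * ‖P‖ ^ (m - 2) * p e ≤ m * ‖P‖ ^ (m - 2) * (‖p‖ * ‖P‖) := by gcongr
  rw [e2] at h3
  nlinarith

lemma nlMoll {N : ℕ} (η : ContDiffBump (0 : SpT N)) {U : SpT N → ℝ} (hU : Continuous U) {m F : ℝ}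
    (hm : 1 < m) {O : Set (SpT N)} (hO : IsOpen O) (hsub : ∀ p ∈ O, VSubAt m F U p)
    {q : SpT N} (hq : closedBall q η.rOut ⊆ O) : pOp m (moll η U) q ≤ F := by
  obtain ⟨b, hb⟩ := tangent hm (Gd (moll η U) q)
  have := linMoll η hU hO (b := b) (M := F - ‖Gd (moll η U) q‖ ^ m + Gd (moll η U) q b) ?_ hq
  · rw [pOp]; linarith
  · intro p hp φ hφ hmax
    have h1 := hsub p hp φ hφ hmax
    have h2 := hb (Gd φ p)
    rw [pOp] at h1
    linarith


def VSuperAt {N : ℕ} (Ω : Set (Euc N)) (m G : ℝ) (v : SpT N → ℝ) (p : SpT N) : Prop :=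
  ∀ φ : SpT N → ℝ, ContDiff ℝ 2 φ → IsLocalMinOn (fun q => v q - φ q) (closure Ω ×ˢ Iic p.2) p →
    G ≤ pOp m φ p

def ConeAt {N : ℕ} (Ω : Set (Euc N)) (x₀ : Euc N) : Prop :=
  ∃ n : Euc N, ∃ κ : ℝ, 0 < κ ∧ ∃ r0 : ℝ, 0 < r0 ∧ ∀ x ∈ closure Ω, dist x x₀ < r0 →
    ∀ s : ℝ, 0 < s → s < r0 → closedBall (x + s • n) (κ * s) ⊆ Ω

lemma pOp_trans {N : ℕ} {φ : SpT N → ℝ} (h : ContDiff ℝ 2 φ) (m : ℝ) (p z : SpT N) :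
    pOp m (fun z => φ (p + z)) z = pOp m φ (p + z) := by
  have h1 := fun z => fderiv_aff h (ContinuousLinearMap.id ℝ (SpT N)) p z
  have h2 := fun z a b => fderiv2_aff h (ContinuousLinearMap.id ℝ (SpT N)) p z a b
  simp only [ContinuousLinearMap.id_apply, ContinuousLinearMap.comp_id] at h1 h2
  simp only [pOp, Dt, Gd, Lpl, h1, h2]

lemma pOp_convex {N : ℕ} {φ ψ : SpT N → ℝ} (h : ContDiff ℝ 2 φ) (h' : ContDiff ℝ 2 ψ) {m μ : ℝ}
    (hm : 1 ≤ m) (h0 : 0 ≤ μ) (h1 : μ ≤ 1) (p : SpT N) :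
    pOp m (fun q => μ * φ q + (1 - μ) * ψ q) p ≤ μ * pOp m φ p + (1 - μ) * pOp m ψ p := by
  simp only [pOp, Dt_lc h h', Lpl_lc h h', Gd_lc h h']
  have hn : ‖μ • Gd φ p + (1 - μ) • Gd ψ p‖ ≤ μ * ‖Gd φ p‖ + (1 - μ) * ‖Gd ψ p‖ := by
    refine (norm_add_le _ _).trans ?_
    rw [norm_smul, norm_smul, Real.norm_of_nonneg h0, Real.norm_of_nonneg (by linarith)]
  have h2 : ‖μ • Gd φ p + (1 - μ) • Gd ψ p‖ ^ m ≤ (μ * ‖Gd φ p‖ + (1 - μ) * ‖Gd ψ p‖) ^ m :=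
    Real.rpow_le_rpow (norm_nonneg _) hn (by linarith)
  have h3 := (convexOn_rpow hm).2 (norm_nonneg (Gd φ p)) (norm_nonneg (Gd ψ p)) h0
    (by linarith : 0 ≤ 1 - μ) (by ring)
  simp only [smul_eq_mul] at h3
  linarith

noncomputable def kap {N : ℕ} (p₀ : SpT N) (q : SpT N) : ℝ := ‖q.1 - p₀.1‖ ^ 2 + (q.2 - p₀.2) ^ 2

lemma kap_c2 {N : ℕ} (p₀ : SpT N) : ContDiff ℝ 2 (kap p₀) := by
  unfold kap
  refine ContDiff.add ?_ (by fun_prop)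
  exact (contDiff_norm_sq ℝ).comp (contDiff_fst.sub contDiff_const)

lemma kap_fderiv {N : ℕ} (p₀ : SpT N) : fderiv ℝ (kap p₀) p₀ = 0 := by
  have : IsLocalMin (kap p₀) p₀ := Eventually.of_forall fun q => by
    change kap p₀ p₀ ≤ kap p₀ q
    have : kap p₀ p₀ = 0 := by simp [kap]
    rw [this, kap]; positivity
  exact this.fderiv_eq_zero

lemma kap_ge {N : ℕ} (p₀ q : SpT N) : dist q p₀ ^ 2 ≤ kap p₀ q := by
  rw [Prod.dist_eq, kap, dist_eq_norm, Real.dist_eq]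
  have h1 := sq_nonneg ‖q.1 - p₀.1‖
  have h2 := sq_nonneg (q.2 - p₀.2)
  rcases max_choice ‖q.1 - p₀.1‖ |q.2 - p₀.2| with h | h <;> rw [h]
  · linarith
  · rw [sq_abs]; linarith

lemma pOp_kap {N : ℕ} {ψ : SpT N → ℝ} (h : ContDiff ℝ 2 ψ) (m η : ℝ) (p₀ : SpT N) :
    pOp m (fun q => 1 * ψ q + (-η) * kap p₀ q) p₀ = pOp m ψ p₀ + η * Lpl (kap p₀) p₀ := by
  have hk := kap_c2 p₀
  have e1 : Dt (kap p₀) p₀ = 0 := by rw [Dt, kap_fderiv]; simp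
  have e2 : Gd (kap p₀) p₀ = 0 := by rw [Gd, kap_fderiv]; simp
  simp only [pOp, Dt_lc h hk, Gd_lc h hk, Lpl_lc h hk, e1, e2]
  simp; ring

lemma moll_close {N : ℕ} (η : ContDiffBump (0 : SpT N)) {U : SpT N → ℝ} (hU : Continuous U) {q : SpT N} {e : ℝ}
    (h : ∀ x ∈ ball q η.rOut, dist (U x) (U q) ≤ e) : dist (moll η U q) (U q) ≤ e := by
  rw [moll_conv]
  exact η.dist_normed_convolution_le hU.aestronglyMeasurable h

set_option maxHeartbeats 1000000 in
lemma maxContra {N : ℕ} {Ω : Set (Euc N)} (hΩo : IsOpen Ω) {m μ : ℝ} (hm : 1 < m) (hμ0 : 0 ≤ μ) (hμ1 : μ < 1)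
    {U v ψ F G : SpT N → ℝ} (hU : Continuous U) (hv : Continuous v) (hψ : ContDiff ℝ 2 ψ)
    {p₀ : SpT N} (hx₀ : p₀.1 ∈ closure Ω) (hcone : ConeAt Ω p₀.1) (hF : ContinuousAt F p₀)
    (hG : ContinuousAt G p₀) {a b : ℝ} (ha : a < p₀.2) (hb : p₀.2 < b)
    (hsub : ∀ p ∈ Ω ×ˢ Ioo a b, VSubAt m (F p) U p)
    (hsup : ∀ᶠ p in 𝓝[closure Ω ×ˢ Iic p₀.2] p₀, VSuperAt Ω m (G p) v p)
    (hmax : IsLocalMaxOn (fun q => μ * U q + (1 - μ) * ψ q - v q) (closure Ω ×ˢ Iic p₀.2) p₀) :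
    G p₀ ≤ μ * F p₀ + (1 - μ) * pOp m ψ p₀ := by
  by_contra hc
  push Not at hc
  have hμ' : 0 < 1 - μ := by linarith
  set ℓ := Lpl (kap p₀) p₀ with hℓ
  -- choose constants
  obtain ⟨γ, hγ, hγ'⟩ : ∃ γ > 0, μ * F p₀ + (1 - μ) * pOp m ψ p₀ + 4 * γ < G p₀ :=
    ⟨(G p₀ - (μ * F p₀ + (1 - μ) * pOp m ψ p₀)) / 8, by linarith, by linarith⟩
  set η := γ / (|ℓ| + 1) with hη
  have hη0 : 0 < η := by positivity
  have hηℓ : η * ℓ ≤ γ := by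
    have h1 : η * ℓ ≤ η * (|ℓ| + 1) := by
      have := le_abs_self ℓ
      gcongr; linarith
    have h2 : η * (|ℓ| + 1) = γ := by rw [hη]; field_simp
    linarith
  set ψ' : SpT N → ℝ := fun q => 1 * ψ q + (-η) * kap p₀ q with hψ'
  have hψc : ContDiff ℝ 2 ψ' := lc_c2 hψ (kap_c2 p₀) _ _
  have hψ0 : pOp m ψ' p₀ ≤ pOp m ψ p₀ + γ := by
    rw [hψ', pOp_kap hψ]; linarith
  set Q := closure Ω ×ˢ Iic p₀.2 with hQ
  obtain ⟨n, κ, hκ, r0, hr0, hcone⟩ := hcone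
  -- neighbourhoods
  have e1 : ∀ᶠ p in 𝓝 p₀, F p < F p₀ + γ := hF.eventually (gt_mem_nhds (by linarith))
  have e2 : ∀ᶠ p in 𝓝 p₀, G p₀ - γ < G p := hG.eventually (lt_mem_nhds (by linarith))
  have e3 : ∀ᶠ p in 𝓝 p₀, pOp m ψ' p < pOp m ψ p₀ + 2 * γ :=
    (pOp_cont hψc (by linarith)).continuousAt.eventually (gt_mem_nhds (by linarith))
  have e4 : ∀ᶠ p in 𝓝 p₀, p ∈ Q → VSuperAt Ω m (G p) v p := eventually_nhdsWithin_iff.1 hsup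
  have e5 : ∀ᶠ p in 𝓝 p₀, p ∈ Q → μ * U p + (1 - μ) * ψ p - v p ≤ μ * U p₀ + (1 - μ) * ψ p₀ - v p₀ :=
    eventually_nhdsWithin_iff.1 hmax
  have e6 : ∀ᶠ p : SpT N in 𝓝 p₀, p.2 ∈ Ioo a b :=
    continuous_snd.continuousAt.eventually (Ioo_mem_nhds ha hb)
  have e7 : ∀ᶠ p : SpT N in 𝓝 p₀, p.1 ∈ ball p₀.1 r0 :=
    continuous_fst.continuousAt.eventually (ball_mem_nhds _ hr0)
  obtain ⟨R, hR, hball⟩ := Metric.eventually_nhds_iff_ball.1 (e1.and (e2.and (e3.and (e4.and (e5.and (e6.and e7))))))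
  set O : Set (SpT N) := (Ω ×ˢ Ioo a b) ∩ ball p₀ R with hO
  have hOo : IsOpen O := (hΩo.prod isOpen_Ioo).inter isOpen_ball
  have hOsub : ∀ p ∈ O, VSubAt m (F p₀ + γ) U p := fun p hp φ hφ hmx =>
    (hsub p hp.1 φ hφ hmx).trans (hball p hp.2).1.le
  set R' := R / 2 with hR'
  set Kc := closedBall p₀ R' ∩ Q with hKc
  have hQc : IsClosed Q := isClosed_closure.prod isClosed_Iic
  have hKcc : IsCompact Kc := (isCompact_closedBall _ _).inter_right hQc
  have hp₀K : p₀ ∈ Kc := ⟨mem_closedBall_self (by positivity), hx₀, self_mem_Iic⟩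
  set e := (1 - μ) * η * R' ^ 2 / 8 with he
  have he0 : 0 < e := by positivity
  have hun := hKcc.uniformContinuousAt_of_continuousAt U (fun x _ => hU.continuousAt) (Metric.dist_mem_uniformity he0)
  obtain ⟨δ, hδ, hδU⟩ := Metric.mem_uniformity_dist.1 hun
  have hδU' : ∀ p ∈ Kc, ∀ q, dist p q < δ → dist (U p) (U q) < e := fun p hp q hpq => hδU hpq hp
  obtain ⟨s, hs0, hs1, hs2⟩ : ∃ s : ℝ, 0 < s ∧ s < r0 ∧ s * (‖n‖ + κ) < min δ R' := by
    have hM : 0 < min δ R' := lt_min hδ (by positivity)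
    refine ⟨min (r0 / 2) (min δ R' / (2 * (‖n‖ + κ))), by positivity,
      (min_le_left _ _).trans_lt (by linarith), ?_⟩
    have hnk : 0 < ‖n‖ + κ := by positivity
    calc _ ≤ min δ R' / (2 * (‖n‖ + κ)) * (‖n‖ + κ) := by
          gcongr; exact min_le_right _ _
      _ = min δ R' / 2 := by field_simp
      _ < _ := by linarith
  have hsκ : 0 < κ * s := by positivity
  let bump : ContDiffBump (0 : SpT N) := ⟨κ * s / 2, κ * s, by positivity, by linarith⟩
  have hrOut : bump.rOut = κ * s := rfl
  set sh : SpT N := (s • n, 0) with hsh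
  have hshn : ‖sh‖ = s * ‖n‖ := by
    rw [hsh, Prod.norm_mk, norm_smul, Real.norm_of_nonneg hs0.le, norm_zero]
    exact max_eq_left (by positivity)
  set Us : SpT N → ℝ := fun q => moll bump U (sh + q) with hUs
  have hmc := moll_c2 bump hU
  have hUsc : ContDiff ℝ 2 Us := hmc.comp (contDiff_const.add contDiff_id)
  have hclose : ∀ p ∈ Kc, |Us p - U p| ≤ 3 * e := by
    intro p hp
    have hd : dist p (sh + p) < δ := by
      rw [dist_comm, dist_eq_norm, add_sub_cancel_right, hshn]
      have := lt_min_iff.1 hs2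
      nlinarith
    have h1 : dist (moll bump U (sh + p)) (U (sh + p)) ≤ 2 * e := by
      refine moll_close bump hU fun x hx => ?_
      rw [hrOut, mem_ball] at hx
      have h2 : dist p x < δ := by
        have := dist_triangle_right p x (sh + p)
        have h3 : dist p (sh + p) = s * ‖n‖ := by
          rw [dist_comm, dist_eq_norm, add_sub_cancel_right, hshn]
        have := lt_min_iff.1 hs2
        nlinarith
      have := dist_triangle_left (U x) (U (sh + p)) (U p)
      have := hδU' p hp x h2
      have := hδU' p hp _ hd
      linarith
    have h2 := hδU' p hp _ hd
    rw [← Real.dist_eq]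
    have := dist_triangle_right (Us p) (U p) (U (sh + p))
    have e : Us p = moll bump U (sh + p) := rfl
    rw [e] at this ⊢
    linarith
  obtain ⟨ps, hps, hpmax⟩ := hKcc.exists_isMaxOn ⟨p₀, hp₀K⟩
    (f := fun q => μ * Us q + (1 - μ) * ψ' q - v q)
    (by have := hUsc.continuous; have := hψc.continuous; fun_prop)
  have hpsball : ps ∈ ball p₀ R := by
    have := hps.1
    rw [mem_closedBall] at this; rw [mem_ball]; linarith
  obtain ⟨b1, b2, b3, b4, b5, b6, b7⟩ := hball ps hpsball
  have hpsin : dist ps p₀ < R' := by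
    refine lt_of_le_of_ne hps.1 fun heq => ?_
    have h1 := hpmax hp₀K
    simp only [mem_ofPred_eq] at h1
    have h2 := abs_le.1 (hclose ps hps)
    have h3 := abs_le.1 (hclose p₀ hp₀K)
    have h4 := b5 hps.2
    have h5 := kap_ge p₀ ps
    rw [heq] at h5
    have h6 : ψ' ps = ψ ps - η * kap p₀ ps := by rw [hψ']; ring
    have h7 : ψ' p₀ = ψ p₀ := by rw [hψ']; simp [kap]
    rw [h6, h7] at h1
    have h8 : (1 - μ) * (η * R' ^ 2) ≤ (1 - μ) * (η * kap p₀ ps) := by gcongr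
    have h9 : μ * (Us ps - U ps) ≤ 3 * e := by nlinarith
    have h10 : -(3 * e) ≤ μ * (Us p₀ - U p₀) := by nlinarith
    have h11 : (1 - μ) * (η * R' ^ 2) = 8 * e := by rw [he]; ring
    nlinarith
  have htest := b4 hps.2 (fun q => μ * Us q + (1 - μ) * ψ' q) (lc_c2 hUsc hψc _ _) ?_
  · have h1 := pOp_convex hUsc hψc hm.le hμ0 hμ1.le ps
    have h2 : pOp m Us ps ≤ F p₀ + γ := by
      have htr : pOp m Us ps = pOp m (moll bump U) (sh + ps) := pOp_trans hmc m sh ps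
      rw [htr]
      refine nlMoll bump hU hm hOo hOsub ?_
      intro z hz
      rw [hrOut, mem_closedBall] at hz
      have hz1 : dist z.1 (ps.1 + s • n) ≤ κ * s := by
        have := (Prod.dist_eq (x := z) (y := sh + ps)) ▸ hz
        have h3 := (max_le_iff.1 this).1
        simpa [hsh, add_comm] using h3
      have hzd : dist z p₀ < R := by
        have h3 := dist_triangle z (sh + ps) p₀
        have h4 := dist_triangle (sh + ps) ps p₀
        have h5 : dist (sh + ps) ps = s * ‖n‖ := by rw [dist_eq_norm, add_sub_cancel_right, hshn]
        have := lt_min_iff.1 hs2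
        nlinarith
      refine ⟨⟨hcone ps.1 hps.2.1 b7 s hs0 hs1 (mem_closedBall.2 hz1), ?_⟩, hzd⟩
      exact (hball z hzd).2.2.2.2.2.1
    have h3 : μ * pOp m Us ps ≤ μ * (F p₀ + γ) := by gcongr
    have h4 : (1 - μ) * pOp m ψ' ps ≤ (1 - μ) * (pOp m ψ p₀ + 2 * γ) := by gcongr
    nlinarith
  · have hnb : ball p₀ R' ∈ 𝓝 ps := isOpen_ball.mem_nhds hpsin
    have : ∀ᶠ q in 𝓝[closure Ω ×ˢ Iic ps.2] ps, q ∈ closure Ω ×ˢ Iic ps.2 ∧ q ∈ ball p₀ R' :=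
      eventually_mem_nhdsWithin.and (mem_nhdsWithin_of_mem_nhds hnb)
    filter_upwards [this] with q hq
    have hqK : q ∈ Kc := ⟨ball_subset_closedBall hq.2, hq.1.1, mem_Iic.2 (le_trans (mem_Iic.1 hq.1.2) (mem_Iic.1 hps.2.2))⟩
    have := hpmax hqK
    simp only [mem_ofPred_eq] at this
    linarith


lemma closure_rho {N : ℕ} {Ω : Set (Euc N)} {ρ : Euc N → ℝ} (hρ : Continuous ρ)
    (h1 : Ω = {x | ρ x < 0}) {x : Euc N} (hx : x ∈ closure Ω) : ρ x ≤ 0 := by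
  have h2 : closure Ω ⊆ {x | ρ x ≤ 0} :=
    closure_minimal (by rw [h1]; exact fun y (hy : ρ y < 0) => (show ρ y ≤ 0 from le_of_lt hy)) (isClosed_le hρ continuous_const)
  exact h2 hx

lemma cone {N : ℕ} {Ω : Set (Euc N)} (hΩo : IsOpen Ω) (hΩ2 : HasC2Boundary Ω) {x₀ : Euc N}
    (hx₀ : x₀ ∈ closure Ω) : ConeAt Ω x₀ := by
  by_cases hin : x₀ ∈ Ω
  · obtain ⟨ε, hε, hb⟩ := Metric.isOpen_iff.1 hΩo x₀ hin
    refine ⟨0, 1, one_pos, ε / 3, by positivity, fun x _ hx s hs0 hs y hy => hb ?_⟩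
    rw [smul_zero, add_zero, one_mul, mem_closedBall] at hy
    rw [mem_ball]
    have := dist_triangle y x x₀
    linarith
  obtain ⟨ρ, hρ, hΩ, hfr, hgr⟩ := hΩ2
  have hxf : x₀ ∈ frontier Ω := by rw [frontier, hΩo.interior_eq]; exact ⟨hx₀, hin⟩
  set p := fderiv ℝ ρ x₀ with hp
  have hp0 : p ≠ 0 := by
    intro h0
    apply hgr x₀ hxf
    rw [← norm_eq_zero, norm_grad, ← hp, h0, norm_zero]
  obtain ⟨e, he⟩ : ∃ e, p e = -1 := by
    obtain ⟨e, he⟩ : ∃ e, p e ≠ 0 := by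
      by_contra hc
      push Not at hc
      exact hp0 (ContinuousLinearMap.ext hc)
    exact ⟨(-(p e)⁻¹) • e, by simp [he]⟩
  set κ : ℝ := 1 / (4 * (‖p‖ + 1)) with hκ
  have hκ0 : 0 < κ := by positivity
  have hκp : ‖p‖ * κ ≤ 1 / 4 := by
    rw [hκ, mul_one_div, div_le_div_iff₀ (by positivity) (by norm_num)]; linarith
  have hek : 0 < ‖e‖ + κ := by positivity
  set c : ℝ := 1 / (4 * (‖e‖ + κ)) with hc
  have hc0 : 0 < c := by positivity
  have hstr : HasStrictFDerivAt ρ p x₀ := hρ.contDiffAt.hasStrictFDerivAt (by norm_num)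
  have hlo := hstr.isLittleO.def hc0
  obtain ⟨ε, hε, hb'⟩ := Metric.eventually_nhds_iff.1 hlo
  have hb : ∀ a b : Euc N, dist a x₀ < ε → dist b x₀ < ε → ‖ρ a - ρ b - p (a - b)‖ ≤ c * ‖a - b‖ :=
    fun a b h1 h2 => hb' (y := (a, b)) (by rw [Prod.dist_eq]; exact max_lt h1 h2)
  set r0 := ε / (2 * (1 + ‖e‖ + κ)) with hr0
  have hD : 0 < 1 + ‖e‖ + κ := by positivity
  have hr00 : 0 < r0 := by positivity
  have hr0e : r0 * (1 + ‖e‖ + κ) = ε / 2 := by rw [hr0]; field_simp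
  refine ⟨e, κ, hκ0, r0, hr00, fun x hx hxd s hs0 hs y hy => ?_⟩
  rw [mem_closedBall, dist_eq_norm] at hy
  set w := y - (x + s • e) with hw
  have hyx : y - x = s • e + w := by rw [hw]; abel
  have hnyx : ‖y - x‖ ≤ s * (‖e‖ + κ) := by
    rw [hyx]
    refine (norm_add_le _ _).trans ?_
    rw [norm_smul, Real.norm_of_nonneg hs0.le]
    linarith
  have hyd : dist y x₀ < ε := by
    have h1 := dist_triangle y x x₀
    rw [dist_eq_norm y x] at h1
    have h2 : s * (‖e‖ + κ) ≤ r0 * (‖e‖ + κ) := by gcongr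
    nlinarith
  have hxd' : dist x x₀ < ε := by nlinarith
  have h1 := hb y x hyd hxd'
  rw [Real.norm_eq_abs] at h1
  have h2 := (abs_le.1 h1).2
  have h3 : p (y - x) ≤ -s + ‖p‖ * (κ * s) := by
    rw [hyx, map_add, map_smul, he]
    have h4 := (le_abs_self _).trans (p.le_opNorm w)
    have h5 : ‖p‖ * ‖w‖ ≤ ‖p‖ * (κ * s) := by gcongr
    simp only [smul_eq_mul]; linarith
  have h4 : c * ‖y - x‖ ≤ s / 4 := by
    calc c * ‖y - x‖ ≤ c * (s * (‖e‖ + κ)) := by gcongr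
      _ = s / 4 := by rw [hc]; field_simp
  have h5 : ρ x ≤ 0 := closure_rho hρ.continuous hΩ hx
  have h6 : ‖p‖ * (κ * s) ≤ s / 4 := by nlinarith
  rw [hΩ]
  change ρ y < 0
  linarith


structure Dom {N : ℕ} (Ω : Set (Euc N)) : Prop where
  op : IsOpen Ω
  cpt : IsCompact (closure Ω)
  ne : Ω.Nonempty
  cone : ∀ x ∈ closure Ω, ConeAt Ω x

def SubP {N : ℕ} (Ω : Set (Euc N)) (m : ℝ) (F : Euc N → ℝ) (U : SpT N → ℝ) (a : ℝ) : Prop :=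
  ∀ p ∈ Ω ×ˢ Ioi a, VSubAt m (F p.1) U p

def SupP {N : ℕ} (Ω : Set (Euc N)) (m : ℝ) (F : Euc N → ℝ) (v : SpT N → ℝ) (a : ℝ) : Prop :=
  ∀ p ∈ closure Ω ×ˢ Ioi a, VSuperAt Ω m (F p.1) v p

lemma maxCyl {N : ℕ} {Ω : Set (Euc N)} (D : Dom Ω) {m μ : ℝ} (hm : 1 < m) (hμ0 : 0 ≤ μ) (hμ1 : μ < 1)
    {F : Euc N → ℝ} {U v ψ G : SpT N → ℝ} (hF : Continuous F) (hG : Continuous G)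
    (hU : Continuous U) (hv : Continuous v) (hψ : ContDiff ℝ 2 ψ)
    {p₀ : SpT N} {a : ℝ} (hx₀ : p₀.1 ∈ closure Ω) (ha : a < p₀.2)
    (hsub : SubP Ω m F U a)
    (hsup : ∀ᶠ p in 𝓝[closure Ω ×ˢ Iic p₀.2] p₀, VSuperAt Ω m (G p) v p)
    (hmax : ∀ᶠ q in 𝓝[closure Ω ×ˢ Iic p₀.2] p₀,
      μ * U q + (1 - μ) * ψ q - v q ≤ μ * U p₀ + (1 - μ) * ψ p₀ - v p₀) :
    G p₀ ≤ μ * F p₀.1 + (1 - μ) * pOp m ψ p₀ :=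
  maxContra (F := fun p => F p.1) D.op hm hμ0 hμ1 hU hv hψ hx₀ (D.cone _ hx₀)
    (hF.comp continuous_fst).continuousAt hG.continuousAt ha (lt_add_one p₀.2)
    (fun p hp => hsub p ⟨hp.1, hp.2.1⟩) hsup hmax

/-- eventually in the past cylinder we are in a set which contains recent times -/
lemma ev_past {N : ℕ} {Ω : Set (Euc N)} {p₀ : SpT N} {a : ℝ} (ha : a < p₀.2) :
    ∀ᶠ q in 𝓝[closure Ω ×ˢ Iic p₀.2] p₀, q.1 ∈ closure Ω ∧ a < q.2 ∧ q.2 ≤ p₀.2 := by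
  have h1 : ∀ᶠ q : SpT N in 𝓝[closure Ω ×ˢ Iic p₀.2] p₀, a < q.2 :=
    mem_nhdsWithin_of_mem_nhds (continuous_snd.continuousAt.eventually (lt_mem_nhds ha))
  filter_upwards [h1, eventually_mem_nhdsWithin] with q h2 h3
  exact ⟨h3.1, h2, h3.2⟩

lemma pOp_time {N : ℕ} {τ : ℝ → ℝ} (h : ContDiff ℝ 2 τ) {m : ℝ} (hm : 0 < m) (p : SpT N) :
    pOp m (fun q : SpT N => τ q.2) p = deriv τ p.2 := by
  rw [pOp, timefun_Dt h, timefun_Gd h, timefun_Lpl h]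
  simp [hm.ne']

lemma bdd_cyl {N : ℕ} {Ω : Set (Euc N)} (D : Dom Ω) {U : SpT N → ℝ} (hU : Continuous U) (a t : ℝ) :
    ∃ B > 0, ∀ p ∈ closure Ω ×ˢ Icc a t, |U p| ≤ B := by
  obtain ⟨B, hB⟩ := (D.cpt.prod isCompact_Icc).exists_bound_of_continuousOn (f := U) hU.continuousOn
  exact ⟨max B 1, by positivity, fun p hp => (hB p hp).trans (le_max_left _ _)⟩

lemma bdd_F {N : ℕ} {Ω : Set (Euc N)} (D : Dom Ω) {F : Euc N → ℝ} (hF : Continuous F) :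
    ∃ B > 0, ∀ x ∈ closure Ω, |F x| ≤ B := by
  obtain ⟨B, hB⟩ := D.cpt.exists_bound_of_continuousOn (f := F) hF.continuousOn
  exact ⟨max B 1, by positivity, fun p hp => (hB p hp).trans (le_max_left _ _)⟩

/-- comparison, where `v` is only required to be a supersolution where `v < U` -/
lemma comp0 {N : ℕ} {Ω : Set (Euc N)} (D : Dom Ω) {m : ℝ} (hm : 1 < m)
    {F : Euc N → ℝ} {U v : SpT N → ℝ} (hF : Continuous F)
    (hU : Continuous U) (hv : Continuous v) {a : ℝ}
    (hsub : SubP Ω m F U a)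
    (hsup : ∀ p ∈ closure Ω ×ˢ Ioi a, v p < U p → VSuperAt Ω m (F p.1) v p)
    (hinit : ∀ x ∈ closure Ω, U (x, a) ≤ v (x, a)) :
    ∀ p ∈ closure Ω ×ˢ Ici a, U p ≤ v p := by
  rintro ⟨x₁, t₁⟩ ⟨hx₁, ht₁⟩
  simp only [mem_Ici] at hx₁ ht₁
  by_contra hc
  push Not at hc
  obtain ⟨B, hB, hUB⟩ := bdd_cyl D hU a t₁
  obtain ⟨L, hL, hFL⟩ := bdd_F D hF
  set τ : ℝ → ℝ := fun t => -(L + 1) * (t - a) - B with hτ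
  have hτc : ContDiff ℝ 2 τ := by rw [hτ]; fun_prop
  have hτd : ∀ t, deriv τ t = -(L + 1) := by
    intro t
    have h1 : HasDerivAt τ (-(L + 1) * 1) t :=
      (((hasDerivAt_id t).sub_const a).const_mul (-(L + 1))).sub_const B
    rw [h1.deriv, mul_one]
  set ψ : SpT N → ℝ := fun q => τ q.2 with hψ
  have hψc : ContDiff ℝ 2 ψ := timefun_c2 hτc
  set d := U (x₁, t₁) - v (x₁, t₁) with hd
  have hd0 : 0 < d := by rw [hd]; linarith
  set E := 2 * B + (L + 1) * (t₁ - a) with hE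
  have hE0 : 0 < E := by
    have : 0 ≤ (L + 1) * (t₁ - a) := by apply mul_nonneg <;> linarith
    linarith
  obtain ⟨ν, hν0, hν1, hνE⟩ : ∃ ν : ℝ, 0 < ν ∧ ν ≤ 1 ∧ ν * E ≤ d / 2 := by
    refine ⟨min 1 (d / (2 * E)), by positivity, min_le_left _ _, ?_⟩
    calc _ ≤ d / (2 * E) * E := by gcongr; exact min_le_right _ _
      _ = d / 2 := by field_simp
  set W : SpT N → ℝ := fun q => (1 - ν) * U q + (1 - (1 - ν)) * ψ q - v q with hW
  have hWc : Continuous W := by have := hψc.continuous; fun_prop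
  obtain ⟨p₀, hp₀, hpm⟩ := (D.cpt.prod (isCompact_Icc (a := a) (b := t₁))).exists_isMaxOn
    ⟨(x₁, t₁), hx₁, right_mem_Icc.2 ht₁⟩ hWc.continuousOn
  have hψle : ∀ p ∈ closure Ω ×ˢ Icc a t₁, ψ p ≤ -B := by
    intro p hp
    have : 0 ≤ (L + 1) * (p.2 - a) := by apply mul_nonneg <;> linarith [hp.2.1]
    simp only [hψ, hτ]; linarith
  have hWle : ∀ p ∈ closure Ω ×ˢ Icc a t₁, W p ≤ U p - v p := by
    intro p hp
    have h1 := hψle p hp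
    have h2 := (abs_le.1 (hUB p hp)).1
    simp only [hW]; nlinarith
  have hW1 : 0 < W (x₁, t₁) := by
    have h2 := (abs_le.1 (hUB (x₁, t₁) ⟨hx₁, right_mem_Icc.2 ht₁⟩)).2
    have : W (x₁, t₁) = d - ν * (U (x₁, t₁) + (L + 1) * (t₁ - a) + B) := by
      simp only [hW, hψ, hτ, hd]; ring
    rw [this]
    have : ν * (U (x₁, t₁) + (L + 1) * (t₁ - a) + B) ≤ ν * E :=
      mul_le_mul_of_nonneg_left (by rw [hE]; linarith) hν0.le
    linarith
  have hWp : 0 < W p₀ := hW1.trans_le (hpm ⟨hx₁, right_mem_Icc.2 ht₁⟩)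
  have hpos : v p₀ < U p₀ := by have := hWle p₀ hp₀; linarith
  have hap : a < p₀.2 := by
    refine lt_of_le_of_ne hp₀.2.1 fun h => ?_
    have := hinit p₀.1 hp₀.1
    rw [h, Prod.mk.eta] at this
    linarith
  have key := maxCyl D hm (μ := 1 - ν) (by linarith) (by linarith) hF (hF.comp continuous_fst) hU hv hψc
    hp₀.1 hap hsub ?_ ?_
  · rw [hψ, pOp_time hτc (by linarith), hτd] at key
    have h1 := (abs_le.1 (hFL p₀.1 hp₀.1)).1
    simp only [Function.comp] at key
    nlinarith
  · have h1 : ∀ᶠ q in 𝓝[closure Ω ×ˢ Iic p₀.2] p₀, v q < U q :=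
      mem_nhdsWithin_of_mem_nhds ((isOpen_lt hv hU).mem_nhds hpos)
    filter_upwards [h1, ev_past hap] with q h2 h3
    exact hsup q ⟨h3.1, h3.2.1⟩ h2
  · filter_upwards [ev_past hap] with q h3
    exact hpm ⟨h3.1, h3.2.1.le, h3.2.2.trans hp₀.2.2⟩

lemma comp {N : ℕ} {Ω : Set (Euc N)} (D : Dom Ω) {m : ℝ} (hm : 1 < m)
    {F : Euc N → ℝ} {U v : SpT N → ℝ} (hF : Continuous F)
    (hU : Continuous U) (hv : Continuous v) {a C : ℝ}
    (hsub : SubP Ω m F U a) (hsup : SupP Ω m F v a)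
    (hinit : ∀ x ∈ closure Ω, U (x, a) ≤ v (x, a) + C) :
    ∀ p ∈ closure Ω ×ˢ Ici a, U p ≤ v p + C := by
  have hsub' : SubP Ω m F (fun p => U p + (-C)) a := by
    intro p hp φ hφ hmax
    refine hsub p hp φ hφ ?_
    filter_upwards [hmax] with q hq
    linarith
  have := comp0 D hm (U := fun p => U p + (-C)) hF (by fun_prop) hv hsub' (fun p hp _ => hsup p hp)
    (fun x hx => by have := hinit x hx; linarith)
  intro p hp
  have := this p hp
  linarith


lemma sum_sq_clm {N : ℕ} (l : Euc N →L[ℝ] ℝ) : ∑ i : Fin N, l (EuclideanSpace.single i 1) ^ 2 = ‖l‖ ^ 2 := by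
  set e := (InnerProductSpace.toDual ℝ (Euc N)).symm l with he
  have h1 : ‖l‖ = ‖e‖ := by rw [he]; simp
  have h2 : ∀ x, l x = inner ℝ e x := fun x => by
    rw [he, InnerProductSpace.toDual_symm_apply]
  rw [h1, EuclideanSpace.norm_sq_eq]
  refine Finset.sum_congr rfl fun i _ => ?_
  rw [h2, EuclideanSpace.inner_single_right]; simp

lemma chain_c2 {N : ℕ} {θ : SpT N → ℝ} (h : ContDiff ℝ 2 θ) {g : ℝ → ℝ} (hg : ContDiff ℝ 2 g) :
    ContDiff ℝ 2 (fun q => g (θ q)) := hg.comp h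

lemma chain_fd {N : ℕ} {θ : SpT N → ℝ} (h : ContDiff ℝ 2 θ) {g : ℝ → ℝ} (hg : ContDiff ℝ 2 g) (p : SpT N) :
    fderiv ℝ (fun q => g (θ q)) p = deriv g (θ p) • fderiv ℝ θ p :=
  ((c2_diff hg (θ p)).hasDerivAt.comp_hasFDerivAt p (c2_diff h p).hasFDerivAt).fderiv

lemma chain_Dt {N : ℕ} {θ : SpT N → ℝ} (h : ContDiff ℝ 2 θ) {g : ℝ → ℝ} (hg : ContDiff ℝ 2 g) (p : SpT N) :
    Dt (fun q => g (θ q)) p = deriv g (θ p) * Dt θ p := by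
  simp [Dt, chain_fd h hg]

lemma chain_Gd {N : ℕ} {θ : SpT N → ℝ} (h : ContDiff ℝ 2 θ) {g : ℝ → ℝ} (hg : ContDiff ℝ 2 g) (p : SpT N) :
    Gd (fun q => g (θ q)) p = deriv g (θ p) • Gd θ p := by
  simp [Gd, chain_fd h hg, ContinuousLinearMap.smul_comp]

lemma chain_Lpl {N : ℕ} {θ : SpT N → ℝ} (h : ContDiff ℝ 2 θ) {g : ℝ → ℝ} (hg : ContDiff ℝ 2 g) (p : SpT N) :
    Lpl (fun q => g (θ q)) p = deriv (deriv g) (θ p) * ‖Gd θ p‖ ^ 2 + deriv g (θ p) * Lpl θ p := by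
  have e : fderiv ℝ (fun q => g (θ q)) = fun p => deriv g (θ p) • fderiv ℝ θ p := by
    ext1 q; exact chain_fd h hg q
  have hg' : Differentiable ℝ (deriv g) := by
    have h2 : ContDiff ℝ (1 + 1) g := by simpa [one_add_one_eq_two] using hg
    exact (contDiff_succ_iff_deriv.1 h2).2.2.differentiable (by norm_num)
  have h1 := ((hg' (θ p)).hasDerivAt.comp_hasFDerivAt p (c2_diff h p).hasFDerivAt).smul (c2_diff2 h p).hasFDerivAt
  have h2 : fderiv ℝ (fun p => deriv g (θ p) • fderiv ℝ θ p) p = _ := h1.fderiv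
  rw [Lpl, e, h2, ← sum_sq_clm, Lpl, Finset.mul_sum, Finset.mul_sum, ← Finset.sum_add_distrib]
  refine Finset.sum_congr rfl fun i _ => ?_
  simp [Gd, eb, Function.comp]
  ring

lemma tmul_c2 {N : ℕ} {φ : SpT N → ℝ} (h : ContDiff ℝ 2 φ) {σ : ℝ → ℝ} (hs : ContDiff ℝ 2 σ) :
    ContDiff ℝ 2 (fun q : SpT N => σ q.2 * φ q) := (timefun_c2 hs).mul h

lemma tmul_Gd {N : ℕ} {φ : SpT N → ℝ} (h : ContDiff ℝ 2 φ) {σ : ℝ → ℝ} (hs : ContDiff ℝ 2 σ) (p : SpT N) :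
    Gd (fun q : SpT N => σ q.2 * φ q) p = σ p.2 • Gd φ p :=
  (sec_hasFDeriv (tmul_c2 h hs) p.1 p.2).unique ((sec_hasFDeriv h p.1 p.2).const_mul (σ p.2))

lemma tmul_Lpl {N : ℕ} {φ : SpT N → ℝ} (h : ContDiff ℝ 2 φ) {σ : ℝ → ℝ} (hs : ContDiff ℝ 2 σ) (p : SpT N) :
    Lpl (fun q : SpT N => σ q.2 * φ q) p = σ p.2 * Lpl φ p := by
  have h1 := lapl_sec (tmul_c2 h hs) p.1 p.2
  have h2 := lapl_sec (lc_c2 h h (σ p.2) 0) p.1 p.2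
  have h3 := Lpl_lc h h (σ p.2) 0 p
  simp only [zero_mul, add_zero, Prod.mk.eta] at h1 h2 h3
  rw [← h1, h2, h3]

lemma tmul_Dt {N : ℕ} {φ : SpT N → ℝ} (h : ContDiff ℝ 2 φ) {σ : ℝ → ℝ} (hs : ContDiff ℝ 2 σ) (p : SpT N) :
    Dt (fun q : SpT N => σ q.2 * φ q) p = deriv σ p.2 * φ p + σ p.2 * Dt φ p :=
  (sec_hasDeriv (tmul_c2 h hs) p.1 p.2).unique
    ((c2_diff hs p.2).hasDerivAt.mul (sec_hasDeriv h p.1 p.2))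

/-- squared distance -/
noncomputable def nsq {N : ℕ} (y : Euc N) (q : SpT N) : ℝ := ‖q.1 - y‖ ^ 2

lemma nsq_c2 {N : ℕ} (y : Euc N) : ContDiff ℝ 2 (nsq y) :=
  (contDiff_norm_sq ℝ).comp (contDiff_fst.sub contDiff_const)

lemma nsq_fd {N : ℕ} (y : Euc N) (p : SpT N) : fderiv ℝ (nsq y) p =
    (2 : ℝ) • (innerSL ℝ (p.1 - y)).comp (ContinuousLinearMap.fst ℝ (Euc N) ℝ) := by
  have h1 : HasFDerivAt (fun q : SpT N => q.1 - y) (ContinuousLinearMap.fst ℝ (Euc N) ℝ) p :=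
    (hasFDerivAt_fst).sub_const y
  have := h1.norm_sq
  refine this.fderiv.trans ?_
  ext <;> simp

lemma nsq_Dt {N : ℕ} (y : Euc N) (p : SpT N) : Dt (nsq y) p = 0 := by
  simp [Dt, nsq_fd]

lemma nsq_Gd {N : ℕ} (y : Euc N) (p : SpT N) : ‖Gd (nsq y) p‖ = 2 * ‖p.1 - y‖ := by
  have : Gd (nsq y) p = (2 : ℝ) • innerSL ℝ (p.1 - y) := by
    ext z; simp [Gd, nsq_fd]
  rw [this, norm_smul, innerSL_apply_norm]; simp

lemma nsq_Lpl {N : ℕ} (y : Euc N) (p : SpT N) : Lpl (nsq y) p = 2 * N := by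
  set A : SpT N →L[ℝ] (SpT N →L[ℝ] ℝ) := (2 : ℝ) • ((ContinuousLinearMap.compL ℝ (SpT N) (Euc N) ℝ).flip
      (ContinuousLinearMap.fst ℝ (Euc N) ℝ)).comp ((innerSL ℝ).comp (ContinuousLinearMap.fst ℝ (Euc N) ℝ)) with hA
  have e : fderiv ℝ (nsq y) = fun p => A (p - (y, 0)) := by
    ext1 q; rw [nsq_fd]; ext <;> simp [hA]
  have h1 : HasFDerivAt (fun p => A (p - (y, 0))) A p := by
    have := A.hasFDerivAt.comp p ((hasFDerivAt_id p).sub_const (y, 0))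
    rw [ContinuousLinearMap.comp_id] at this
    exact this
  rw [Lpl, e, h1.fderiv]
  simp [hA, eb]
  ring

/-- local to global `C²` extension in one variable -/
lemma c2_extend {g : ℝ → ℝ} {s₀ : ℝ} (h : ContDiffAt ℝ 2 g s₀) :
    ∃ G : ℝ → ℝ, ContDiff ℝ 2 G ∧ G =ᶠ[𝓝 s₀] g := by
  have h1 := h.eventually (by simp)
  obtain ⟨ε, hε, hb⟩ := Metric.eventually_nhds_iff_ball.1 h1
  let b : ContDiffBump s₀ := ⟨ε / 4, ε / 2, by positivity, by linarith⟩
  refine ⟨fun s => b s * g s, ?_, ?_⟩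
  · rw [contDiff_iff_contDiffAt]
    intro x
    by_cases hx2 : x ∈ tsupport b
    · rw [b.tsupport_eq, mem_closedBall] at hx2
      exact b.contDiff.contDiffAt.mul (hb x (by rw [mem_ball]; change dist x s₀ ≤ ε / 2 at hx2; linarith))
    · have h3 := notMem_tsupport_iff_eventuallyEq.1 hx2
      refine (contDiffAt_const (c := (0 : ℝ))).congr_of_eventuallyEq ?_
      filter_upwards [h3] with s hs
      rw [hs]; simp
  · filter_upwards [b.eventuallyEq_one] with s hs
    rw [hs]; simp


lemma vsub_trans {N : ℕ} {m F : ℝ} {U : SpT N → ℝ} {z p : SpT N} (h : VSubAt m F U (z + p)) :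
    VSubAt m F (fun q => U (z + q)) p := by
  intro φ hφ hmax
  have hφ' : ContDiff ℝ 2 (fun q => φ (-z + q)) := hφ.comp (by fun_prop)
  have h1 := h (fun q => φ (-z + q)) hφ' ?_
  · rw [pOp_trans hφ, neg_add_cancel_left] at h1; exact h1
  · have ht : Tendsto (fun q : SpT N => -z + q) (𝓝 (z + p)) (𝓝 p) := by
      have : Continuous (fun q : SpT N => -z + q) := by fun_prop
      simpa using this.tendsto (z + p)
    filter_upwards [ht.eventually hmax] with q hq
    simpa using hq

lemma vsup_trans {N : ℕ} {Ω : Set (Euc N)} {m F h : ℝ} {U : SpT N → ℝ} {p : SpT N}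
    (hp : VSuperAt Ω m F U ((0, h) + p)) :
    VSuperAt Ω m F (fun q => U ((0, h) + q)) p := by
  intro φ hφ hmax
  set z : SpT N := (0, h) with hz
  have hφ' : ContDiff ℝ 2 (fun q => φ (-z + q)) := hφ.comp (by fun_prop)
  have h1 := hp (fun q => φ (-z + q)) hφ' ?_
  · rw [pOp_trans hφ, neg_add_cancel_left] at h1; exact h1
  · have ht : Tendsto (fun q : SpT N => -z + q) (𝓝[closure Ω ×ˢ Iic (z + p).2] (z + p)) (𝓝[closure Ω ×ˢ Iic p.2] p) := by
      have : Continuous (fun q : SpT N => -z + q) := by fun_prop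
      refine tendsto_nhdsWithin_iff.2 ⟨?_, ?_⟩
      · have := this.tendsto (z + p)
        rw [neg_add_cancel_left] at this
        exact this.mono_left nhdsWithin_le_nhds
      · filter_upwards [self_mem_nhdsWithin] with q hq
        obtain ⟨h1, h2⟩ := hq
        simp only [hz, Prod.snd_add, mem_Iic] at h2
        refine ⟨?_, ?_⟩
        · simpa [hz] using h1
        · simp only [hz, Prod.snd_add, Prod.snd_neg, mem_Iic]; linarith
    filter_upwards [ht.eventually hmax] with q hq
    simpa using hq

lemma subP_trans {N : ℕ} {Ω : Set (Euc N)} {m a b h : ℝ} {F : Euc N → ℝ} {U : SpT N → ℝ} (hU : SubP Ω m F U a)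
    (hb : a ≤ b + h) : SubP Ω m F (fun q => U ((0, h) + q)) b := by
  intro p hp
  have hp2 := hp.2
  simp only [mem_Ioi] at hp2
  have := hU ((0, h) + p) ⟨by simpa using hp.1, by simp only [Prod.snd_add, mem_Ioi]; linarith⟩
  simp only [Prod.fst_add, zero_add] at this
  exact vsub_trans this

lemma supP_trans {N : ℕ} {Ω : Set (Euc N)} {m a b h : ℝ} {F : Euc N → ℝ} {U : SpT N → ℝ} (hU : SupP Ω m F U a)
    (hb : a ≤ b + h) : SupP Ω m F (fun q => U ((0, h) + q)) b := by
  intro p hp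
  have hp2 := hp.2
  simp only [mem_Ioi] at hp2
  have := hU ((0, h) + p) ⟨by simpa using hp.1, by simp only [Prod.snd_add, mem_Ioi]; linarith⟩
  simp only [Prod.fst_add, zero_add] at this
  exact vsup_trans this

lemma time_mod {N : ℕ} {Ω : Set (Euc N)} (D : Dom Ω) {m : ℝ} (hm : 1 < m)
    {F : Euc N → ℝ} {w : SpT N → ℝ} (hF : Continuous F) (hw : Continuous w)
    (hsub : SubP Ω m F w 0) (hsup : SupP Ω m F w 0) {ε : ℝ} (hε : 0 < ε) :
    ∃ η > 0, ∀ x ∈ closure Ω, ∀ s t : ℝ, 0 ≤ s → 0 ≤ t → |s - t| ≤ η → |w (x, s) - w (x, t)| ≤ ε := by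
  have huc := (D.cpt.prod (isCompact_Icc (a := (0:ℝ)) (b := 1))).uniformContinuousOn_of_continuous hw.continuousOn
  obtain ⟨η, hη, hu⟩ := Metric.uniformContinuousOn_iff.1 huc ε hε
  have key : ∀ x ∈ closure Ω, ∀ h : ℝ, 0 ≤ h → h ≤ min 1 (η / 2) → |w (x, h) - w (x, 0)| ≤ ε := by
    intro x hx h h0 h1
    have h2 := h1.trans (min_le_left _ _)
    have h3 := h1.trans (min_le_right _ _)
    have := hu (x, h) ⟨hx, h0, h2⟩ (x, 0) ⟨hx, by simp⟩ (by
      rw [Prod.dist_eq, dist_self, Real.dist_eq]; simp [abs_of_nonneg h0]; constructor <;> linarith)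
    exact this.le
  have main : ∀ x ∈ closure Ω, ∀ t h : ℝ, 0 ≤ t → 0 ≤ h → h ≤ min 1 (η / 2) → |w (x, t + h) - w (x, t)| ≤ ε := by
    intro x hx t h ht h0 h1
    have hc : Continuous (fun q : SpT N => w ((0, h) + q)) := by fun_prop
    have c1 := comp D hm hF hc hw (a := 0) (C := ε) (subP_trans hsub (by linarith)) hsup (fun y hy => by
      have := (abs_le.1 (key y hy h h0 h1)).2
      simp; linarith) (x, t) ⟨hx, ht⟩
    have c2 := comp D hm hF hw hc (a := 0) (C := ε) hsub (supP_trans hsup (by linarith)) (fun y hy => by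
      have := (abs_le.1 (key y hy h h0 h1)).1
      simp; linarith) (x, t) ⟨hx, ht⟩
    simp only [Prod.mk_add_mk, zero_add] at c1 c2
    rw [add_comm t h, abs_le]; constructor <;> linarith
  refine ⟨min 1 (η / 2), by positivity, fun x hx s t hs ht hst => ?_⟩
  rcases le_total s t with h | h
  · have := main x hx s (t - s) hs (by linarith) (by rw [abs_le] at hst; linarith)
    rw [add_sub_cancel, abs_sub_comm] at this; exact this
  · have := main x hx t (s - t) ht (by linarith) (by rw [abs_le] at hst; linarith)
    rw [add_sub_cancel] at this; exact this


lemma pow_germ (A β : ℝ) {s₀ : ℝ} (hs : 0 < s₀) : ∃ G : ℝ → ℝ, ContDiff ℝ 2 G ∧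
    (∀ᶠ s in 𝓝 s₀, G s = A * s ^ β) ∧ deriv G s₀ = A * (β * s₀ ^ (β - 1)) ∧
    deriv (deriv G) s₀ = A * (β * ((β - 1) * s₀ ^ (β - 1 - 1))) := by
  have h0 : ContDiffAt ℝ 2 (fun s : ℝ => A * s ^ β) s₀ :=
    contDiffAt_const.mul (Real.contDiffAt_rpow_const_of_ne hs.ne')
  obtain ⟨G, hG, he⟩ := c2_extend h0
  have hd : ∀ s : ℝ, 0 < s → ∀ (A β : ℝ), HasDerivAt (fun s : ℝ => A * s ^ β) (A * (β * s ^ (β - 1))) s := fun s hs A β =>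
    (Real.hasDerivAt_rpow_const (Or.inl hs.ne')).const_mul A
  have h1 : deriv G =ᶠ[𝓝 s₀] fun s => (A * β) * s ^ (β - 1) := by
    filter_upwards [he.deriv, lt_mem_nhds hs] with s h2 h3
    rw [h2, (hd s h3 A β).deriv, mul_assoc]
  refine ⟨G, hG, he, ?_, ?_⟩
  · exact h1.self_of_nhds.trans (mul_assoc _ _ _)
  · rw [h1.deriv_eq, (hd s₀ hs (A * β) (β - 1)).deriv, mul_assoc]

/-- the Hölder barrier -/
lemma holder_bar {N : ℕ} {m A α B t : ℝ} (hm : 2 < m) (hα : α = (m - 2) / (m - 1)) (hA : 0 < A)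
    {y : Euc N} {p : SpT N} (hp : p.1 ≠ y) :
    ∃ φ : SpT N → ℝ, ContDiff ℝ 2 φ ∧ (∀ᶠ q in 𝓝 p, φ q = A * ‖q.1 - y‖ ^ α + B * (q.2 - t) ^ 2) ∧
      pOp m φ p = 2 * B * (p.2 - t) + ((A * α) ^ m - A * α * (α - 2 + N)) * ‖p.1 - y‖ ^ (α - 2) := by
  have hr : 0 < ‖p.1 - y‖ := norm_pos_iff.2 (sub_ne_zero.2 hp)
  set r := ‖p.1 - y‖ with hrdef
  have hα0 : 0 < α := by rw [hα]; apply div_pos <;> linarith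
  have hs : 0 < r ^ 2 := by positivity
  obtain ⟨G, hG, he, hd1, hd2⟩ := pow_germ A (α / 2) hs
  set τ : ℝ → ℝ := fun s => B * (s - t) ^ 2 with hτ
  have hτc : ContDiff ℝ 2 τ := by rw [hτ]; fun_prop
  have hτd : deriv τ p.2 = 2 * B * (p.2 - t) := by
    have h1 : HasDerivAt τ (B * ((2 : ℕ) * (p.2 - t) ^ (2 - 1) * 1)) p.2 :=
      ((((hasDerivAt_id p.2).sub_const t)).pow 2).const_mul B
    rw [h1.deriv]; push_cast; ring
  have hn := nsq_c2 y
  have hc := chain_c2 hn hG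
  have hnp : nsq y p = r ^ 2 := rfl
  refine ⟨fun q => 1 * G (nsq y q) + 1 * τ q.2, lc_c2 hc (timefun_c2 hτc) 1 1, ?_, ?_⟩
  · have ht : Tendsto (nsq y) (𝓝 p) (𝓝 (r ^ 2)) := hn.continuous.tendsto p
    filter_upwards [ht.eventually he] with q hq
    rw [hq, nsq, ← Real.rpow_natCast, ← Real.rpow_mul (norm_nonneg _)]
    simp only [hτ]
    congr 1
    · rw [one_mul]; congr 2; push_cast; ring
    · ring
  · have hq : ∀ e : ℝ, (r ^ 2) ^ e = r ^ (2 * e) := fun e => by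
      rw [← Real.rpow_natCast, ← Real.rpow_mul hr.le]; norm_num
    have e1 : r ^ (α - 1) = r ^ (α - 2) * r := by
      rw [← Real.rpow_add_one hr.ne']; ring_nf
    have e2 : (r ^ 2) ^ (α / 2 - 1) = r ^ (α - 2) := by rw [hq]; ring_nf
    have e3 : (r ^ 2) ^ (α / 2 - 1 - 1) * r ^ 2 = r ^ (α - 2) := by
      rw [← Real.rpow_add_one hs.ne', hq]; ring_nf
    have eG : ‖Gd (fun q : SpT N => 1 * G (nsq y q) + 1 * τ q.2) p‖ = A * α * r ^ (α - 1) := by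
      rw [Gd_lc hc (timefun_c2 hτc), chain_Gd hn hG, timefun_Gd hτc, hnp, hd1, smul_zero, add_zero, one_smul, norm_smul,
        nsq_Gd, ← hrdef, e2, e1, Real.norm_of_nonneg (by positivity)]
      ring
    have em : (r ^ (α - 1)) ^ m = r ^ (α - 2) := by
      rw [← Real.rpow_mul hr.le]; congr 1; rw [hα]
      have : m - 1 ≠ 0 := by linarith
      field_simp; ring
    rw [pOp, eG, Dt_lc hc (timefun_c2 hτc), Lpl_lc hc (timefun_c2 hτc), chain_Dt hn hG, timefun_Dt hτc, chain_Lpl hn hG,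
      timefun_Lpl hτc, nsq_Dt, nsq_Lpl, nsq_Gd, hnp, hd1, hd2, hτd, Real.mul_rpow (by positivity) (by positivity), em, e2, ← hrdef]
    linear_combination (-A * α * (α - 2)) * e3

lemma hb_arith {X m n α Q R : ℝ} (hm : 2 ≤ m) (hα : α < 1) (hn : 0 ≤ n) (hQ : 0 < Q)
    (hX : n + 2 + Q ≤ X) (hR : 1 ≤ R) : Q + 1 ≤ (X ^ m - X * (α - 2 + n)) * R := by
  have h1 : X ^ (2 : ℝ) ≤ X ^ m := Real.rpow_le_rpow_of_exponent_le (by linarith) hm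
  rw [Real.rpow_two] at h1
  have hX0 : 0 < X := by linarith
  have h2 : X * (Q + 1) ≤ X * (X - (α - 2 + n)) := mul_le_mul_of_nonneg_left (by linarith) hX0.le
  have h3 : 1 * (Q + 1) ≤ X * (Q + 1) := mul_le_mul_of_nonneg_right (by linarith) (by linarith)
  have h4 : Q + 1 ≤ X ^ m - X * (α - 2 + n) := by linarith
  exact h4.trans (le_mul_of_one_le_right (by linarith) hR)

set_option maxHeartbeats 400000 in
lemma space_mod {N : ℕ} {Ω : Set (Euc N)} (D : Dom Ω) {m : ℝ} (hm : 2 < m)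
    {F : Euc N → ℝ} {w : SpT N → ℝ} (hF : Continuous F) (hw : Continuous w)
    (hsub : SubP Ω m F w 0) (hsup : SupP Ω m F w 0)
    {S : ℝ} (hS : 0 < S) (hwS : ∀ p ∈ closure Ω ×ˢ Ici (0 : ℝ), |w p| ≤ S)
    {ε d : ℝ} (hε : 0 < ε) (hd : 0 < d) :
    ∃ r > 0, r ≤ d ∧ ∀ y, closedBall y d ⊆ Ω → ∀ t : ℝ, 1 ≤ t → ∀ x ∈ closedBall y r,
      w (x, t) ≤ w (y, t) + ε := by
  obtain ⟨η, hη, hmod⟩ := time_mod D (by linarith) hF hw hsub hsup (half_pos hε)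
  obtain ⟨L, hL, hFL⟩ := bdd_F D hF
  obtain ⟨α, hα⟩ : ∃ α : ℝ, α = (m - 2) / (m - 1) := ⟨_, rfl⟩
  have hα0 : 0 < α := by rw [hα]; apply div_pos <;> linarith
  have hα1 : α < 1 := by rw [hα, div_lt_one (by linarith)]; linarith
  obtain ⟨B, hB1, hB2⟩ : ∃ B : ℝ, 2 * S < B ∧ 2 * S < B * η ^ 2 := by
    refine ⟨2 * S + 1 + 2 * S / η ^ 2, by have : 0 < 2 * S / η ^ 2 := by positivity
                                          linarith, ?_⟩
    rw [add_mul, div_mul_cancel₀ _ (by positivity)]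
    have : 0 < (2 * S + 1) * η ^ 2 := by positivity
    linarith
  have hB0 : 0 < B := by linarith
  obtain ⟨r₀, hr₀, hr₀d, hr₀1⟩ : ∃ r₀ : ℝ, 0 < r₀ ∧ r₀ ≤ d ∧ r₀ ≤ 1 :=
    ⟨min d 1, by positivity, min_le_left _ _, min_le_right _ _⟩
  have hrα : 0 < r₀ ^ α := by positivity
  set X : ℝ := N + 2 + 2 * B + L + α * (2 * S) / r₀ ^ α with hX
  have hX1 : N + 2 + 2 * B + L ≤ X := by
    have : 0 < α * (2 * S) / r₀ ^ α := by positivity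
    linarith
  have hN : (0 : ℝ) ≤ N := Nat.cast_nonneg N
  have hX0 : 0 < X := by linarith
  set A := X / α with hA
  have hA0 : 0 < A := by positivity
  have hAα : A * α = X := by rw [hA]; field_simp
  have hAr : 2 * S < A * r₀ ^ α := by
    rw [hA, hX]
    have : (N + 2 + 2 * B + L + α * (2 * S) / r₀ ^ α) / α * r₀ ^ α = (N + 2 + 2 * B + L) / α * r₀ ^ α + 2 * S := by
      field_simp
    rw [this]
    have : 0 < (N + 2 + 2 * B + L) / α * r₀ ^ α := by positivity
    linarith
  obtain ⟨r, hr, hrr, hrA⟩ : ∃ r : ℝ, 0 < r ∧ r ≤ r₀ ∧ A * r ^ α ≤ ε / 2 := by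
    refine ⟨min r₀ ((ε / 2 / A) ^ α⁻¹), by positivity, min_le_left _ _, ?_⟩
    have h1 : (min r₀ ((ε / 2 / A) ^ α⁻¹)) ^ α ≤ ((ε / 2 / A) ^ α⁻¹) ^ α :=
      Real.rpow_le_rpow (by positivity) (min_le_right _ _) hα0.le
    rw [Real.rpow_inv_rpow (by positivity) hα0.ne', le_div_iff₀ hA0] at h1
    linarith
  refine ⟨r, hr, hrr.trans hr₀d, fun y hy t ht x hx => ?_⟩
  have hyc : y ∈ closure Ω := subset_closure (hy (mem_closedBall_self hd.le))
  have hbc : closedBall y r₀ ⊆ Ω := (closedBall_subset_closedBall hr₀d).trans hy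
  set Φ : SpT N → ℝ := fun q => w q - (A * ‖q.1 - y‖ ^ α + B * (q.2 - t) ^ 2) with hΦ
  have hΦc : Continuous Φ := by
    have : Continuous (fun q : SpT N => ‖q.1 - y‖ ^ α) :=
      (by fun_prop : Continuous (fun q : SpT N => ‖q.1 - y‖)).rpow_const (fun _ => Or.inr hα0.le)
    fun_prop
  have hyt : ((y, t) : SpT N) ∈ closedBall y r₀ ×ˢ Icc (t - 1) (t + 1) :=
    ⟨mem_closedBall_self hr₀.le, by constructor <;> simp⟩
  obtain ⟨p, hp, hpm⟩ := ((isCompact_closedBall y r₀).prod (isCompact_Icc (a := t - 1) (b := t + 1))).exists_isMaxOn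
    ⟨(y, t), hyt⟩ hΦc.continuousOn
  have hmem : ∀ q ∈ closedBall y r₀ ×ˢ Icc (t - 1) (t + 1), q ∈ closure Ω ×ˢ Ici (0 : ℝ) := fun q hq =>
    ⟨subset_closure (hbc hq.1), by have := hq.2.1; rw [mem_Ici]; linarith⟩
  have h1 : w (y, t) ≤ Φ p := by
    have : Φ (y, t) = w (y, t) := by simp [hΦ, Real.zero_rpow hα0.ne']
    rw [← this]; exact hpm hyt
  have h2 : A * ‖p.1 - y‖ ^ α + B * (p.2 - t) ^ 2 ≤ 2 * S := by
    have a1 := (abs_le.1 (hwS p (hmem p hp))).2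
    have a2 := (abs_le.1 (hwS _ (hmem _ hyt))).1
    simp only [hΦ] at h1; linarith
  have h3 : 0 ≤ A * ‖p.1 - y‖ ^ α := by positivity
  have h4 : 0 ≤ B * (p.2 - t) ^ 2 := by positivity
  have h5 : |p.2 - t| ≤ η := by
    apply abs_le_of_sq_le_sq _ hη.le
    by_contra hc
    push Not at hc
    have := mul_lt_mul_of_pos_left hc hB0
    linarith
  have h6 : |p.2 - t| < 1 := by
    apply abs_lt_of_sq_lt_sq _ one_pos.le
    by_contra hc
    push Not at hc
    have := mul_le_mul_of_nonneg_left hc hB0.le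
    linarith
  have h7 : ‖p.1 - y‖ < r₀ := by
    by_contra hc
    push Not at hc
    have := mul_le_mul_of_nonneg_left (Real.rpow_le_rpow hr₀.le hc hα0.le) hA0.le
    linarith
  have hpy : p.1 = y := by
    by_contra hne
    obtain ⟨φ, hφ, hφe, hφp⟩ := holder_bar (m := m) (B := B) (t := t) hm hα hA0 hne
    have hpt : 0 < p.2 := by have := (abs_lt.1 h6).1; linarith
    have hv := hsub p ⟨hbc hp.1, hpt⟩ φ hφ ?_
    · rw [hφp, hAα] at hv
      have hr1 : 1 ≤ ‖p.1 - y‖ ^ (α - 2) :=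
        Real.one_le_rpow_of_pos_of_le_one_of_nonpos (norm_pos_iff.2 (sub_ne_zero.2 hne)) (by linarith) (by linarith)
      have hX4 := hb_arith hm.le hα1 hN (by positivity : 0 < 2 * B + L) (by linarith : N + 2 + (2 * B + L) ≤ X) hr1
      have hX5 := (abs_le.1 (hFL p.1 (hmem p hp).1)).2
      have hX6 : 2 * B * (-1) ≤ 2 * B * (p.2 - t) :=
        mul_le_mul_of_nonneg_left (abs_lt.1 h6).1.le (by positivity)
      linarith
    · have hn : closedBall y r₀ ×ˢ Icc (t - 1) (t + 1) ∈ 𝓝 p := by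
        rw [abs_lt] at h6
        refine prod_mem_nhds (closedBall_mem_nhds_of_mem ?_) (Icc_mem_nhds (by linarith) (by linarith))
        rw [mem_ball, dist_eq_norm]; exact h7
      filter_upwards [hn, hφe] with q hq1 hq2
      have := hpm hq1
      simp only [mem_ofPred_eq, hΦ] at this
      rw [hq2, hφe.self_of_nhds]; exact this
  have hxr : ‖x - y‖ ≤ r := by rw [← dist_eq_norm]; exact hx
  have h8 : Φ (x, t) ≤ Φ p := hpm ⟨closedBall_subset_closedBall hrr hx, by constructor <;> simp⟩
  have h9 : A * ‖x - y‖ ^ α ≤ ε / 2 :=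
    (mul_le_mul_of_nonneg_left (Real.rpow_le_rpow (norm_nonneg _) hxr hα0.le) hA0.le).trans hrA
  have h10 := (abs_le.1 (hmod y hyc p.2 t (hmem p hp).2 (by linarith) h5)).2
  have h11 : w p = w (y, p.2) := by rw [← hpy]
  simp only [hΦ] at h8
  rw [h11] at h8
  simp at h8
  linarith


lemma pOp_add_const {N : ℕ} (φ : SpT N → ℝ) (m C : ℝ) (p : SpT N) :
    pOp m (fun q => φ q + C) p = pOp m φ p := by
  have e : fderiv ℝ (fun q => φ q + C) = fderiv ℝ φ := by ext1 q; exact fderiv_add_const C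
  simp only [pOp, Dt, Gd, Lpl, e]

lemma strip_bar {N : ℕ} {Ω : Set (Euc N)} (D : Dom Ω) {m : ℝ} (hm : 1 < m) {ρ : Euc N → ℝ}
    (hρ : ContDiff ℝ 2 ρ) (hρ1 : Ω = {x | ρ x < 0}) (hρ2 : frontier Ω = {x | ρ x = 0})
    (hρ3 : ∀ x ∈ frontier Ω, gradient ρ x ≠ 0) {LF : ℝ} :
    ∃ L ≥ 0, ∃ s > 0, ContDiff ℝ 2 (fun q : SpT N => L * ρ q.1 ^ 2 + q.2) ∧
      ∀ p : SpT N, p.1 ∈ closure Ω → -s < ρ p.1 →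
        pOp m (fun q : SpT N => L * ρ q.1 ^ 2 + q.2) p < -LF := by
  have hθ : ContDiff ℝ 2 (fun q : SpT N => ρ q.1) := hρ.comp contDiff_fst
  have hg : ContDiff ℝ 2 (fun s : ℝ => s ^ 2) := by fun_prop
  have hχ := chain_c2 hθ hg
  have hτ : ContDiff ℝ 2 (fun s : ℝ => s) := contDiff_id
  have hG : ∀ x t, Gd (fun q : SpT N => ρ q.1) (x, t) = fderiv ℝ ρ x := fun x t =>
    ((sec_hasFDeriv hθ x t).fderiv).symm
  have hDt : ∀ x t, Dt (fun q : SpT N => ρ q.1) (x, t) = 0 := fun x t => by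
    have := (sec_hasDeriv hθ x t).deriv
    simpa using this.symm
  have hgd : deriv (fun s : ℝ => s ^ 2) = fun s => 2 * s := by ext s; simp
  have hgd2 : deriv (fun s : ℝ => 2 * s) = fun s => 2 := by
    ext s; have := ((hasDerivAt_id s).const_mul (2:ℝ)).deriv; simpa using this
  -- lower bound of gradient
  obtain ⟨κ, hκ, hκb⟩ : ∃ κ > 0, ∀ x ∈ frontier Ω, κ ≤ ‖fderiv ℝ ρ x‖ ^ 2 := by
    have hfc : IsCompact (frontier Ω) := D.cpt.of_isClosed_subset isClosed_frontier frontier_subset_closure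
    have hcont : Continuous (fun x => ‖fderiv ℝ ρ x‖ ^ 2) := by
      have := (hρ.fderiv_right (m := 1) (by norm_num)).continuous
      fun_prop
    rcases (frontier Ω).eq_empty_or_nonempty with h | h
    · exact ⟨1, one_pos, by rw [h]; simp⟩
    · obtain ⟨x, hx, hmin⟩ := hfc.exists_isMinOn h hcont.continuousOn
      refine ⟨‖fderiv ℝ ρ x‖ ^ 2, ?_, fun y hy => hmin hy⟩
      have := hρ3 x hx
      have h2 : 0 < ‖fderiv ℝ ρ x‖ := by rw [← norm_grad]; exact norm_pos_iff.2 this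
      positivity
  set L := (|LF| + 2) / (2 * κ) with hL
  have hL0 : 0 ≤ L := by positivity
  have hLκ : 2 * L * κ = |LF| + 2 := by rw [hL]; field_simp
  have hc2 : ContDiff ℝ 2 (fun q : SpT N => L * ρ q.1 ^ 2 + q.2) := by
    have := lc_c2 hχ (timefun_c2 (N := N) hτ) L 1
    simpa using this
  have hfr : ∀ x ∈ frontier Ω, ∀ t, pOp m (fun q : SpT N => L * ρ q.1 ^ 2 + q.2) (x, t) < -LF := by
    intro x hx t
    have hx0 : ρ x = 0 := by rw [hρ2] at hx; exact hx
    have e : (fun q : SpT N => L * ρ q.1 ^ 2 + q.2) = fun q => L * (fun s : ℝ => s ^ 2) (ρ q.1) + 1 * (fun s : ℝ => s) q.2 := by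
      ext q; simp
    rw [e, pOp, Dt_lc hχ (timefun_c2 hτ), Lpl_lc hχ (timefun_c2 hτ), Gd_lc hχ (timefun_c2 hτ), chain_Dt hθ hg,
      chain_Gd hθ hg, chain_Lpl hθ hg, timefun_Dt hτ, timefun_Gd hτ, timefun_Lpl hτ, hgd, hgd2, hG, hDt]
    simp only [hx0]
    simp [Real.zero_rpow (by linarith : m ≠ 0)]
    have h1 := hκb x hx
    have h2 := mul_le_mul_of_nonneg_left h1 hL0
    have h3 := le_abs_self LF
    nlinarith
  have htr : ∀ x t, pOp m (fun q : SpT N => L * ρ q.1 ^ 2 + q.2) (x, t) =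
      pOp m (fun q : SpT N => L * ρ q.1 ^ 2 + q.2) (x, 0) := by
    intro x t
    have h1 := pOp_trans hc2 m (0, t) (x, 0)
    have h2 : (fun z : SpT N => L * ρ ((0, t) + z).1 ^ 2 + ((0, t) + z).2) =
        fun z => (fun q : SpT N => L * ρ q.1 ^ 2 + q.2) z + t := by
      ext z; simp; ring
    rw [h2, pOp_add_const] at h1
    rw [h1]; simp
  have hcont : Continuous (fun x => pOp m (fun q : SpT N => L * ρ q.1 ^ 2 + q.2) (x, 0)) :=
    (pOp_cont hc2 (by linarith)).comp (by fun_prop)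
  set Z : Set (Euc N) := closure Ω ∩ {x | -LF ≤ pOp m (fun q : SpT N => L * ρ q.1 ^ 2 + q.2) (x, 0)} with hZ
  have hZc : IsCompact Z := D.cpt.inter_right (isClosed_le continuous_const hcont)
  have hZρ : ∀ x ∈ Z, ρ x < 0 := by
    intro x hx
    have h1 := closure_rho hρ.continuous hρ1 hx.1
    refine lt_of_le_of_ne h1 fun h0 => ?_
    have h2 : x ∈ frontier Ω := by rw [hρ2]; exact h0
    exact absurd hx.2 (not_le.2 (hfr x h2 0))
  obtain ⟨s, hs, hZs⟩ : ∃ s > 0, ∀ x ∈ Z, ρ x ≤ -s := by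
    rcases Z.eq_empty_or_nonempty with h | h
    · exact ⟨1, one_pos, by rw [h]; simp⟩
    · obtain ⟨x, hx, hmax⟩ := hZc.exists_isMaxOn h hρ.continuous.continuousOn
      exact ⟨-ρ x, by have := hZρ x hx; linarith, fun y hy => by rw [neg_neg]; exact hmax hy⟩
  refine ⟨L, hL0, s, hs, hc2, fun p hp hps => ?_⟩
  by_contra hc
  push Not at hc
  have : pOp m (fun q : SpT N => L * ρ q.1 ^ 2 + q.2) p = pOp m (fun q : SpT N => L * ρ q.1 ^ 2 + q.2) (p.1, 0) := htr p.1 p.2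
  rw [this] at hc
  have := hZs p.1 ⟨hp, hc⟩
  linarith

lemma strip {N : ℕ} {Ω : Set (Euc N)} (D : Dom Ω) {m : ℝ} (hm : 1 < m) {ρ : Euc N → ℝ}
    (hρ : ContDiff ℝ 2 ρ) (hρ1 : Ω = {x | ρ x < 0}) (hρ2 : frontier Ω = {x | ρ x = 0})
    (hρ3 : ∀ x ∈ frontier Ω, gradient ρ x ≠ 0) {F : Euc N → ℝ} (hF : Continuous F) :
    ∃ s > 0, ∃ C₀ ≥ 0, ∀ U v : SpT N → ℝ, Continuous U → Continuous v → ∀ B t₀ T : ℝ, 0 ≤ T →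
      SubP Ω m F U t₀ → SupP Ω m F v t₀ → (∀ p ∈ closure Ω ×ˢ Icc t₀ (t₀ + T), |U p| ≤ B) →
      ∀ M₁ M₂ : ℝ, (∀ x ∈ closure Ω, U (x, t₀) - v (x, t₀) ≤ M₁) →
      (∀ x ∈ closure Ω, ρ x ≤ -s → ∀ t ∈ Icc t₀ (t₀ + T), U (x, t) - v (x, t) ≤ M₂) →
      ∀ ν : ℝ, 0 < ν → ν ≤ 1 → ∀ x ∈ closure Ω,
        U (x, t₀ + T) - v (x, t₀ + T) ≤ max (M₁ + ν * (C₀ + 2 * B - T)) (M₂ + ν * (C₀ + 2 * B)) := by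
  obtain ⟨LF, hLF, hFL⟩ := bdd_F D hF
  obtain ⟨L, hL, s, hs, hψ, hbar⟩ := strip_bar D hm hρ hρ1 hρ2 hρ3 (LF := LF)
  obtain ⟨C₀, hC₀, hC⟩ := bdd_F D (F := fun x => L * ρ x ^ 2) (by have := hρ.continuous; fun_prop)
  refine ⟨s, hs, C₀, hC₀.le, fun U v hU hv B t₀ T hT hsub hsup hB M₁ M₂ h1 h2 ν hν0 hν1 x₁ hx₁ => ?_⟩
  set ψ : SpT N → ℝ := fun q : SpT N => L * ρ q.1 ^ 2 + q.2 with hψd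
  set W : SpT N → ℝ := fun q => (1 - ν) * U q + (1 - (1 - ν)) * ψ q - v q with hW
  have hWc : Continuous W := by have := hψ.continuous; fun_prop
  have hmem : ((x₁, t₀ + T) : SpT N) ∈ closure Ω ×ˢ Icc t₀ (t₀ + T) := ⟨hx₁, right_mem_Icc.2 (by linarith)⟩
  obtain ⟨p₀, hp₀, hpm⟩ := (D.cpt.prod (isCompact_Icc (a := t₀) (b := t₀ + T))).exists_isMaxOn
    ⟨_, hmem⟩ hWc.continuousOn
  have k1 : U (x₁, t₀ + T) - v (x₁, t₀ + T) + ν * (t₀ + T - B) ≤ W (x₁, t₀ + T) := by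
    have e1 := (abs_le.1 (hB _ hmem)).2
    have e2 : 0 ≤ L * ρ x₁ ^ 2 := by positivity
    have e3 := mul_le_mul_of_nonneg_left (by linarith : t₀ + T - B ≤ L * ρ x₁ ^ 2 + (t₀ + T) - U (x₁, t₀ + T)) hν0.le
    simp only [hW, hψd]
    linarith
  have k2 : W p₀ ≤ U p₀ - v p₀ + ν * (C₀ + p₀.2 + B) := by
    have e1 := (abs_le.1 (hB _ hp₀)).1
    have e2 := (abs_le.1 (hC p₀.1 hp₀.1)).2
    have e3 := mul_le_mul_of_nonneg_left (by linarith : L * ρ p₀.1 ^ 2 + p₀.2 - U p₀ ≤ C₀ + p₀.2 + B) hν0.le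
    simp only [hW, hψd]
    linarith
  have k3 : W (x₁, t₀ + T) ≤ W p₀ := hpm hmem
  by_cases ht : p₀.2 = t₀
  · refine le_max_of_le_left ?_
    have e1 := h1 p₀.1 hp₀.1
    rw [← ht, Prod.mk.eta] at e1
    rw [ht] at k2
    linarith
  by_cases hr : ρ p₀.1 ≤ -s
  · refine le_max_of_le_right ?_
    have e1 := h2 p₀.1 hp₀.1 hr p₀.2 hp₀.2
    rw [Prod.mk.eta] at e1
    have e3 := mul_le_mul_of_nonneg_left hp₀.2.2 hν0.le
    linarith
  · exfalso
    push Not at hr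
    have hap : t₀ < p₀.2 := lt_of_le_of_ne hp₀.2.1 (Ne.symm ht)
    have key := maxCyl D hm (μ := 1 - ν) (by linarith) (by linarith) hF (hF.comp continuous_fst) hU hv hψ
      hp₀.1 hap hsub ?_ ?_
    · have e1 := (abs_le.1 (hFL p₀.1 hp₀.1)).1
      have e2 := mul_lt_mul_of_pos_left (hbar p₀ hp₀.1 hr) hν0
      have e3 := mul_le_mul_of_nonneg_left e1 hν0.le
      simp only [Function.comp] at key
      linarith
    · filter_upwards [ev_past hap] with q h3
      exact hsup q ⟨h3.1, h3.2.1⟩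
    · filter_upwards [ev_past hap] with q h3
      exact hpm ⟨h3.1, h3.2.1.le, h3.2.2.trans hp₀.2.2⟩


lemma clm_le_of_onesided {N : ℕ} {f : Euc N → ℝ} {l : Euc N →L[ℝ] ℝ} {x : Euc N} (hf : HasFDerivAt f l x)
    {K : ℝ} (hK : 0 ≤ K) (h : ∀ᶠ z in 𝓝 x, f z - f x ≤ K * ‖z - x‖) : ‖l‖ ≤ K := by
  have key : ∀ v : Euc N, l v ≤ K * ‖v‖ := by
    intro v
    have hl : HasDerivAt (fun s : ℝ => x + s • v) v 0 := by
      simpa using ((hasDerivAt_id (0:ℝ)).smul_const v).const_add x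
    have h1 : HasDerivAt (fun s : ℝ => f (x + s • v)) (l v) 0 := by
      have := HasFDerivAt.comp_hasDerivAt (0 : ℝ) (by simpa using hf) hl
      simpa [Function.comp_def] using this
    have h2 := h1.hasDerivWithinAt (s := Ioi 0)
    rw [hasDerivWithinAt_iff_tendsto_slope' (by simp)] at h2
    refine le_of_tendsto h2 ?_
    have hc : Tendsto (fun s : ℝ => x + s • v) (𝓝[>] 0) (𝓝 x) := by
      have := hl.continuousAt.tendsto
      simp at this
      exact this.mono_left nhdsWithin_le_nhds
    filter_upwards [hc.eventually h, self_mem_nhdsWithin] with s hs hs0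
    simp only [mem_Ioi] at hs0
    rw [slope_def_field, sub_zero, div_le_iff₀ hs0]
    simp [norm_smul, abs_of_pos hs0] at hs
    simp; linarith
  refine ContinuousLinearMap.opNorm_le_bound _ hK fun v => ?_
  rw [Real.norm_eq_abs, abs_le]
  constructor
  · have := key (-v); simp at this; linarith
  · exact key v

lemma norm_pow_sub {N : ℕ} {m K : ℝ} (hm : 1 < m) {P Q : Euc N →L[ℝ] ℝ} (hP : ‖P‖ ≤ K) :
    ‖P‖ ^ m - m * K ^ (m - 1) * ‖Q‖ ≤ ‖P - Q‖ ^ m := by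
  have hK : 0 ≤ K := (norm_nonneg P).trans hP
  rcases (norm_nonneg P).eq_or_lt with h | h
  · rw [← h, Real.zero_rpow (by linarith)]
    have : 0 ≤ m * K ^ (m - 1) * ‖Q‖ := by positivity
    have : 0 ≤ ‖P - Q‖ ^ m := by positivity
    linarith
  · have h1 := tangent1 hm h (norm_nonneg (P - Q))
    have h2 : ‖P‖ - ‖Q‖ ≤ ‖P - Q‖ := norm_sub_norm_le P Q
    have h3 : m * ‖P‖ ^ (m - 1) * (-‖Q‖) ≤ m * ‖P‖ ^ (m - 1) * (‖P - Q‖ - ‖P‖) :=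
      mul_le_mul_of_nonneg_left (by linarith) (by positivity)
    have h4 : m * ‖P‖ ^ (m - 1) * ‖Q‖ ≤ m * K ^ (m - 1) * ‖Q‖ := by
      have := Real.rpow_le_rpow h.le hP (by linarith : 0 ≤ m - 1)
      gcongr
    linarith

lemma super_sub {N : ℕ} {Ω : Set (Euc N)} {m K ε F : ℝ} (hm : 1 < m) (hε : 0 ≤ ε) {uI : Euc N → ℝ} {β : SpT N → ℝ}
    (hΩ : IsOpen Ω) (hβ : ContDiff ℝ 2 β) {p : SpT N} (hp : p.1 ∈ Ω) (hK : 0 ≤ K)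
    (hlip : ∀ᶠ z in 𝓝 p.1, |uI z - uI p.1| ≤ K * ‖z - p.1‖)
    (hsup : VSuperAt Ω m F (fun q => uI q.1) p) :
    VSuperAt Ω m (F + ε * (-Dt β p + Lpl β p - m * K ^ (m - 1) * ‖Gd β p‖)) (fun q => uI q.1 - ε * β q) p := by
  intro φ hφ hmin
  have hc := lc_c2 hφ hβ 1 ε
  have hmin' : IsLocalMinOn (fun q : SpT N => uI q.1 - (1 * φ q + ε * β q)) (closure Ω ×ˢ Iic p.2) p := by
    filter_upwards [hmin] with q hq
    linarith
  have h1 := hsup _ hc hmin'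
  have hG : ‖Gd (fun q => 1 * φ q + ε * β q) p‖ ≤ K := by
    refine clm_le_of_onesided (sec_hasFDeriv hc p.1 p.2) hK ?_
    have ht : Tendsto (fun z : Euc N => ((z, p.2) : SpT N)) (𝓝 p.1) (𝓝[closure Ω ×ˢ Iic p.2] p) := by
      refine tendsto_nhdsWithin_iff.2 ⟨?_, ?_⟩
      · have : Continuous (fun z : Euc N => ((z, p.2) : SpT N)) := by fun_prop
        exact this.tendsto p.1
      · filter_upwards [hΩ.mem_nhds hp] with z hz
        exact ⟨subset_closure hz, mem_Iic.2 le_rfl⟩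
    filter_upwards [ht.eventually hmin', hlip] with z h2 h3
    have := (abs_le.1 h3).2
    simp only [Prod.mk.eta]
    linarith
  have h2 := norm_pow_sub hm (Q := ε • Gd β p) hG
  have e : Gd (fun q => 1 * φ q + ε * β q) p - ε • Gd β p = Gd φ p := by
    rw [Gd_lc hφ hβ]; simp
  rw [e, norm_smul, Real.norm_of_nonneg hε] at h2
  rw [pOp, Dt_lc hφ hβ, Lpl_lc hφ hβ] at h1
  rw [pOp]
  linarith

/-- spreading barrier -/
noncomputable def bet {N : ℕ} (y : Euc N) (Λ τ r k : ℝ) (p : SpT N) : ℝ :=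
  Real.exp (-Λ * (p.2 - τ)) * (r ^ 2 + k * (p.2 - τ) - ‖p.1 - y‖ ^ 2) ^ 2

lemma bet_prop {N : ℕ} (y : Euc N) (Λ τ r k : ℝ) : ContDiff ℝ 2 (bet y Λ τ r k) ∧
    ∀ C E ρ₁ : ℝ, 0 < r → 0 ≤ k → 0 ≤ C → E = 8 + 2 * k + 4 * N + 4 * C * ρ₁ → Λ = E ^ 2 / (32 * r ^ 2) →
      ∀ p : SpT N, τ ≤ p.2 → ‖p.1 - y‖ ≤ ρ₁ → ‖p.1 - y‖ ^ 2 ≤ r ^ 2 + k * (p.2 - τ) →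
      0 ≤ -Dt (bet y Λ τ r k) p + Lpl (bet y Λ τ r k) p - C * ‖Gd (bet y Λ τ r k) p‖ := by
  set σ : ℝ → ℝ := fun t => Real.exp (-Λ * (t - τ)) with hσ
  have hσc : ContDiff ℝ 2 σ := by rw [hσ]; fun_prop
  have hσd : ∀ t, deriv σ t = -Λ * σ t := by
    intro t
    have h1 : HasDerivAt (fun t => -Λ * (t - τ)) (-Λ * 1) t := ((hasDerivAt_id t).sub_const τ).const_mul (-Λ)
    have h2 : HasDerivAt σ (Real.exp (-Λ * (t - τ)) * (-Λ * 1)) t := h1.exp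
    rw [h2.deriv]; simp only [hσ]; ring
  set R : ℝ → ℝ := fun t => r ^ 2 + k * (t - τ) with hR
  have hRc : ContDiff ℝ 2 R := by rw [hR]; fun_prop
  have hRd : ∀ t, deriv R t = k := by
    intro t
    have h1 : HasDerivAt R (k * 1) t := (((hasDerivAt_id t).sub_const τ).const_mul k).const_add (r ^ 2)
    rw [h1.deriv, mul_one]
  have hn := nsq_c2 y
  have hRt := timefun_c2 (N := N) hRc
  have hθ := lc_c2 hRt hn 1 (-1)
  set θ : SpT N → ℝ := fun q => 1 * R q.2 + (-1) * nsq y q with hθd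
  have hg : ContDiff ℝ 2 (fun s : ℝ => s ^ 2) := by fun_prop
  have hgd : deriv (fun s : ℝ => s ^ 2) = fun s => 2 * s := by ext s; simp
  have hgd2 : deriv (fun s : ℝ => 2 * s) = fun s => 2 := by
    ext s; have := ((hasDerivAt_id s).const_mul (2:ℝ)).deriv; simpa using this
  have hχ := chain_c2 hθ hg
  have e : bet y Λ τ r k = fun q => σ q.2 * (fun s : ℝ => s ^ 2) (θ q) := by
    ext q; simp only [bet, hσ, hθd, hR, nsq]; ring_nf
  rw [e]
  refine ⟨tmul_c2 hχ hσc, fun C E ρ₁ hr hk hC hE hΛ p hpτ hpρ hpR => ?_⟩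
  have hGθ : Gd θ p = (-1 : ℝ) • Gd (nsq y) p := by
    rw [hθd, Gd_lc hRt hn, timefun_Gd hRc]; simp
  have hGn : ‖Gd θ p‖ = 2 * ‖p.1 - y‖ := by rw [hGθ, norm_smul, nsq_Gd]; simp
  have hDθ : Dt θ p = k := by rw [hθd, Dt_lc hRt hn, timefun_Dt hRc, nsq_Dt, hRd]; ring
  have hLθ : Lpl θ p = -(2 * N) := by rw [hθd, Lpl_lc hRt hn, timefun_Lpl hRc, nsq_Lpl]; ring
  rw [tmul_Dt hχ hσc, tmul_Lpl hχ hσc, tmul_Gd hχ hσc, chain_Dt hθ hg, chain_Lpl hθ hg, chain_Gd hθ hg, hgd, hgd2,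
    hDθ, hLθ, hGn, hσd, norm_smul, norm_smul, hGn]
  have hσ0 : 0 < σ p.2 := by simp only [hσ]; positivity
  have hq0 : 0 ≤ θ p := by simp only [hθd, hR, nsq]; linarith
  have hqR : r ^ 2 ≤ θ p + ‖p.1 - y‖ ^ 2 := by
    have : 0 ≤ k * (p.2 - τ) := mul_nonneg hk (by linarith)
    simp only [hθd, hR, nsq]; linarith
  rw [Real.norm_of_nonneg hσ0.le, Real.norm_of_nonneg (by positivity)]
  set q := θ p
  set X := ‖p.1 - y‖
  have hX0 : 0 ≤ X := norm_nonneg _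
  have h1 : 0 ≤ Λ * q ^ 2 - E * q + 8 * r ^ 2 := by
    have : Λ * q ^ 2 - E * q + 8 * r ^ 2 = (E * q - 16 * r ^ 2) ^ 2 / (32 * r ^ 2) := by
      rw [hΛ]; field_simp; ring
    rw [this]; positivity
  have h2 : C * q * X ≤ C * q * ρ₁ := mul_le_mul_of_nonneg_left hpρ (by positivity)
  have h3 : 0 ≤ Λ * q ^ 2 - 2 * k * q + 8 * X ^ 2 - 4 * N * q - 4 * (C * q * X) := by
    rw [hE] at h1; linarith
  have h4 := mul_nonneg hσ0.le h3
  linarith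


set_option maxHeartbeats 400000 in
lemma propag {N : ℕ} {Ω : Set (Euc N)} (D : Dom Ω) {m : ℝ} (hm : 1 < m)
    {F : Euc N → ℝ} {w : SpT N → ℝ} (hF : Continuous F) (hw : Continuous w)
    {uI : Euc N → ℝ} (huI : Continuous uI) {y : Euc N} {ρ₁ K : ℝ} (hK : 0 ≤ K) (hb : closedBall y ρ₁ ⊆ Ω)
    (hlip : ∀ x ∈ closedBall y ρ₁, ∀ᶠ z in 𝓝 x, |uI z - uI x| ≤ K * ‖z - x‖)
    {r k : ℝ} (hr : 0 < r) (hk : 0 ≤ k) (hρ₁ : 0 ≤ ρ₁) : ∃ Λ : ℝ, ∀ τ H M δ : ℝ, 0 ≤ H → r ^ 2 + k * H ≤ ρ₁ ^ 2 → 0 ≤ δ →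
      SubP Ω m F w τ → SupP Ω m F (fun q => uI q.1) τ →
      (∀ x ∈ closedBall y ρ₁, ∀ t ∈ Icc τ (τ + H), w (x, t) - uI x ≤ M) →
      (∀ x ∈ closedBall y r, w (x, τ) - uI x ≤ M - δ) →
      ∀ x : Euc N, ∀ t ∈ Icc τ (τ + H), ‖x - y‖ ^ 2 ≤ r ^ 2 + k * (t - τ) →
        w (x, t) - uI x ≤ M - δ / r ^ 4 * bet y Λ τ r k (x, t) := by
  set C := m * K ^ (m - 1) with hC
  have hC0 : 0 ≤ C := by positivity
  set E := 8 + 2 * k + 4 * N + 4 * C * ρ₁ with hE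
  refine ⟨E ^ 2 / (32 * r ^ 2), fun τ H M δ hH hRH hδ hsub hsup hM hδM x₁ t₁ ht₁ hx₁ => ?_⟩
  set Λ := E ^ 2 / (32 * r ^ 2) with hΛ
  obtain ⟨hβc, hβ⟩ := bet_prop y Λ τ r k
  set β := bet y Λ τ r k with hβd
  set ε := δ / r ^ 4 with hε
  have hε0 : 0 ≤ ε := by positivity
  by_contra hc
  push Not at hc
  obtain ⟨B, hB, hUB⟩ := bdd_cyl D hw τ (τ + H)
  obtain ⟨L, hL, hFL⟩ := bdd_F D hF
  set σ : ℝ → ℝ := fun t => -(L + 1) * (t - τ) - B with hσ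
  have hσc : ContDiff ℝ 2 σ := by rw [hσ]; fun_prop
  have hσd : ∀ t, deriv σ t = -(L + 1) := by
    intro t
    have h1 : HasDerivAt σ (-(L + 1) * 1) t :=
      (((hasDerivAt_id t).sub_const τ).const_mul (-(L + 1))).sub_const B
    rw [h1.deriv, mul_one]
  set ψ : SpT N → ℝ := fun q => σ q.2 with hψ
  have hψc : ContDiff ℝ 2 ψ := timefun_c2 hσc
  set d := w (x₁, t₁) - uI x₁ - (M - ε * β (x₁, t₁)) with hd
  have hd0 : 0 < d := by rw [hd]; linarith
  set E' := 2 * B + (L + 1) * (t₁ - τ) with hE'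
  have hE0 : 0 < E' := by
    have : 0 ≤ (L + 1) * (t₁ - τ) := by apply mul_nonneg <;> linarith [ht₁.1]
    linarith
  obtain ⟨ν, hν0, hν1, hνE⟩ : ∃ ν : ℝ, 0 < ν ∧ ν ≤ 1 ∧ ν * E' ≤ d / 2 := by
    refine ⟨min 1 (d / (2 * E')), by positivity, min_le_left _ _, ?_⟩
    calc _ ≤ d / (2 * E') * E' := by gcongr; exact min_le_right _ _
      _ = d / 2 := by field_simp
  set v : SpT N → ℝ := fun q => uI q.1 - ε * β q with hv
  have hβcont : Continuous β := hβc.continuous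
  have hvc : Continuous v := by rw [hv]; fun_prop
  set W : SpT N → ℝ := fun q => (1 - ν) * w q + (1 - (1 - ν)) * ψ q - v q with hW
  have hWc : Continuous W := by have := hψc.continuous; fun_prop
  -- the domain
  have hinb : ∀ p : SpT N, p.2 ≤ τ + H → ‖p.1 - y‖ ^ 2 ≤ r ^ 2 + k * (p.2 - τ) → p.1 ∈ closedBall y ρ₁ := by
    intro p h1 h2
    rw [mem_closedBall, dist_eq_norm]
    have h3 : k * (p.2 - τ) ≤ k * H := mul_le_mul_of_nonneg_left (by linarith) hk
    exact abs_le_of_sq_le_sq' (by linarith) hρ₁ |>.2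
  set Sx : Set (SpT N) := (closedBall y ρ₁ ×ˢ Icc τ (τ + H)) ∩ {p | ‖p.1 - y‖ ^ 2 ≤ r ^ 2 + k * (p.2 - τ)} with hSx
  have hSc : IsCompact Sx := ((isCompact_closedBall y ρ₁).prod isCompact_Icc).inter_right
    (isClosed_le (by fun_prop) (by fun_prop))
  have hmem1 : ((x₁, t₁) : SpT N) ∈ Sx := ⟨⟨hinb (x₁, t₁) ht₁.2 hx₁, ht₁⟩, hx₁⟩
  have hScl : ∀ p ∈ Sx, p ∈ closure Ω ×ˢ Icc τ (τ + H) := fun p hp => ⟨subset_closure (hb hp.1.1), hp.1.2⟩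
  obtain ⟨p₀, hp₀, hpm⟩ := hSc.exists_isMaxOn ⟨_, hmem1⟩ hWc.continuousOn
  have hWle : ∀ p ∈ Sx, W p ≤ w p - v p := by
    intro p hp
    have h0 : 0 ≤ (L + 1) * (p.2 - τ) := by apply mul_nonneg <;> linarith [hp.1.2.1]
    have h1 : ψ p ≤ -B := by simp only [hψ, hσ]; linarith
    have h2 := (abs_le.1 (hUB p (hScl p hp))).1
    have h3 := mul_nonneg hν0.le (by linarith : 0 ≤ w p - ψ p)
    simp only [hW]; linarith
  have hW1 : M < W (x₁, t₁) := by
    have h2 := (abs_le.1 (hUB _ (hScl _ hmem1))).2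
    have : W (x₁, t₁) = M + d - ν * (w (x₁, t₁) + (L + 1) * (t₁ - τ) + B) := by
      simp only [hW, hψ, hσ, hd, hv]; ring
    rw [this]
    have : ν * (w (x₁, t₁) + (L + 1) * (t₁ - τ) + B) ≤ ν * E' :=
      mul_le_mul_of_nonneg_left (by rw [hE']; linarith) hν0.le
    linarith
  have hWp : M < W p₀ := hW1.trans_le (hpm hmem1)
  have hpos : M < w p₀ - v p₀ := by have := hWle p₀ hp₀; linarith
  have hzM : w p₀ - uI p₀.1 ≤ M := hM p₀.1 hp₀.1.1 p₀.2 hp₀.1.2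
  have hap : τ < p₀.2 := by
    refine lt_of_le_of_ne hp₀.1.2.1 fun h => ?_
    have h1 : ‖p₀.1 - y‖ ^ 2 ≤ r ^ 2 + k * (p₀.2 - τ) := hp₀.2
    rw [← h, sub_self, mul_zero, add_zero] at h1
    have h2 := hδM p₀.1 (by rw [mem_closedBall, dist_eq_norm]; exact (abs_le_of_sq_le_sq' h1 hr.le).2)
    rw [h, Prod.mk.eta] at h2
    have h3 : ε * β p₀ ≤ δ := by
      have h4 : β p₀ ≤ r ^ 4 := by
        have h5 : 0 ≤ ‖p₀.1 - y‖ ^ 2 := by positivity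
        rw [hβd, bet, ← h, sub_self, mul_zero, mul_zero, Real.exp_zero, one_mul, add_zero]
        have := pow_le_pow_left₀ (by linarith : 0 ≤ r ^ 2 - ‖p₀.1 - y‖ ^ 2) (by linarith : r ^ 2 - ‖p₀.1 - y‖ ^ 2 ≤ r ^ 2) 2
        calc _ ≤ _ := this
          _ = r ^ 4 := by ring
      calc ε * β p₀ ≤ ε * r ^ 4 := mul_le_mul_of_nonneg_left h4 hε0
        _ = δ := by rw [hε]; field_simp
    simp only [hv] at hpos
    linarith
  have hlat : ‖p₀.1 - y‖ ^ 2 < r ^ 2 + k * (p₀.2 - τ) := by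
    refine lt_of_le_of_ne hp₀.2 fun h => ?_
    have : β p₀ = 0 := by rw [hβd, bet, h]; simp
    simp only [hv, this] at hpos
    linarith
  have hev : ∀ᶠ q in 𝓝[closure Ω ×ˢ Iic p₀.2] p₀, q ∈ Sx := by
    have h1 : ∀ᶠ q : SpT N in 𝓝[closure Ω ×ˢ Iic p₀.2] p₀, ‖q.1 - y‖ ^ 2 < r ^ 2 + k * (q.2 - τ) :=
      mem_nhdsWithin_of_mem_nhds ((isOpen_lt (by fun_prop) (by fun_prop)).mem_nhds hlat)
    filter_upwards [h1, ev_past hap] with q h2 h3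
    exact ⟨⟨hinb q (h3.2.2.trans hp₀.1.2.2) h2.le, h3.2.1.le, h3.2.2.trans hp₀.1.2.2⟩, h2.le⟩
  set G : SpT N → ℝ := fun p => F p.1 + ε * (-Dt β p + Lpl β p - m * K ^ (m - 1) * ‖Gd β p‖) with hG
  have hGc : Continuous G := by
    have h1 := Dt_cont hβc
    have h2 := Gd_cont hβc
    have h3 := Lpl_cont hβc
    rw [hG]; fun_prop
  have key := maxCyl D hm (μ := 1 - ν) (by linarith) (by linarith) hF hGc hw hvc hψc
    (hScl p₀ hp₀).1 hap hsub ?_ ?_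
  · rw [hψ, pOp_time hσc (by linarith), hσd] at key
    have h1 := (abs_le.1 (hFL p₀.1 (hScl p₀ hp₀).1)).1
    have h2 := hβ C E ρ₁ hr hk hC0 hE hΛ p₀ hap.le (by rw [← dist_eq_norm]; exact hp₀.1.1) hp₀.2
    have h3 := mul_nonneg hε0 h2
    have h4 := mul_le_mul_of_nonneg_left h1 hν0.le
    simp only [hG] at key
    linarith
  · filter_upwards [hev, ev_past hap] with q hq h3
    exact super_sub hm hε0 D.op hβc (hb hq.1.1) hK (hlip q.1 hq.1.1) (hsup q ⟨h3.1, h3.2.1⟩)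
  · filter_upwards [hev] with q hq
    exact hpm hq


/-- the main set of hypotheses -/
structure Core {N : ℕ} (Ω : Set (Euc N)) (m : ℝ) (F : Euc N → ℝ) (w : SpT N → ℝ) (uI : Euc N → ℝ) (B : ℝ) : Prop where
  D : Dom Ω
  hm : 2 < m
  hF : Continuous F
  hw : Continuous w
  huI : Continuous uI
  wsub : SubP Ω m F w 0
  wsup : SupP Ω m F w 0
  isub : ∀ a, SubP Ω m F (fun q => uI q.1) a
  isup : ∀ a, SupP Ω m F (fun q => uI q.1) a
  hB : 0 < B
  wB : ∀ p ∈ closure Ω ×ˢ Ici (0 : ℝ), |w p| ≤ B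
  iB : ∀ x ∈ closure Ω, |uI x| ≤ B
  lip : LocLipIn Ω uI
  con : IsPreconnected Ω

lemma lip_cpt {N : ℕ} {Ω : Set (Euc N)} (hΩ : IsOpen Ω) {uI : Euc N → ℝ} (h : LocLipIn Ω uI) {Kc : Set (Euc N)}
    (hK : IsCompact Kc) (hKΩ : Kc ⊆ Ω) :
    ∃ K ≥ 0, ∀ x ∈ Kc, ∀ᶠ z in 𝓝 x, |uI z - uI x| ≤ K * ‖z - x‖ := by
  refine hK.induction_on (p := fun s => ∃ K ≥ 0, ∀ x ∈ s, ∀ᶠ z in 𝓝 x, |uI z - uI x| ≤ K * ‖z - x‖) ?_ ?_ ?_ ?_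
  · exact ⟨0, le_rfl, by simp⟩
  · rintro s t hst ⟨K, hK, h1⟩
    exact ⟨K, hK, fun x hx => h1 x (hst hx)⟩
  · rintro s t ⟨K, hK, h1⟩ ⟨K', hK', h2⟩
    refine ⟨max K K', le_max_of_le_left hK, fun x hx => ?_⟩
    rcases hx with hx | hx
    · filter_upwards [h1 x hx] with z hz
      exact hz.trans (mul_le_mul_of_nonneg_right (le_max_left _ _) (norm_nonneg _))
    · filter_upwards [h2 x hx] with z hz
      exact hz.trans (mul_le_mul_of_nonneg_right (le_max_right _ _) (norm_nonneg _))
  · intro x hx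
    obtain ⟨ε, hε, K, hK0, hl⟩ := h x (hKΩ hx)
    have ho : IsOpen (ball x ε ∩ Ω) := isOpen_ball.inter hΩ
    refine ⟨ball x ε ∩ Ω, mem_nhdsWithin_of_mem_nhds (ho.mem_nhds ⟨mem_ball_self hε, hKΩ hx⟩), K, hK0, fun y hy => ?_⟩
    filter_upwards [ho.mem_nhds hy] with z hz
    exact hl z hz y hy

def QQ {N : ℕ} (w : SpT N → ℝ) (uI : Euc N → ℝ) (mb : ℝ) (l : Filter ℝ) (y : Euc N) (h : ℝ) : Prop :=
  ∃ r > 0, ∃ δ > 0, ∀ᶠ t in l, ∀ x ∈ closedBall y r, w (x, t + h) - uI x ≤ mb - δ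

section
variable {N : ℕ} {Ω : Set (Euc N)} {m : ℝ} {F : Euc N → ℝ} {w : SpT N → ℝ} {uI : Euc N → ℝ} {B mb : ℝ} {l : Filter ℝ}

lemma subP_mono {U : SpT N → ℝ} {a b : ℝ} (hab : a ≤ b) (h : SubP Ω m F U a) : SubP Ω m F U b :=
  fun p hp => h p ⟨hp.1, lt_of_le_of_lt hab hp.2⟩

lemma supP_mono {U : SpT N → ℝ} {a b : ℝ} (hab : a ≤ b) (h : SupP Ω m F U a) : SupP Ω m F U b :=
  fun p hp => h p ⟨hp.1, lt_of_le_of_lt hab hp.2⟩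

/-- common form of spreading and persistence -/
lemma spread0 (c : Core Ω m F w uI B) (hl : l ≤ atTop)
    (hlim : ∀ η > 0, ∀ᶠ t in atTop, ∀ s ≥ t, ∀ x ∈ closure Ω, w (x, s) - uI x ≤ mb + η)
    {y : Euc N} {ρ₁ h : ℝ} (hρ₁ : 0 < ρ₁) (hb : closedBall y ρ₁ ⊆ Ω) (hh : 0 ≤ h)
    (hQ : QQ w uI mb l y h) : ∃ r₀ > 0, ∀ r, 0 < r → r ≤ r₀ → ∀ k H : ℝ, 0 ≤ k → 0 ≤ H → r ^ 2 + k * H ≤ ρ₁ ^ 2 →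
      ∃ κ > 0, ∀ η > 0, ∀ᶠ t in l, ∀ s ∈ Icc 0 H, ∀ x, ‖x - y‖ ^ 2 ≤ r ^ 2 + k * s →
        w (x, t + h + s) - uI x ≤ mb + η - κ * (r ^ 2 + k * s - ‖x - y‖ ^ 2) ^ 2 := by
  obtain ⟨r₀, hr₀, δ, hδ, hev⟩ := hQ
  obtain ⟨K, hK, hlip⟩ := lip_cpt c.D.op c.lip (isCompact_closedBall y ρ₁) hb
  refine ⟨r₀, hr₀, fun r hr hrr k H hk hH hkH => ?_⟩
  obtain ⟨Λ, hp⟩ := propag (m := m) c.D (by linarith [c.hm]) c.hF c.hw c.huI hK hb hlip hr hk hρ₁.le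
  refine ⟨δ / r ^ 4 * Real.exp (-|Λ| * H), by positivity, fun η hη => ?_⟩
  filter_upwards [hev, hl (hlim η hη), hl (eventually_ge_atTop 0)] with t h1 h2 h3 s hs x hx
  have := hp (t + h) H (mb + η) δ hH hkH hδ.le (subP_mono (by linarith) c.wsub) (c.isup _)
    (fun x hx s hs => h2 s (by linarith [hs.1]) x (subset_closure (hb hx)))
    (fun x hx => by have := h1 x (closedBall_subset_closedBall hrr hx); linarith) x (t + h + s)
    ⟨by linarith [hs.1], by linarith [hs.2]⟩ (by rw [add_sub_cancel_left]; exact hx)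
  refine this.trans ?_
  simp only [bet, add_sub_cancel_left]
  have h4 : Real.exp (-|Λ| * H) ≤ Real.exp (-Λ * s) := by
    apply Real.exp_le_exp.2
    have a1 : Λ * s ≤ |Λ| * s := mul_le_mul_of_nonneg_right (le_abs_self _) hs.1
    have a2 : |Λ| * s ≤ |Λ| * H := mul_le_mul_of_nonneg_left hs.2 (abs_nonneg _)
    linarith
  have h5 : δ / r ^ 4 * (Real.exp (-|Λ| * H) * (r ^ 2 + k * s - ‖x - y‖ ^ 2) ^ 2) ≤
      δ / r ^ 4 * (Real.exp (-Λ * s) * (r ^ 2 + k * s - ‖x - y‖ ^ 2) ^ 2) := by gcongr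
  linarith

lemma spread (c : Core Ω m F w uI B) (hl : l ≤ atTop)
    (hlim : ∀ η > 0, ∀ᶠ t in atTop, ∀ s ≥ t, ∀ x ∈ closure Ω, w (x, s) - uI x ≤ mb + η)
    {y : Euc N} {ρ₁ h : ℝ} (hρ₁ : 0 < ρ₁) (hb : closedBall y ρ₁ ⊆ Ω) (hh : 0 ≤ h)
    (hQ : QQ w uI mb l y h) {x : Euc N} (hx : x ∈ ball y ρ₁) {h' : ℝ} (hh' : 0 < h') :
    QQ w uI mb l x (h + h') := by
  obtain ⟨r₀, hr₀, H⟩ := spread0 c hl hlim hρ₁ hb hh hQ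
  set r := min r₀ ρ₁ with hr
  have hr0 : 0 < r := by positivity
  have hrρ : r ^ 2 ≤ ρ₁ ^ 2 := by have := min_le_right r₀ ρ₁; gcongr
  obtain ⟨κ, hκ, hev⟩ := H r hr0 (min_le_left _ _) ((ρ₁ ^ 2 - r ^ 2) / h') h' (div_nonneg (by linarith) hh'.le) hh'.le
    (by rw [div_mul_cancel₀ _ hh'.ne']; linarith)
  rw [mem_ball, dist_eq_norm] at hx
  set ρ₂ := (ρ₁ + ‖x - y‖) / 2 with hρ₂
  have hρ₂0 : 0 ≤ ρ₂ := by positivity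
  have hρ₂1 : ρ₂ < ρ₁ := by rw [hρ₂]; linarith
  have hsq : ρ₂ ^ 2 < ρ₁ ^ 2 := by gcongr
  set δ := κ * (ρ₁ ^ 2 - ρ₂ ^ 2) ^ 2 with hδ
  have hδ0 : 0 < δ := by have : 0 < ρ₁ ^ 2 - ρ₂ ^ 2 := by linarith
                         positivity
  refine ⟨ρ₂ - ‖x - y‖, by rw [hρ₂]; linarith, δ / 2, by positivity, ?_⟩
  filter_upwards [hev (δ / 2) (by positivity)] with t ht x' hx'
  rw [mem_closedBall, dist_eq_norm] at hx'
  have h1 : ‖x' - y‖ ≤ ρ₂ := by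
    have := norm_sub_le_norm_sub_add_norm_sub x' x y
    linarith
  have h2 : ‖x' - y‖ ^ 2 ≤ ρ₂ ^ 2 := by gcongr
  have h3 := ht h' ⟨hh'.le, le_rfl⟩ x'
  rw [div_mul_cancel₀ _ hh'.ne', add_sub_cancel] at h3
  have h4 := h3 (by linarith)
  have h5 : δ ≤ κ * (ρ₁ ^ 2 - ‖x' - y‖ ^ 2) ^ 2 := by
    rw [hδ]
    have : (ρ₁ ^ 2 - ρ₂ ^ 2) ^ 2 ≤ (ρ₁ ^ 2 - ‖x' - y‖ ^ 2) ^ 2 :=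
      pow_le_pow_left₀ (by linarith) (by linarith) 2
    gcongr
  rw [← add_assoc]
  linarith

lemma persist (c : Core Ω m F w uI B) (hl : l ≤ atTop)
    (hlim : ∀ η > 0, ∀ᶠ t in atTop, ∀ s ≥ t, ∀ x ∈ closure Ω, w (x, s) - uI x ≤ mb + η)
    {y : Euc N} {h : ℝ} (hy : y ∈ Ω) (hh : 0 ≤ h)
    (hQ : QQ w uI mb l y h) {H : ℝ} (hH : 0 ≤ H) :
    ∃ r > 0, ∃ δ > 0, ∀ᶠ t in l, ∀ x ∈ closedBall y r, ∀ s ∈ Icc 0 H, w (x, t + h + s) - uI x ≤ mb - δ := by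
  obtain ⟨ρ₁, hρ₁, hb⟩ := Metric.nhds_basis_closedBall.mem_iff.1 (c.D.op.mem_nhds hy)
  obtain ⟨r₀, hr₀, HH⟩ := spread0 c hl hlim hρ₁ hb hh hQ
  set r := min r₀ ρ₁ with hr
  have hr0 : 0 < r := by positivity
  have hrρ : r ^ 2 ≤ ρ₁ ^ 2 := by have := min_le_right r₀ ρ₁; gcongr
  obtain ⟨κ, hκ, hev⟩ := HH r hr0 (min_le_left _ _) 0 H le_rfl hH (by linarith)
  set δ := κ * (r ^ 2 / 2) ^ 2 with hδ
  have hδ0 : 0 < δ := by positivity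
  refine ⟨r / 2, by positivity, δ / 2, by positivity, ?_⟩
  filter_upwards [hev (δ / 2) (by positivity)] with t ht x hx s hs
  rw [mem_closedBall, dist_eq_norm] at hx
  have h2 : ‖x - y‖ ^ 2 ≤ r ^ 2 / 2 := by
    have : ‖x - y‖ ^ 2 ≤ (r / 2) ^ 2 := by gcongr
    nlinarith
  have h3 := ht s hs x (by rw [zero_mul, add_zero]; nlinarith)
  rw [zero_mul, add_zero] at h3
  have h5 : δ ≤ κ * (r ^ 2 - ‖x - y‖ ^ 2) ^ 2 := by
    rw [hδ]
    have : (r ^ 2 / 2) ^ 2 ≤ (r ^ 2 - ‖x - y‖ ^ 2) ^ 2 :=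
      pow_le_pow_left₀ (by positivity) (by linarith) 2
    gcongr
  linarith

lemma spread_all (c : Core Ω m F w uI B) (hl : l ≤ atTop)
    (hlim : ∀ η > 0, ∀ᶠ t in atTop, ∀ s ≥ t, ∀ x ∈ closure Ω, w (x, s) - uI x ≤ mb + η)
    {y₀ : Euc N} (hy₀ : y₀ ∈ Ω) (hQ : QQ w uI mb l y₀ 0) : ∀ y ∈ Ω, ∀ h > 0, QQ w uI mb l y h := by
  set A : Set (Euc N) := {y | y ∈ Ω ∧ ∀ h > 0, QQ w uI mb l y h} with hA
  have hball : ∀ y ρ₁, 0 < ρ₁ → closedBall y ρ₁ ⊆ Ω → y ∈ A → ball y ρ₁ ⊆ A := by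
    intro y ρ₁ hρ₁ hb hy x hx
    refine ⟨hb (ball_subset_closedBall hx), fun h hh => ?_⟩
    have := spread c hl hlim hρ₁ hb (half_pos hh).le (hy.2 _ (half_pos hh)) hx (half_pos hh)
    rwa [add_halves] at this
  have hsub : Ω ⊆ A := by
    refine c.con.subset_of_closure_inter_subset ?_ ?_ ?_
    · rw [Metric.isOpen_iff]
      intro y hy
      obtain ⟨ρ₁, hρ₁, hb⟩ := Metric.nhds_basis_closedBall.mem_iff.1 (c.D.op.mem_nhds hy.1)
      exact ⟨ρ₁, hρ₁, hball y ρ₁ hρ₁ hb hy⟩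
    · obtain ⟨ρ₁, hρ₁, hb⟩ := Metric.nhds_basis_closedBall.mem_iff.1 (c.D.op.mem_nhds hy₀)
      refine ⟨y₀, hy₀, hy₀, fun h hh => ?_⟩
      have := spread c hl hlim hρ₁ hb le_rfl hQ (mem_ball_self hρ₁) hh
      rwa [zero_add] at this
    · rintro y ⟨hyc, hy⟩
      obtain ⟨ρ₁, hρ₁, hb⟩ := Metric.nhds_basis_closedBall.mem_iff.1 (c.D.op.mem_nhds hy)
      obtain ⟨y', hy', hd⟩ := Metric.mem_closure_iff.1 hyc (ρ₁ / 2) (by positivity)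
      refine hball y' (ρ₁ / 2) (by positivity) (fun x hx => hb ?_) hy' (by rwa [mem_ball])
      rw [mem_closedBall] at hx ⊢
      have := dist_triangle x y' y
      rw [dist_comm y' y] at this
      linarith
  exact fun y hy => (hsub hy).2
end


section
variable {N : ℕ} {Ω : Set (Euc N)} {m : ℝ} {F : Euc N → ℝ} {w : SpT N → ℝ} {uI : Euc N → ℝ} {B : ℝ}

lemma lim_sup (c : Core Ω m F w uI B) : ∃ mb : ℝ,
    (∀ η > 0, ∀ᶠ t in atTop, ∀ s ≥ t, ∀ x ∈ closure Ω, w (x, s) - uI x ≤ mb + η) ∧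
    (∀ t ≥ 0, ∀ M, (∀ x ∈ closure Ω, w (x, t) - uI x ≤ M) → mb ≤ M) := by
  set A : Set ℝ := {M | ∃ t ≥ 0, ∀ x ∈ closure Ω, w (x, t) - uI x ≤ M} with hA
  have hne : A.Nonempty := ⟨2 * B, 0, le_rfl, fun x hx => by
    have h1 := (abs_le.1 (c.wB (x, 0) ⟨hx, mem_Ici.2 le_rfl⟩)).2
    have h2 := (abs_le.1 (c.iB x hx)).1
    linarith⟩
  have hbd : BddBelow A := by
    refine ⟨-(2 * B), ?_⟩
    rintro M ⟨t, ht, hM⟩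
    obtain ⟨x, hx⟩ := c.D.ne
    have hx := subset_closure hx
    have h1 := (abs_le.1 (c.wB (x, t) ⟨hx, ht⟩)).1
    have h2 := (abs_le.1 (c.iB x hx)).2
    have := hM x hx
    linarith
  refine ⟨sInf A, fun η hη => ?_, fun t ht M hM => csInf_le hbd ⟨t, ht, hM⟩⟩
  obtain ⟨M, ⟨t₀, ht₀, hM⟩, hlt⟩ := exists_lt_of_csInf_lt hne (lt_add_of_pos_right (sInf A) hη)
  filter_upwards [eventually_ge_atTop t₀] with t ht s hs x hx
  have := comp c.D (m := m) (by linarith [c.hm]) c.hF c.hw (v := fun q => uI q.1) (c.huI.comp continuous_fst)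
    (a := t₀) (C := M) (subP_mono ht₀ c.wsub) (c.isup _) (fun x hx => by have := hM x hx; simp only; linarith) (x, s)
    ⟨hx, mem_Ici.2 (by linarith)⟩
  simp only at this
  linarith

lemma lower_int (c : Core Ω m F w uI B) {mb : ℝ}
    (hlim : ∀ η > 0, ∀ᶠ t in atTop, ∀ s ≥ t, ∀ x ∈ closure Ω, w (x, s) - uI x ≤ mb + η)
    (hlow : ∀ t ≥ 0, ∀ M, (∀ x ∈ closure Ω, w (x, t) - uI x ≤ M) → mb ≤ M)
    {ρ : Euc N → ℝ} (hρc : Continuous ρ) (hρ1 : Ω = {x | ρ x < 0}) {s C₀ : ℝ} (hs : 0 < s) (hC₀ : 0 ≤ C₀)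
    (hst : ∀ U v : SpT N → ℝ, Continuous U → Continuous v → ∀ B t₀ T : ℝ, 0 ≤ T →
      SubP Ω m F U t₀ → SupP Ω m F v t₀ → (∀ p ∈ closure Ω ×ˢ Icc t₀ (t₀ + T), |U p| ≤ B) →
      ∀ M₁ M₂ : ℝ, (∀ x ∈ closure Ω, U (x, t₀) - v (x, t₀) ≤ M₁) →
      (∀ x ∈ closure Ω, ρ x ≤ -s → ∀ t ∈ Icc t₀ (t₀ + T), U (x, t) - v (x, t) ≤ M₂) →
      ∀ ν : ℝ, 0 < ν → ν ≤ 1 → ∀ x ∈ closure Ω,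
        U (x, t₀ + T) - v (x, t₀ + T) ≤ max (M₁ + ν * (C₀ + 2 * B - T)) (M₂ + ν * (C₀ + 2 * B)))
    {ε : ℝ} (hε : 0 < ε) :
    ∀ᶠ t in atTop, ∀ x ∈ closure Ω, ρ x ≤ -s → mb - ε ≤ w (x, t) - uI x := by
  by_contra hcon
  rw [not_eventually] at hcon
  set Ks : Set (Euc N) := {x | x ∈ closure Ω ∧ ρ x ≤ -s} with hKs
  have hKc : IsCompact Ks := c.D.cpt.inter_right (isClosed_le hρc continuous_const)
  have hKΩ : Ks ⊆ Ω := by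
    intro x hx
    have h2 := hx.2
    rw [hρ1]
    show ρ x < 0
    linarith
  set bad : Set ℝ := {t | ∃ x ∈ Ks, w (x, t) - uI x < mb - ε} with hbad
  have hfr : ∃ᶠ t in atTop, t ∈ bad := by
    refine hcon.mono fun t ht => ?_
    push Not at ht
    obtain ⟨x, h1, h2, h3⟩ := ht
    exact ⟨x, ⟨h1, h2⟩, h3⟩
  have hy : ∀ t, ∃ y, t ∈ bad → y ∈ Ks ∧ w (y, t) - uI y < mb - ε := by
    intro t
    by_cases ht : t ∈ bad
    · obtain ⟨y, h1, h2⟩ := ht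
      exact ⟨y, fun _ => ⟨h1, h2⟩⟩
    · exact ⟨0, fun h => absurd h ht⟩
  choose y hy using hy
  set l' : Filter ℝ := atTop ⊓ 𝓟 bad with hl'
  haveI : NeBot l' := frequently_mem_iff_neBot.1 hfr
  have hbl : ∀ᶠ t in l', t ∈ bad := mem_inf_of_right (mem_principal_self bad)
  obtain ⟨y₀, hy₀, hcl⟩ := hKc (f := map y l') (by
    rw [le_principal_iff, mem_map]
    filter_upwards [hbl] with t ht
    exact (hy t ht).1)
  set l : Filter ℝ := l' ⊓ comap y (𝓝 y₀) with hldef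
  have hlne : NeBot l := by
    have h1 : NeBot (𝓝 y₀ ⊓ map y l') := hcl
    rw [inf_comm, ← Filter.push_pull] at h1
    exact (map_neBot_iff y).1 h1
  have hll' : l ≤ l' := inf_le_left
  have hl : l ≤ atTop := hll'.trans inf_le_left
  have hyt : Tendsto y l (𝓝 y₀) := tendsto_iff_comap.2 inf_le_right
  have hy₀Ω := hKΩ hy₀
  have hQ : QQ w uI mb l y₀ 0 := by
    obtain ⟨d, hd, hb⟩ := Metric.nhds_basis_closedBall.mem_iff.1 (c.D.op.mem_nhds hy₀Ω)
    obtain ⟨r, hr, hrd, hsm⟩ := space_mod c.D c.hm c.hF c.hw c.wsub c.wsup c.hB c.wB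
      (ε := ε / 4) (d := d / 2) (by positivity) (by positivity)
    obtain ⟨r₁, hr₁, hu⟩ := Metric.continuousAt_iff.1 (c.huI.continuousAt (x := y₀)) (ε / 8) (by positivity)
    refine ⟨min (r / 2) (r₁ / 2), by positivity, ε / 4, by positivity, ?_⟩
    filter_upwards [hl (eventually_ge_atTop 1), hll' hbl,
      hyt (ball_mem_nhds y₀ (ε := min (r / 2) r₁) (by positivity))] with t h1 h2 h3 x hx
    have h3 : dist (y t) y₀ < min (r / 2) r₁ := h3
    rw [lt_min_iff] at h3
    rw [mem_closedBall, le_min_iff] at hx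
    rw [add_zero]
    have h4 := hsm (y t) (fun z hz => hb (by
      rw [mem_closedBall] at hz ⊢
      have := dist_triangle z (y t) y₀
      linarith)) t h1 x (by
      rw [mem_closedBall]
      have := dist_triangle x y₀ (y t)
      rw [dist_comm y₀] at this
      linarith)
    have h5 := (hy t h2).2
    have h6 := hu h3.2
    have h7 := hu (x := x) (by linarith)
    rw [Real.dist_eq] at h6 h7
    have h6 := abs_lt.1 h6
    have h7 := abs_lt.1 h7
    linarith [h6.1, h6.2, h7.1, h7.2]
  have hall := spread_all c hl hlim hy₀Ω hQ
  have hB0 := c.hB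
  set T := C₀ + 2 * B + 1 with hT
  have hT0 : 0 < T := by positivity
  have hcov : ∃ δ > 0, ∀ᶠ t in l, ∀ x ∈ Ks, ∀ s ∈ Icc 0 T, w (x, t + 1 + s) - uI x ≤ mb - δ := by
    refine hKc.induction_on (p := fun S => ∃ δ > 0, ∀ᶠ t in l, ∀ x ∈ S, ∀ s ∈ Icc 0 T, w (x, t + 1 + s) - uI x ≤ mb - δ)
      ?_ ?_ ?_ ?_
    · exact ⟨1, one_pos, by simp⟩
    · rintro S S' hS ⟨δ, hδ, h⟩
      exact ⟨δ, hδ, h.mono fun t ht x hx => ht x (hS hx)⟩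
    · rintro S S' ⟨δ, hδ, h⟩ ⟨δ', hδ', h'⟩
      refine ⟨min δ δ', by positivity, ?_⟩
      filter_upwards [h, h'] with t h1 h2 x hx s hs
      have a1 := min_le_left δ δ'
      have a2 := min_le_right δ δ'
      rcases hx with hx | hx
      · linarith [h1 x hx s hs]
      · linarith [h2 x hx s hs]
    · intro x hx
      obtain ⟨r, hr, δ, hδ, h⟩ := persist c hl hlim (hKΩ hx) zero_le_one (hall x (hKΩ hx) 1 one_pos) hT0.le
      exact ⟨closedBall x r, mem_nhdsWithin_of_mem_nhds (closedBall_mem_nhds x hr), δ, hδ, h⟩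
  obtain ⟨δ, hδ, hcov⟩ := hcov
  set ν := min 1 (δ / (2 * T)) with hν
  have hν0 : 0 < ν := by positivity
  have hν1 : ν * T ≤ δ / 2 := by
    have : ν ≤ δ / (2 * T) := min_le_right _ _
    calc ν * T ≤ δ / (2 * T) * T := mul_le_mul_of_nonneg_right this hT0.le
      _ = δ / 2 := by field_simp
  obtain ⟨t, h1, h2, h3⟩ := (hcov.and (((hlim (ν / 2) (by positivity)).filter_mono hl).and ((eventually_ge_atTop 0).filter_mono hl))).exists
  have h4 := hst w (fun q => uI q.1) c.hw (c.huI.comp continuous_fst) B (t + 1) T hT0.le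
    (subP_mono (by linarith) c.wsub) (c.isup _) (fun p hp => c.wB p ⟨hp.1, mem_Ici.2 (by linarith [hp.2.1])⟩)
    (mb + ν / 2) (mb - δ) (fun x hx => h2 (t + 1) (by linarith) x hx) (fun x hx hx2 τ hτ => by
      have := h1 x ⟨hx, hx2⟩ (τ - (t + 1)) ⟨by linarith [hτ.1], by linarith [hτ.2]⟩
      rwa [add_sub_cancel] at this) ν hν0 (min_le_left _ _)
  have h5 := hlow (t + 1 + T) (by linarith) _ h4
  have e1 : ν * (C₀ + 2 * B - T) = -ν := by rw [hT]; ring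
  have e2 : ν * (C₀ + 2 * B) = ν * T - ν := by rw [hT]; ring
  rw [e1, e2, le_max_iff] at h5
  rcases h5 with h5 | h5 <;> linarith

theorem core_thm (c : Core Ω m F w uI B) {ρ : Euc N → ℝ}
    (hρ : ContDiff ℝ 2 ρ) (hρ1 : Ω = {x | ρ x < 0}) (hρ2 : frontier Ω = {x | ρ x = 0})
    (hρ3 : ∀ x ∈ frontier Ω, gradient ρ x ≠ 0) :
    ∃ K₁ : ℝ, ∀ ε > 0, ∀ᶠ t in atTop, ∀ x ∈ closure Ω, |w (x, t) - uI x - K₁| ≤ ε := by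
  obtain ⟨mb, hlim, hlow⟩ := lim_sup c
  have hm1 : 1 < m := by linarith [c.hm]
  have hB0 := c.hB
  obtain ⟨s, hs, C₀, hC₀, hst⟩ := strip c.D hm1 hρ hρ1 hρ2 hρ3 c.hF
  refine ⟨mb, fun ε hε => ?_⟩
  have hli := lower_int c hlim hlow hρ.continuous hρ1 hs hC₀ hst (half_pos hε)
  set R := C₀ + 2 * B with hR
  have hR0 : 0 < R := by positivity
  set ν := min 1 (ε / (2 * R)) with hν
  have hν0 : 0 < ν := by positivity
  have hν1 : ν * R ≤ ε / 2 := by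
    have : ν ≤ ε / (2 * R) := min_le_right _ _
    calc ν * R ≤ ε / (2 * R) * R := mul_le_mul_of_nonneg_right this hR0.le
      _ = ε / 2 := by field_simp
  set T := (2 * B + |mb|) / ν with hT
  have hT0 : 0 ≤ T := by positivity
  have hνT : ν * T = 2 * B + |mb| := by rw [hT]; field_simp
  obtain ⟨t₁, ht₁⟩ := eventually_atTop.1 hli
  filter_upwards [hlim ε hε, eventually_ge_atTop (max 0 t₁ + T)] with t h1 h2 x hx
  rw [abs_le]
  refine ⟨?_, by linarith [h1 t le_rfl x hx]⟩
  have a0 := le_max_left 0 t₁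
  have a1 := le_max_right 0 t₁
  have h4 := hst (fun q => uI q.1) w (c.huI.comp continuous_fst) c.hw B (t - T) T hT0
    (c.isub _) (supP_mono (by linarith) c.wsup) (fun p hp => c.iB _ hp.1)
    (2 * B) (-mb + ε / 2) (fun x hx => by
      have b1 := (abs_le.1 (c.wB (x, t - T) ⟨hx, mem_Ici.2 (by linarith)⟩)).1
      have b2 := (abs_le.1 (c.iB x hx)).2
      simp only
      linarith) (fun x hx hx2 τ hτ => by
      have := ht₁ τ (by linarith [hτ.1]) x hx hx2
      simp only
      linarith) ν hν0 (min_le_left _ _) x hx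
  have e1 : ν * (C₀ + 2 * B - T) = ν * R - ν * T := by ring
  rw [sub_add_cancel, e1, hνT, le_max_iff] at h4
  have := le_abs_self mb
  simp only at h4
  rcases h4 with h4 | h4 <;> linarith
end


lemma ext_cont {X : Type*} [TopologicalSpace X] [NormalSpace X] {s : Set X} (hs : IsClosed s) {f : X → ℝ}
    (hf : ContinuousOn f s) : ∃ g : X → ℝ, Continuous g ∧ ∀ x ∈ s, g x = f x := by
  obtain ⟨g, hg⟩ := ContinuousMap.exists_restrict_eq hs ⟨s.restrict f, hf.restrict⟩
  refine ⟨g, g.continuous, fun x hx => ?_⟩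
  have := congrArg (fun h => h ⟨x, hx⟩) hg
  exact this

lemma pOp_ct {N : ℕ} {φ : SpT N → ℝ} (h : ContDiff ℝ 2 φ) (m c : ℝ) (p : SpT N) :
    pOp m (fun q => 1 * φ q + (-c) * q.2) p = pOp m φ p - c := by
  have hτ : ContDiff ℝ 2 (fun s : ℝ => s) := contDiff_id
  have h2 := timefun_c2 (N := N) hτ
  rw [pOp, Dt_lc h h2, Gd_lc h h2, Lpl_lc h h2, timefun_Dt hτ, timefun_Gd hτ, timefun_Lpl hτ, pOp]
  simp
  ring

section
variable {N : ℕ} {Ω : Set (Euc N)} {m : ℝ} {F f : Euc N → ℝ}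

lemma stat_subP {w wE : Euc N → ℝ} (hΩ : IsOpen Ω) (hw : ∀ x ∈ closure Ω, wE x = w x) (hF : ∀ x ∈ closure Ω, F x = f x)
    (h : ∀ φ : Euc N → ℝ, ContDiff ℝ 2 φ → ∀ x₀ ∈ Ω, IsLocalMax (w - φ) x₀ → statOp f 0 m φ (w x₀) x₀ ≤ 0) (a : ℝ) :
    SubP Ω m F (fun q => wE q.1) a := by
  rintro ⟨x, t⟩ ⟨hx, -⟩ φ hφ hmax
  simp only at hx ⊢
  have hc : Continuous fun y : Euc N => ((y, t) : SpT N) := by fun_prop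
  have hc2 : Continuous fun s : ℝ => ((x, s) : SpT N) := by fun_prop
  have h1 := h (fun y => φ (y, t)) (hφ.comp (by fun_prop)) x hx (by
    filter_upwards [hc.continuousAt.eventually hmax, hΩ.mem_nhds hx] with y hy hyΩ
    simp only [Pi.sub_apply]
    rwa [hw y (subset_closure hyΩ), hw x (subset_closure hx)] at hy)
  have h2 : Dt φ (x, t) = 0 := by
    refine IsLocalMin.hasDerivAt_eq_zero (f := fun s => φ (x, s)) ?_ (sec_hasDeriv hφ x t)
    filter_upwards [hc2.continuousAt.eventually hmax] with s hs
    linarith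
  rw [statOp_sec hφ, h2] at h1
  rw [hF x (subset_closure hx)]
  linarith

lemma stat_supP {w wE : Euc N → ℝ} (hw : ∀ x ∈ closure Ω, wE x = w x) (hF : ∀ x ∈ closure Ω, F x = f x)
    (h : ∀ φ : Euc N → ℝ, ContDiff ℝ 2 φ → ∀ x₀ ∈ closure Ω,
      IsLocalMinOn (w - φ) (closure Ω) x₀ → 0 ≤ statOp f 0 m φ (w x₀) x₀) (a : ℝ) :
    SupP Ω m F (fun q => wE q.1) a := by
  rintro ⟨x, t⟩ ⟨hx, -⟩ φ hφ hmin
  simp only at hx hmin ⊢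
  have hc : Tendsto (fun y : Euc N => ((y, t) : SpT N)) (𝓝[closure Ω] x) (𝓝[closure Ω ×ˢ Iic t] (x, t)) := by
    refine tendsto_nhdsWithin_iff.2 ⟨?_, ?_⟩
    · have : Continuous fun y : Euc N => ((y, t) : SpT N) := by fun_prop
      exact this.continuousAt.mono_left nhdsWithin_le_nhds
    · filter_upwards [eventually_mem_nhdsWithin] with y hy
      exact ⟨hy, mem_Iic.2 le_rfl⟩
  have hc2 : Tendsto (fun s : ℝ => ((x, s) : SpT N)) (𝓝[<] t) (𝓝[closure Ω ×ˢ Iic t] (x, t)) := by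
    refine tendsto_nhdsWithin_iff.2 ⟨?_, ?_⟩
    · have : Continuous fun y : ℝ => ((x, y) : SpT N) := by fun_prop
      exact this.continuousAt.mono_left nhdsWithin_le_nhds
    · filter_upwards [eventually_mem_nhdsWithin] with s hs
      exact ⟨hx, mem_Iic.2 (le_of_lt hs)⟩
  have h1 := h (fun y => φ (y, t)) (hφ.comp (by fun_prop)) x hx (by
    filter_upwards [hc.eventually hmin, eventually_mem_nhdsWithin] with y hy hyΩ
    simp only [Pi.sub_apply]
    rwa [hw y hyΩ, hw x hx] at hy)
  have h2 : 0 ≤ Dt φ (x, t) := by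
    have h3 := (hasDerivAt_iff_tendsto_slope.1 (sec_hasDeriv hφ x t)).mono_left
      (nhdsWithin_mono t (s := Iio t) (fun s hs => (ne_of_lt hs)))
    refine ge_of_tendsto h3 ?_
    filter_upwards [hc2.eventually hmin, eventually_mem_nhdsWithin] with s hs hst
    have hst : s < t := hst
    rw [slope_def_field]
    exact div_nonneg_of_nonpos (by linarith) (by linarith)
  rw [statOp_sec hφ] at h1
  rw [hF x hx]
  linarith

lemma par_subP {u₀ g : Euc N → ℝ} {u : Euc N → ℝ → ℝ} {c : ℝ} {wE : SpT N → ℝ} (hΩ : IsOpen Ω)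
    (hw : ∀ p ∈ closure Ω ×ˢ Ici (0 : ℝ), wE p = u p.1 p.2 + c * p.2) (hF : ∀ x ∈ closure Ω, F x = f x + c)
    (hu : IsGlobalParSol Ω f g u₀ 0 m u) : SubP Ω m F wE 0 := by
  rintro ⟨x, t⟩ ⟨hx, ht⟩ φ hφ hmax
  simp only [mem_Ioi] at hx ht hmax ⊢
  have hxc := subset_closure hx
  have hτ : ContDiff ℝ 2 (fun s : ℝ => s) := contDiff_id
  have hφ' := lc_c2 hφ (timefun_c2 (N := N) hτ) 1 (-c)
  have h1 := ((hu.2 (t + 1) (by linarith)).1.2.2 _ hφ' x t ⟨hxc, ht, by linarith⟩ (by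
    filter_upwards [mem_nhdsWithin_of_mem_nhds hmax, eventually_mem_nhdsWithin] with q hq hq2
    rw [hw q ⟨hq2.1, mem_Ici.2 hq2.2.1.le⟩, hw (x, t) ⟨hxc, mem_Ici.2 ht.le⟩] at hq
    simp only at hq ⊢
    linarith)).1 hx
  rw [parOp_eq hφ', pOp_ct hφ] at h1
  rw [hF x hxc]
  linarith

lemma par_sup {u₀ g : Euc N → ℝ} {u : Euc N → ℝ → ℝ} {c : ℝ} {wE : SpT N → ℝ} (hΩ : IsOpen Ω)
    (hw : ∀ p ∈ closure Ω ×ˢ Ici (0 : ℝ), wE p = u p.1 p.2 + c * p.2) (hF : ∀ x ∈ closure Ω, F x = f x + c)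
    (hu : IsGlobalParSol Ω f g u₀ 0 m u) {p : SpT N} (hp : p ∈ closure Ω ×ˢ Ioi (0 : ℝ))
    (hb : p.1 ∈ frontier Ω → wE p < g p.1 + c * p.2) : VSuperAt Ω m (F p.1) wE p := by
  obtain ⟨x, t⟩ := p
  obtain ⟨hx, ht⟩ := hp
  intro φ hφ hmin
  simp only [mem_Ioi] at hx ht hmin hb ⊢
  have hτ : ContDiff ℝ 2 (fun s : ℝ => s) := contDiff_id
  have hφ' := lc_c2 hφ (timefun_c2 (N := N) hτ) 1 (-c)
  have hwp := hw (x, t) ⟨hx, mem_Ici.2 ht.le⟩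
  simp only at hwp
  have h1 := (hu.2 t ht).2.2.2 _ hφ' x t ⟨hx, ht, le_rfl⟩ (by
    have hsub : closure Ω ×ˢ Ioc 0 t ⊆ closure Ω ×ˢ Iic t := prod_mono le_rfl fun s hs => hs.2
    filter_upwards [nhdsWithin_mono _ hsub hmin, eventually_mem_nhdsWithin] with q hq hq2
    rw [hw q ⟨hq2.1, mem_Ici.2 hq2.2.1.le⟩, hwp] at hq
    linarith)
  have h2 : 0 ≤ parOp f 0 m (fun q => 1 * φ q + (-c) * q.2) (u x t) x t := by
    by_cases hxΩ : x ∈ Ω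
    · exact h1.1 hxΩ
    · have hfr : x ∈ frontier Ω := by rw [hΩ.frontier_eq]; exact ⟨hx, hxΩ⟩
      rcases le_max_iff.1 (h1.2 hfr) with h3 | h3
      · exact h3
      · have := hb hfr
        linarith
  rw [parOp_eq hφ', pOp_ct hφ] at h2
  rw [hF x hx]
  linarith

lemma no_stat (D : Dom Ω) (hm : 1 < m) (hF : Continuous F) {c : ℝ} (hc : 0 < c) {w uI : Euc N → ℝ}
    (hw : Continuous w) (huI : Continuous uI) (hsub : SubP Ω m F (fun q => w q.1) 0)
    (hsup : SupP Ω m (fun x => F x + c) (fun q => uI q.1) 0) : False := by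
  obtain ⟨L, hL, hFL⟩ := bdd_F D hF
  set ν := min 1 (c / (2 * L)) with hν
  have hν0 : 0 < ν := by positivity
  have hν1 : ν * L ≤ c / 2 := by
    have : ν ≤ c / (2 * L) := min_le_right _ _
    calc ν * L ≤ c / (2 * L) * L := mul_le_mul_of_nonneg_right this hL.le
      _ = c / 2 := by field_simp
  have hν2 : ν ≤ 1 := min_le_left _ _
  obtain ⟨x₀, hx₀, hmax⟩ := D.cpt.exists_isMaxOn (D.ne.mono subset_closure)
    (f := fun x => (1 - ν) * w x - uI x) (by fun_prop)
  have hτ : ContDiff ℝ 2 (fun _ : ℝ => (0 : ℝ)) := contDiff_const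
  have h := maxCyl D hm (μ := 1 - ν) (by linarith) (by linarith) hF (G := fun p => F p.1 + c) (by fun_prop)
    (U := fun q => w q.1) (v := fun q => uI q.1) (by fun_prop) (by fun_prop) (timefun_c2 (N := N) hτ)
    (p₀ := (x₀, 1)) hx₀ (a := 0) one_pos hsub (by
      filter_upwards [ev_past (Ω := Ω) (p₀ := ((x₀, 1) : SpT N)) (a := 0) one_pos] with q hq
      exact hsup q ⟨hq.1, hq.2.1⟩) (by
      filter_upwards [eventually_mem_nhdsWithin] with q hq
      have := hmax hq.1
      simp only [mem_ofPred_eq] at this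
      linarith)
  rw [pOp_time hτ (by linarith)] at h
  simp only [deriv_const', mul_zero, add_zero] at h
  have h1 := (abs_le.1 (hFL x₀ hx₀)).1
  have h2 : ν * (-L) ≤ ν * F x₀ := mul_le_mul_of_nonneg_left h1 hν0.le
  linarith
end

/-- Long-time behavior when the ergodic constant is positive,
Theorem 4.1 (B)(ii) of the paper. -/
theorem stmt18 {N : ℕ} (hN : 1 ≤ N) (Ω : Set (Euc N))
    (hΩo : IsOpen Ω) (hΩb : Bornology.IsBounded Ω) (hΩc : IsConnected Ω)
    (hΩ2 : HasC2Boundary Ω)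
    (m : ℝ) (hm : 2 < m)
    (f u₀ g : Euc N → ℝ)
    (hf : ContinuousOn f (closure Ω)) (hu₀ : ContinuousOn u₀ (closure Ω))
    (hg : ContinuousOn g (frontier Ω))
    (hcomp : ∀ x ∈ frontier Ω, u₀ x = g x)
    (u : Euc N → ℝ → ℝ) (hu : IsGlobalParSol Ω f g u₀ 0 m u)
    (c : ℝ) (uInf : Euc N → ℝ)
    (hHol : HolderOnCl ((m - 2) / (m - 1)) (closure Ω) uInf)
    (hLip : LocLipIn Ω uInf)
    (hErg : IsSCSolution Ω (fun x => f x + c) 0 m uInf)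
    (hcpos : 0 < c) :
    (¬∃ w : Euc N → ℝ, ContinuousOn w (closure Ω) ∧
      (∃ C : ℝ, ∀ x ∈ closure Ω, |w x| ≤ C) ∧
      IsStatSub Ω f g 0 m w ∧ IsStatSuper Ω f g 0 m w) ∧
    (∃ C : ℝ, ∀ x ∈ closure Ω, ∀ t : ℝ, 0 ≤ t → |u x t + c * t| ≤ C) ∧
    ∃ K₁ : ℝ, TendstoUniformlyOn (fun t x => u x t + c * t)
      (fun x => uInf x + K₁) atTop (closure Ω) := by
  obtain ⟨ρ, hρ, hρ1, hρ2, hρ3⟩ := id hΩ2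
  have hm1 : 1 < m := by linarith
  have D : Dom Ω := ⟨hΩo, hΩb.isCompact_closure, hΩc.nonempty, fun x hx => cone hΩo hΩ2 hx⟩
  obtain ⟨fE, hfE, hfe⟩ := ext_cont isClosed_closure hf
  obtain ⟨uI, huI, hue⟩ := ext_cont isClosed_closure hErg.1
  obtain ⟨wE, hwE, hwe⟩ := ext_cont (isClosed_closure.prod isClosed_Ici)
    (f := fun p : SpT N => u p.1 p.2 + c * p.2) (hu.1.add (by fun_prop))
  have hFc : Continuous (fun x => fE x + c) := by fun_prop
  have hFe : ∀ x ∈ closure Ω, fE x + c = f x + c := fun x hx => by rw [hfe x hx]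
  have isub : ∀ a, SubP Ω m (fun x => fE x + c) (fun q => uI q.1) a :=
    stat_subP (f := fun x => f x + c) hΩo hue hFe (fun φ hφ x hx h => hErg.2.1 φ hφ x hx (h.on _))
  have isup : ∀ a, SupP Ω m (fun x => fE x + c) (fun q => uI q.1) a :=
    stat_supP (f := fun x => f x + c) hue hFe hErg.2.2
  have wsub : SubP Ω m (fun x => fE x + c) wE 0 := par_subP hΩo hwe hFe hu
  have wsup : ∀ p ∈ closure Ω ×ˢ Ioi (0 : ℝ), (p.1 ∈ frontier Ω → wE p < g p.1 + c * p.2) →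
      VSuperAt Ω m (fE p.1 + c) wE p := fun p hp hb => par_sup hΩo hwe hFe hu hp hb
  obtain ⟨Bi, hBi, hBi'⟩ := bdd_F D huI
  obtain ⟨B₀, hB₀⟩ := D.cpt.exists_bound_of_continuousOn hu₀
  obtain ⟨Bg, hBg⟩ := (D.cpt.of_isClosed_subset isClosed_frontier frontier_subset_closure).exists_bound_of_continuousOn hg
  have hB₀0 : 0 ≤ B₀ := by
    obtain ⟨x, hx⟩ := hΩc.nonempty
    exact (norm_nonneg _).trans (hB₀ x (subset_closure hx))
  have hw0 : ∀ x ∈ closure Ω, wE (x, 0) = u₀ x := by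
    intro x hx
    have h1 := (hu.2 1 one_pos).1.2.1 x hx
    have h2 := (hu.2 1 one_pos).2.2.1 x hx
    have h3 := hwe (x, 0) ⟨hx, mem_Ici.2 le_rfl⟩
    simp only [mul_zero, add_zero] at h3
    linarith
  set C₁ := Bi + B₀ + |Bg| with hC₁
  have hup : ∀ p ∈ closure Ω ×ˢ Ici (0 : ℝ), wE p ≤ uI p.1 + C₁ :=
    comp D hm1 hFc hwE (v := fun q => uI q.1) (by fun_prop) wsub (isup 0) (fun x hx => by
      rw [hw0 x hx]
      have h1 := (abs_le.1 (hB₀ x hx)).2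
      have h2 := (abs_le.1 (hBi' x hx)).1
      have h3 := abs_nonneg Bg
      simp only
      linarith)
  have hlo : ∀ p ∈ closure Ω ×ˢ Ici (0 : ℝ), uI p.1 - C₁ ≤ wE p := by
    refine comp0 D hm1 hFc (U := fun q => uI q.1 - C₁) (by fun_prop) hwE ?_ ?_ ?_
    · intro p hp φ hφ hmax
      refine isub 0 p hp φ hφ ?_
      filter_upwards [hmax] with q hq
      linarith
    · intro p hp hlt
      refine wsup p hp fun hfr => ?_
      have h1 := (abs_le.1 (hBg p.1 hfr)).1
      have h2 := (abs_le.1 (hBi' p.1 hp.1)).2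
      have h3 := le_abs_self Bg
      have h4 : 0 < c * p.2 := mul_pos hcpos hp.2
      linarith
    · intro x hx
      rw [hw0 x hx]
      have h1 := (abs_le.1 (hB₀ x hx)).1
      have h2 := (abs_le.1 (hBi' x hx)).2
      have h3 := abs_nonneg Bg
      simp only
      linarith
  set B := Bi + C₁ with hB
  have hC₁0 : 0 ≤ C₁ := by positivity
  have hB0 : 0 < B := by linarith
  have hwB : ∀ p ∈ closure Ω ×ˢ Ici (0 : ℝ), |wE p| ≤ B := by
    intro p hp
    have h1 := abs_le.1 (hBi' p.1 hp.1)
    have h2 := hup p hp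
    have h3 := hlo p hp
    rw [abs_le]
    exact ⟨by linarith [h1.1], by linarith [h1.2]⟩
  refine ⟨?_, ?_, ?_⟩
  · rintro ⟨w, hwc, -, hws, -⟩
    obtain ⟨w', hw', hwe'⟩ := ext_cont isClosed_closure hwc
    refine no_stat D hm1 hfE hcpos hw' huI ?_ (isup 0)
    exact stat_subP hΩo hwe' hfe (fun φ hφ x hx h => (hws.2 φ hφ x (subset_closure hx) (h.on _)).1 hx) 0
  · refine ⟨B, fun x hx t ht => ?_⟩
    have := hwB (x, t) ⟨hx, ht⟩
    rwa [hwe (x, t) ⟨hx, ht⟩] at this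
  · set ts := (B + |Bg|) / c with hts
    have hts0 : 0 ≤ ts := by positivity
    have hsup : SupP Ω m (fun x => fE x + c) wE ts := by
      intro p hp
      have hp2 : ts < p.2 := hp.2
      refine wsup p ⟨hp.1, mem_Ioi.2 (by linarith)⟩ fun hfr => ?_
      have h1 := (abs_le.1 (hwB p ⟨hp.1, mem_Ici.2 (by linarith)⟩)).2
      have h2 := (abs_le.1 (hBg p.1 hfr)).1
      have h3 := le_abs_self Bg
      have h4 : B + |Bg| < p.2 * c := (div_lt_iff₀ hcpos).1 hp2
      linarith
    have hlipE : LocLipIn Ω uI := by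
      intro x hx
      obtain ⟨ε, hε, K, hK, h⟩ := hLip x hx
      refine ⟨ε, hε, K, hK, fun y hy z hz => ?_⟩
      rw [hue y (subset_closure hy.2), hue z (subset_closure hz.2)]
      exact h y hy z hz
    have core : Core Ω m (fun x => fE x + c) (fun q => wE ((0, ts) + q)) uI B :=
      { D := D
        hm := hm
        hF := hFc
        hw := by fun_prop
        huI := huI
        wsub := subP_trans wsub (by linarith)
        wsup := supP_trans hsup (by linarith)
        isub := isub
        isup := isup
        hB := hB0
        wB := by
          rintro ⟨x, t⟩ ⟨hx, ht⟩
          have ht : 0 ≤ t := ht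
          refine hwB _ ⟨by simpa using hx, mem_Ici.2 ?_⟩
          simp only [Prod.snd_add]
          linarith
        iB := fun x hx => (hBi' x hx).trans (by linarith)
        lip := hlipE
        con := hΩc.isPreconnected }
    obtain ⟨K₁, hK⟩ := core_thm core hρ hρ1 hρ2 hρ3
    refine ⟨K₁, Metric.tendstoUniformlyOn_iff.2 fun ε hε => ?_⟩
    have ht : Tendsto (fun t : ℝ => t + -ts) atTop atTop := tendsto_atTop_add_const_right _ _ tendsto_id
    filter_upwards [ht.eventually (hK (ε / 2) (half_pos hε)), eventually_ge_atTop 0] with t h1 h2 x hx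
    have h3 := h1 x hx
    have e : (((0 : Euc N), ts) + (x, t + -ts) : SpT N) = (x, t) := by
      ext1
      · simp
      · simp
    rw [e, hwe (x, t) ⟨hx, h2⟩, hue x hx] at h3
    rw [dist_comm, Real.dist_eq, ← sub_sub]
    exact lt_of_le_of_lt h3 (half_lt_self hε)
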